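/- Let f ∈ L log L(𝕋²) and for n ≥ 1 define the modified quadratic partial sums S*_{nn}(x,y,f) = (1/π²) p.v. ∬_{𝕋²} [sin(nt) sin(ns) / (4 tan(t/2) tan(s/2))] f(x+t, y+s) dt ds. Then there is an absolute constant c > 0 such that for every λ > 0, |{(x,y) ∈ 𝕋² : bmo[S*_{nn}(x,y,f)] > λ}| ≤ (c/λ)·(1 + ∬_{𝕋²} |f| log⁺|f|). -/

import Mathlib

open MeasureTheory Filter Set

noncomputable section

/-- `[-π, π)`, a fundamental domain for the circle `𝕋 = ℝ/2πℤ`. -/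
def T1 : Set ℝ := Set.Ico (-Real.pi) Real.pi

/-- `[-π, π)²`, a fundamental domain for the torus `𝕋²`. -/
def T2 : Set (ℝ × ℝ) := T1 ×ˢ T1

/-- `log⁺ u = log u` for `u > 1`, and `0` otherwise. -/
def logPlus (u : ℝ) : ℝ := if 1 < u then Real.log u else 0

/-- `f` is `2π`-periodic in each variable. -/
def Biperiodic (f : ℝ × ℝ → ℝ) : Prop :=
  ∀ x y : ℝ, f (x + 2 * Real.pi, y) = f (x, y) ∧ f (x, y + 2 * Real.pi) = f (x, y)

/-- Fourier coefficients `f̂(m,n)` of a function on `𝕋²`. -/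
def fourierCoef2 (f : ℝ × ℝ → ℝ) (m n : ℤ) : ℂ :=
  (1 / (4 * (Real.pi : ℂ) ^ 2)) *
    ∫ p in T2, (f p : ℂ) * Complex.exp (-Complex.I * ((m : ℂ) * (p.1 : ℂ) + (n : ℂ) * (p.2 : ℂ)))

/-- Quadratic partial sums `S_{nn}(x, y, f)` of the double Fourier series.
(For real `f` the symmetric sum is real, so we take the real part.) -/
def Snn (f : ℝ × ℝ → ℝ) (n : ℕ) (x y : ℝ) : ℝ :=
  (∑ m ∈ Finset.Icc (-(n : ℤ)) (n : ℤ), ∑ k ∈ Finset.Icc (-(n : ℤ)) (n : ℤ),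
    fourierCoef2 f m k * Complex.exp (Complex.I * ((m : ℂ) * (x : ℂ) + (k : ℂ) * (y : ℂ)))).re

/-- The `BMO[0,1]` norm:
`‖g‖_BMO = sup_{I ⊂ [0,1]} (1/|I|) ∫_I |g - g_I| + |∫_0^1 g|`. -/
def bmoNorm (g : ℝ → ℝ) : ℝ :=
  (⨆ I : {p : ℝ × ℝ // 0 ≤ p.1 ∧ p.1 < p.2 ∧ p.2 ≤ 1},
      (I.1.2 - I.1.1)⁻¹ *
        ∫ t in Set.Icc I.1.1 I.1.2,
          |g t - (I.1.2 - I.1.1)⁻¹ * ∫ s in Set.Icc I.1.1 I.1.2, g s|) +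
    |∫ t in Set.Icc (0 : ℝ) 1, g t|

/-- The step function `Σ_{k=0}^n ξ_k 𝟙_{δ_k^n}` with `δ_k^n = [k/(n+1), (k+1)/(n+1)]`. -/
def stepFun (ξ : ℕ → ℝ) (n : ℕ) (t : ℝ) : ℝ :=
  ∑ k ∈ Finset.range (n + 1),
    Set.indicator (Set.Icc ((k : ℝ) / ((n : ℝ) + 1)) (((k : ℝ) + 1) / ((n : ℝ) + 1)))
      (fun _ => ξ k) t

/-- `bmo[ξ_n] = sup_{n ≥ 0} ‖Σ_{k=0}^n ξ_k 𝟙_{δ_k^n}‖_BMO`. -/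
def bmoSeq (ξ : ℕ → ℝ) : ℝ := ⨆ n : ℕ, bmoNorm (stepFun ξ n)

/-- `L` is the principal value `p.v. ∫_𝕋 g`, i.e. the limit as `ε → 0⁺` of the
integrals over `{ε < |t| < π}`. -/
def pvT1 (g : ℝ → ℝ) (L : ℝ) : Prop :=
  Filter.Tendsto (fun ε : ℝ => ∫ t in {t : ℝ | ε < |t| ∧ |t| < Real.pi}, g t)
    (nhdsWithin 0 (Set.Ioi 0)) (nhds L)

/-- `L` is the two-dimensional principal value `p.v. ∬_{𝕋²} g`, the limit as `ε → 0⁺`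
of the integrals over `{ε < |t| < π, ε < |s| < π}`. -/
def pvT2 (g : ℝ × ℝ → ℝ) (L : ℝ) : Prop :=
  Filter.Tendsto
    (fun ε : ℝ =>
      ∫ q in {q : ℝ × ℝ | (ε < |q.1| ∧ |q.1| < Real.pi) ∧ ε < |q.2| ∧ |q.2| < Real.pi}, g q)
    (nhdsWithin 0 (Set.Ioi 0)) (nhds L)

/-- Luxemburg norm with respect to a Young function `M`. -/
def luxNorm {α : Type*} [MeasurableSpace α] (μ : Measure α) (M : ℝ → ℝ) (g : α → ℝ) : ℝ :=
  sInf {lam : ℝ | 0 < lam ∧ ∫⁻ x, ENNReal.ofReal (M (|g x| / lam)) ∂μ ≤ 1}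

/-- The Young function `Φ(t) = t log⁺ t`. -/
def PhiY (t : ℝ) : ℝ := t * logPlus t

/-- The Young function `Ψ(t) = eᵗ - 1`. -/
def PsiY (t : ℝ) : ℝ := Real.exp t - 1

section Helpers
open scoped ENNReal

/-- Hardy-Littlewood bad set. -/
def HLset (H : ℝ → ℝ≥0∞) (l : ℝ) : Set ℝ :=
  {x | ∃ r : ℝ, 0 < r ∧ ENNReal.ofReal (2 * l * r) < ∫⁻ y in Metric.ball x r, H y}

lemma HLset_measure (H : ℝ → ℝ≥0∞) (l : ℝ) (hl : 0 < l) :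
    volume (HLset H l) ≤ ENNReal.ofReal (5 / l) * ∫⁻ y, H y := by
  by_cases hfin : ∫⁻ y, H y = ∞
  · rw [hfin, ENNReal.mul_top]
    · exact le_top
    · simp; positivity
  choose! r hr0 hr using fun (x : ℝ) (hx : x ∈ HLset H l) => hx
  have hrle : ∀ x ∈ HLset H l, r x ≤ (∫⁻ y, H y).toReal / (2 * l) := by
    intro x hx
    have h1 : ENNReal.ofReal (2 * l * r x) ≤ ∫⁻ y, H y :=
      (hr x hx).le.trans (setLIntegral_le_lintegral _ _)
    rw [ENNReal.ofReal_le_iff_le_toReal hfin] at h1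
    rw [le_div_iff₀ (by positivity)]
    linarith
  obtain ⟨u, hut, hdisj, hcov⟩ :=
    Vitali.exists_disjoint_subfamily_covering_enlargement_closedBall (HLset H l) (fun x => x) r _
      hrle 5 (by norm_num)
  have hucount : u.Countable := by
    apply hdisj.countable_of_nonempty_interior
    intro a ha
    rw [interior_closedBall _ (hr0 a (hut ha)).ne']
    exact ⟨a, Metric.mem_ball_self (hr0 a (hut ha))⟩
  have hsub : HLset H l ⊆ ⋃ b ∈ u, Metric.closedBall b (5 * r b) := by
    intro x hx
    obtain ⟨b, hb, hbs⟩ := hcov x hx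
    exact mem_biUnion hb (hbs (Metric.mem_closedBall_self (hr0 x hx).le))
  calc volume (HLset H l) ≤ volume (⋃ b ∈ u, Metric.closedBall b (5 * r b)) := measure_mono hsub
    _ ≤ ∑' b : u, volume (Metric.closedBall (b : ℝ) (5 * r b)) := measure_biUnion_le _ hucount _
    _ ≤ ∑' b : u, ENNReal.ofReal (5 / l) * ∫⁻ y in Metric.closedBall (b : ℝ) (r b), H y := by
        refine ENNReal.tsum_le_tsum fun b => ?_
        rw [Real.volume_closedBall]
        have h2 := (hr b (hut b.2)).le
        calc ENNReal.ofReal (2 * (5 * r b)) = ENNReal.ofReal (5 / l) * ENNReal.ofReal (2 * l * r b) := by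
              rw [← ENNReal.ofReal_mul (by positivity)]
              congr 1; field_simp
          _ ≤ _ := by
              gcongr
              exact h2.trans (lintegral_mono_set Metric.ball_subset_closedBall)
    _ = ENNReal.ofReal (5 / l) * ∑' b : u, ∫⁻ y in Metric.closedBall (b : ℝ) (r b), H y :=
        ENNReal.tsum_mul_left
    _ = ENNReal.ofReal (5 / l) * ∫⁻ y in ⋃ b ∈ u, Metric.closedBall (b : ℝ) (r b), H y := by
        rw [lintegral_biUnion hucount (fun b _ => measurableSet_closedBall) hdisj]
    _ ≤ _ := by gcongr; exact Measure.restrict_le_self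

/-- decay profile -/
def psi (w : ℝ) : ℝ := if |w| ≤ 1 then 1 else 1 / (|w| * √|w|)

lemma psi_nonneg (w : ℝ) : 0 ≤ psi w := by
  unfold psi; split_ifs <;> positivity

lemma psi_neg (w : ℝ) : psi (-w) = psi w := by simp [psi]

@[fun_prop]
lemma measurable_psi : Measurable psi := by
  unfold psi
  refine Measurable.ite ?_ measurable_const (by fun_prop)
  exact measurableSet_le (by fun_prop) measurable_const

def pker (N : ℕ) (t : ℝ) : ℝ≥0∞ := ENNReal.ofReal (N * psi (N * t))

@[fun_prop]
lemma measurable_pker (N : ℕ) : Measurable (pker N) := by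
  unfold pker; fun_prop

lemma pker_neg (N : ℕ) (t : ℝ) : pker N (-t) = pker N t := by
  simp [pker, psi_neg]

lemma psi_layer (w : ℝ) : ∃ k : ℕ, |w| < 2 ^ (k + 1) ∧ psi w ≤ (3 / 8) ^ k := by
  unfold psi
  split_ifs with h
  · exact ⟨0, by norm_num; linarith, by norm_num⟩
  · push Not at h
    obtain ⟨k, hk1, hk2⟩ := exists_nat_pow_near h.le (by norm_num : (1 : ℝ) < 2)
    refine ⟨k, hk2, ?_⟩
    have h1 : (8 / 3 : ℝ) ^ k ≤ |w| * √|w| := by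
      have h3 : ((8 / 3 : ℝ) ^ k) ^ 2 ≤ (|w| * √|w|) ^ 2 := by
        have : (|w| * √|w|) ^ 2 = |w| ^ 3 := by
          rw [mul_pow, Real.sq_sqrt (abs_nonneg w)]; ring
        rw [this]
        calc ((8 / 3 : ℝ) ^ k) ^ 2 = ((8 / 3 : ℝ) ^ 2) ^ k := by rw [← pow_mul, ← pow_mul, mul_comm]
          _ ≤ (2 ^ 3) ^ k := by gcongr; norm_num
          _ = (2 ^ k) ^ 3 := by rw [← pow_mul, ← pow_mul, mul_comm]
          _ ≤ |w| ^ 3 := by gcongr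
      exact le_of_sq_le_sq h3 (by positivity)
    rw [div_le_iff₀ (by positivity)]
    calc (1 : ℝ) = (3 / 8) ^ k * (8 / 3) ^ k := by rw [← mul_pow]; norm_num
      _ ≤ _ := by gcongr

lemma pker_layer (N : ℕ) (hN : 1 ≤ N) (t : ℝ) :
    pker N t ≤ ∑' k : ℕ, ENNReal.ofReal (N * (3 / 8) ^ k) *
      (Metric.ball (0 : ℝ) (2 ^ (k + 1) / N)).indicator 1 t := by
  obtain ⟨k, hk1, hk2⟩ := psi_layer (N * t)
  refine le_trans ?_ (ENNReal.le_tsum k)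
  have hN' : (0 : ℝ) < N := by exact_mod_cast hN
  have : t ∈ Metric.ball (0 : ℝ) (2 ^ (k + 1) / N) := by
    rw [mem_ball_zero_iff, Real.norm_eq_abs, lt_div_iff₀ hN']
    rw [abs_mul, abs_of_pos hN'] at hk1
    linarith
  rw [indicator_of_mem this]
  simp only [Pi.one_apply, mul_one]
  unfold pker
  gcongr

/-- growth lemma -/
lemma pker_growth (N : ℕ) (hN : 1 ≤ N) (H : ℝ → ℝ≥0∞) (hH : Measurable H) (z l d : ℝ) (hl : 0 ≤ l)
    (hd : 0 ≤ d)
    (hg : ∀ r : ℝ, 0 < r → ∫⁻ y in Metric.ball z r, H y ≤ ENNReal.ofReal (2 * l * (r + d))) :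
    ∫⁻ t, pker N t * H (z + t) ≤ ENNReal.ofReal (16 * l * (1 + N * d)) := by
  have hN' : (0 : ℝ) < N := by exact_mod_cast hN
  have key : ∀ r : ℝ, ∫⁻ t, (Metric.ball (0 : ℝ) r).indicator 1 t * H (z + t)
      = ∫⁻ y in Metric.ball z r, H y := by
    intro r
    rw [← lintegral_indicator measurableSet_ball,
      ← lintegral_add_left_eq_self (μ := volume) ((Metric.ball z r).indicator H) z]
    congr 1; ext t
    by_cases ht : t ∈ Metric.ball (0 : ℝ) r
    · have : z + t ∈ Metric.ball z r := by simpa using ht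
      rw [indicator_of_mem ht, indicator_of_mem this]; simp
    · have : z + t ∉ Metric.ball z r := by simpa using ht
      rw [indicator_of_notMem ht, indicator_of_notMem this]; simp
  calc ∫⁻ t, pker N t * H (z + t)
      ≤ ∫⁻ t, ∑' k : ℕ, ENNReal.ofReal (N * (3 / 8) ^ k) *
        ((Metric.ball (0 : ℝ) (2 ^ (k + 1) / N)).indicator 1 t * H (z + t)) := by
        refine lintegral_mono fun t => ?_
        simp_rw [← mul_assoc]
        rw [ENNReal.tsum_mul_right]
        gcongr
        exact pker_layer N hN t
    _ = ∑' k : ℕ, ENNReal.ofReal (N * (3 / 8) ^ k) *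
        ∫⁻ y in Metric.ball z (2 ^ (k + 1) / N), H y := by
        rw [lintegral_tsum]
        · congr 1; ext k
          rw [lintegral_const_mul, key]
          refine Measurable.mul ?_ (by fun_prop)
          exact measurable_one.indicator measurableSet_ball
        · intro k
          refine (Measurable.const_mul (Measurable.mul ?_ (by fun_prop)) _).aemeasurable
          exact measurable_one.indicator measurableSet_ball
    _ ≤ ∑' k : ℕ, ENNReal.ofReal (4 * l * (3 / 4) ^ k + 2 * l * N * d * (3 / 8) ^ k) := by
        refine ENNReal.tsum_le_tsum fun k => ?_
        calc _ ≤ ENNReal.ofReal (N * (3 / 8) ^ k) * ENNReal.ofReal (2 * l * (2 ^ (k + 1) / N + d)) := by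
              gcongr; exact hg _ (by positivity)
          _ = _ := by
              rw [← ENNReal.ofReal_mul (by positivity)]
              congr 1
              have : (3 / 4 : ℝ) ^ k = (3 / 8) ^ k * 2 ^ k := by rw [← mul_pow]; norm_num
              rw [this]; field_simp; ring
    _ ≤ _ := by
        have h1 : HasSum (fun k : ℕ => 4 * l * (3 / 4 : ℝ) ^ k + 2 * l * N * d * (3 / 8) ^ k)
            (4 * l * (1 - 3 / 4)⁻¹ + 2 * l * N * d * (1 - 3 / 8)⁻¹) :=
          ((hasSum_geometric_of_lt_one (by norm_num) (by norm_num)).mul_left _).add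
            ((hasSum_geometric_of_lt_one (by norm_num) (by norm_num)).mul_left _)
        rw [← ENNReal.ofReal_tsum_of_nonneg (fun k => by positivity) h1.summable, h1.tsum_eq]
        apply ENNReal.ofReal_le_ofReal
        have : 0 ≤ l * (N * d) := by positivity
        norm_num
        nlinarith

def AA (N : ℕ) (h : ℝ → ℝ≥0∞) (x : ℝ) : ℝ≥0∞ :=
  ∫⁻ t in Ioo (-Real.pi) Real.pi, pker N t * h (x + t)

def farSet (M : ℕ) : Set ℝ := {u | 1 / (M : ℝ) < |u| ∧ |u| < Real.pi}

lemma measurableSet_farSet (M : ℕ) : MeasurableSet (farSet M) :=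
  (measurableSet_lt measurable_const continuous_abs.measurable).inter
    (measurableSet_lt continuous_abs.measurable measurable_const)

def QQ (M : ℕ) (h : ℝ → ℝ≥0∞) (x : ℝ) : ℝ≥0∞ :=
  ∫⁻ u in farSet M, ENNReal.ofReal (1 / (M * u ^ 2)) * h (x + u) * AA M h (x + u)

lemma lint_tail (v d : ℝ) (hd : 0 ≤ d) (S : Set ℝ) (hS : ∀ x ∈ S, d ≤ |x - v|) :
    ∫⁻ x in S, ENNReal.ofReal (d / (x - v) ^ 2) ≤ 2 := by
  rcases hd.eq_or_lt with rfl | hd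
  · simp
  have hsub : S ⊆ (Ici (v + d)) ∪ (Iic (v - d)) := by
    intro x hx
    have := hS x hx
    rcases le_abs.1 this with h | h
    · left; simp; linarith
    · right; simp; linarith
  have h0 : ∫⁻ y in Ioi d, ENNReal.ofReal (d / y ^ 2) = 1 := by
    have hi : IntegrableOn (fun y : ℝ => d * y ^ (-2 : ℝ)) (Ioi d) :=
      (integrableOn_Ioi_rpow_of_lt (by norm_num) hd).const_mul d
    have h2 : ∫ y in Ioi d, d * y ^ (-2 : ℝ) = 1 := by
      rw [integral_const_mul, integral_Ioi_rpow_of_lt (by norm_num) hd]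
      norm_num [Real.rpow_neg_one]
      field_simp
    rw [← ENNReal.ofReal_one, ← h2, ofReal_integral_eq_lintegral_ofReal hi]
    · refine setLIntegral_congr_fun measurableSet_Ioi fun y hy => ?_
      have : 0 < y := hd.trans hy
      rw [Real.rpow_neg this.le]
      norm_num [div_eq_mul_inv]
    · refine (ae_restrict_iff' measurableSet_Ioi).2 (.of_forall fun y hy => ?_)
      have : 0 < y := hd.trans hy
      simp only [Pi.zero_apply]
      positivity
  have hA : ∫⁻ x in Ici (v + d), ENNReal.ofReal (d / (x - v) ^ 2) = 1 := by
    rw [setLIntegral_congr Ioi_ae_eq_Ici.symm, ← h0, ← lintegral_indicator measurableSet_Ioi,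
      ← lintegral_indicator measurableSet_Ioi,
      ← lintegral_add_left_eq_self (μ := volume) ((Ioi (v + d)).indicator _) v]
    congr 1; ext y
    by_cases hy : y ∈ Ioi d
    · rw [indicator_of_mem hy, indicator_of_mem (by simpa using hy)]; simp
    · rw [indicator_of_notMem hy, indicator_of_notMem (by simpa using hy)]
  have hB : ∫⁻ x in Iic (v - d), ENNReal.ofReal (d / (x - v) ^ 2) = 1 := by
    rw [setLIntegral_congr Iio_ae_eq_Iic.symm, ← h0, ← lintegral_indicator measurableSet_Iio,
      ← lintegral_indicator measurableSet_Ioi,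
      ← lintegral_sub_left_eq_self (μ := volume) ((Iio (v - d)).indicator _) v]
    congr 1; ext y
    by_cases hy : y ∈ Ioi d
    · rw [indicator_of_mem hy, indicator_of_mem (by simpa using hy)]; simp
    · rw [indicator_of_notMem hy, indicator_of_notMem (by simpa using hy)]
  calc _ ≤ ∫⁻ x in (Ici (v + d)) ∪ (Iic (v - d)), ENNReal.ofReal (d / (x - v) ^ 2) :=
        lintegral_mono_set hsub
    _ ≤ _ + _ := lintegral_union_le _ _ _
    _ = 2 := by rw [hA, hB]; norm_num

/-- The main one-dimensional estimate, on the line. -/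
lemma line_weak (H : ℝ → ℝ≥0∞) (hH : Measurable H) (l : ℝ) (hl : 0 < l) :
    ∃ B : Set ℝ, volume B ≤ ENNReal.ofReal (7 / l) * ∫⁻ y, H y ∧ ∀ x ∉ B, ∀ N : ℕ, 1 ≤ N →
      ∫⁻ t, pker N t * H (x + t) ≤ ENNReal.ofReal (16 * l) ∧
      ∫⁻ u in {u : ℝ | 1 / (N : ℝ) < |u|}, ENNReal.ofReal (1 / (N * u ^ 2)) * H (x + u) *
        (∫⁻ t, pker N t * H (x + u + t)) ≤ ENNReal.ofReal (528 * l ^ 2) := by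
  by_cases hfin : ∫⁻ y, H y = ∞
  · refine ⟨univ, ?_, by simp⟩
    rw [hfin, ENNReal.mul_top]
    · exact le_top
    · simp; positivity
  set E := HLset H l with hE
  have hEm := HLset_measure H l hl
  have hEne : (Eᶜ).Nonempty := by
    by_contra hne
    rw [not_nonempty_iff_eq_empty, compl_empty_iff] at hne
    rw [← hE, hne] at hEm
    simp only [Real.volume_univ, top_le_iff] at hEm
    exact ENNReal.mul_ne_top ENNReal.ofReal_ne_top hfin hEm
  set δ : ℝ → ℝ := fun v => Metric.infDist v Eᶜ with hδ
  have hδm : Measurable δ := (Metric.continuous_infDist_pt _).measurable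
  set m : ℝ → ℝ≥0∞ := fun x => ∫⁻ v, H v * ENNReal.ofReal (δ v / (x - v) ^ 2) with hm
  have hmm : Measurable m := by
    apply Measurable.lintegral_prod_right'
      (f := fun q : ℝ × ℝ => H q.2 * ENNReal.ofReal (δ q.2 / (q.1 - q.2) ^ 2))
    fun_prop
  have hmint : ∫⁻ x in Eᶜ, m x ≤ 2 * ∫⁻ y, H y := by
    rw [hm, lintegral_lintegral_swap]
    · rw [← lintegral_const_mul _ hH]
      refine lintegral_mono fun v => ?_
      rw [lintegral_const_mul _ (by fun_prop), mul_comm]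
      gcongr
      refine lint_tail v _ Metric.infDist_nonneg _ fun x hx => ?_
      have := Metric.infDist_le_dist_of_mem (x := v) hx
      rwa [Real.dist_eq, abs_sub_comm] at this
    · fun_prop
  have hball : ∀ z ∉ E, ∀ r : ℝ, 0 < r →
      ∫⁻ y in Metric.ball z r, H y ≤ ENNReal.ofReal (2 * l * r) := by
    intro z hz r hr
    by_contra! hc
    exact hz ⟨r, hr, hc⟩
  have hB2 : volume ({x | ENNReal.ofReal l ≤ m x} ∩ Eᶜ) ≤ ENNReal.ofReal (2 / l) * ∫⁻ y, H y := by
    have h1 := mul_meas_ge_le_lintegral (μ := volume.restrict Eᶜ) hmm (ENNReal.ofReal l)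
    rw [Measure.restrict_apply (measurableSet_le measurable_const hmm)] at h1
    have h2 := h1.trans hmint
    have h3 : ENNReal.ofReal (1 / l) * (ENNReal.ofReal l * volume ({x | ENNReal.ofReal l ≤ m x} ∩ Eᶜ))
        ≤ ENNReal.ofReal (1 / l) * (2 * ∫⁻ y, H y) := by gcongr
    rw [← mul_assoc, ← ENNReal.ofReal_mul (by positivity)] at h3
    have h4 : 1 / l * l = 1 := by field_simp
    rw [h4, ENNReal.ofReal_one, one_mul] at h3
    refine h3.trans (le_of_eq ?_)
    rw [← mul_assoc, ← ENNReal.ofReal_ofNat, ← ENNReal.ofReal_mul (by positivity)]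
    congr 2; ring
  refine ⟨E ∪ ({x | ENNReal.ofReal l ≤ m x} ∩ Eᶜ), ?_, ?_⟩
  · calc _ ≤ volume E + _ := measure_union_le _ _
      _ ≤ ENNReal.ofReal (5 / l) * (∫⁻ y, H y) + ENNReal.ofReal (2 / l) * ∫⁻ y, H y :=
        add_le_add hEm hB2
      _ = _ := by
        rw [← add_mul, ← ENNReal.ofReal_add (by positivity) (by positivity)]
        congr 2; ring
  intro x hx N hN
  have hN' : (0 : ℝ) < N := by exact_mod_cast hN
  simp only [mem_union, mem_inter_iff, mem_ofPred_eq, mem_compl_iff, not_or, not_and, not_not] at hx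
  obtain ⟨hxE, hx2⟩ := hx
  have hmx : m x ≤ ENNReal.ofReal l := by
    by_contra! hc
    exact hxE (hx2 hc.le)
  have first : ∫⁻ t, pker N t * H (x + t) ≤ ENNReal.ofReal (16 * l) := by
    have := pker_growth N hN H hH x l 0 hl.le le_rfl (by simpa using hball x hxE)
    simpa using this
  refine ⟨first, ?_⟩
  have inner : ∀ v : ℝ, ∫⁻ t, pker N t * H (v + t) ≤
      ENNReal.ofReal (32 * l) + ENNReal.ofReal (16 * l * N) * ENNReal.ofReal (δ v) := by
    intro v
    have hδ0 : 0 ≤ δ v := Metric.infDist_nonneg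
    have hlt : δ v < δ v + 1 / N := by
      have : 0 < 1 / (N : ℝ) := by positivity
      linarith
    obtain ⟨z, hz, hzd⟩ := (Metric.infDist_lt_iff hEne).1 hlt
    have := pker_growth N hN H hH v l (δ v + 1 / N) hl.le (by positivity) (by
      intro r hr
      calc _ ≤ ∫⁻ y in Metric.ball z (r + (δ v + 1 / N)), H y :=
            lintegral_mono_set (Metric.ball_subset_ball' (by linarith))
        _ ≤ _ := hball z hz _ (by positivity))
    refine this.trans (le_of_eq ?_)
    rw [← ENNReal.ofReal_mul (by positivity), ← ENNReal.ofReal_add (by positivity) (by positivity)]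
    congr 1; field_simp; ring
  calc _ ≤ ∫⁻ u in {u : ℝ | 1 / (N : ℝ) < |u|}, (ENNReal.ofReal (32 * l) * (pker N u * H (x + u)) +
        ENNReal.ofReal (16 * l) * (H (x + u) * ENNReal.ofReal (δ (x + u) / (x - (x + u)) ^ 2))) := by
        refine setLIntegral_mono (by fun_prop) fun u hu => ?_
        have hu' : 1 / (N : ℝ) < |u| := hu
        have hu0 : 0 < |u| := lt_trans (by positivity) hu'
        have hu2 : 0 < u ^ 2 := by rw [← sq_abs]; positivity
        have hk : ENNReal.ofReal (1 / (N * u ^ 2)) ≤ pker N u := by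
          unfold pker
          apply ENNReal.ofReal_le_ofReal
          have h1 : 1 < |(N : ℝ) * u| := by
            rw [abs_mul, abs_of_pos hN']
            rw [div_lt_iff₀ hN'] at hu'
            linarith
          unfold psi
          rw [if_neg (by linarith)]
          have h2 : √|(N : ℝ) * u| ≤ |(N : ℝ) * u| := by
            rw [Real.sqrt_le_left (by linarith)]
            nlinarith
          have h3 : 0 < √|(N : ℝ) * u| := Real.sqrt_pos.2 (by linarith)
          calc 1 / (N * u ^ 2) = N * (1 / (|(N : ℝ) * u| * |(N : ℝ) * u|)) := by
                rw [← sq, sq_abs]; field_simp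
            _ ≤ _ := by gcongr
        calc _ ≤ ENNReal.ofReal (1 / (N * u ^ 2)) * H (x + u) *
              (ENNReal.ofReal (32 * l) + ENNReal.ofReal (16 * l * N) * ENNReal.ofReal (δ (x + u))) := by
              gcongr; exact inner _
          _ = ENNReal.ofReal (32 * l) * (ENNReal.ofReal (1 / (N * u ^ 2)) * H (x + u)) +
              ENNReal.ofReal (1 / (N * u ^ 2)) * ENNReal.ofReal (16 * l * N) *
                ENNReal.ofReal (δ (x + u)) * H (x + u) := by ring
          _ ≤ _ := by
              refine add_le_add (by gcongr) (le_of_eq ?_)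
              have hδ0 : 0 ≤ δ (x + u) := Metric.infDist_nonneg
              rw [← ENNReal.ofReal_mul (by positivity), ← ENNReal.ofReal_mul (by positivity),
                mul_comm (H (x + u)), ← mul_assoc (ENNReal.ofReal (16 * l)), ← ENNReal.ofReal_mul (by positivity)]
              congr 2
              have : x - (x + u) = -u := by ring
              rw [this]
              field_simp
    _ ≤ ∫⁻ u, (ENNReal.ofReal (32 * l) * (pker N u * H (x + u)) +
        ENNReal.ofReal (16 * l) * (H (x + u) * ENNReal.ofReal (δ (x + u) / (x - (x + u)) ^ 2))) :=
        setLIntegral_le_lintegral _ _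
    _ = ENNReal.ofReal (32 * l) * (∫⁻ u, pker N u * H (x + u)) + ENNReal.ofReal (16 * l) * m x := by
        rw [lintegral_add_left (by fun_prop), lintegral_const_mul _ (by fun_prop),
          lintegral_const_mul _ (by fun_prop)]
        congr 2
        exact lintegral_add_left_eq_self (μ := volume)
          (fun v => H v * ENNReal.ofReal (δ v / (x - v) ^ 2)) x
    _ ≤ ENNReal.ofReal (32 * l) * ENNReal.ofReal (16 * l) + ENNReal.ofReal (16 * l) * ENNReal.ofReal l := by
        gcongr
    _ = _ := by
        rw [← ENNReal.ofReal_mul (by positivity), ← ENNReal.ofReal_mul (by positivity),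
          ← ENNReal.ofReal_add (by positivity) (by positivity)]
        congr 1; ring

lemma per_lint (h : ℝ → ℝ≥0∞) (hp : Function.Periodic h (2 * Real.pi)) (a b : ℝ) :
    ∫⁻ x in Ico a (a + 2 * Real.pi), h x = ∫⁻ x in Ico b (b + 2 * Real.pi), h x := by
  have hT : 0 < 2 * Real.pi := by positivity
  rw [setLIntegral_congr Ico_ae_eq_Ioc, setLIntegral_congr Ico_ae_eq_Ioc]
  exact (isAddFundamentalDomain_Ioc hT a).setLIntegral_eq (isAddFundamentalDomain_Ioc hT b) h
    hp.map_vadd_zmultiples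

lemma T1_eq : T1 = Ico (-Real.pi) (-Real.pi + 2 * Real.pi) := by
  unfold T1; congr 1; ring

lemma per_lint_T1 (h : ℝ → ℝ≥0∞) (hp : Function.Periodic h (2 * Real.pi)) (a : ℝ) :
    ∫⁻ x in Ico a (a + 2 * Real.pi), h x = ∫⁻ x in T1, h x := by
  rw [T1_eq]; exact per_lint h hp _ _

lemma per_lint_shift (h : ℝ → ℝ≥0∞) (hp : Function.Periodic h (2 * Real.pi)) (a : ℝ) :
    ∫⁻ x in T1, h (a + x) = ∫⁻ x in T1, h x := by
  rw [← per_lint_T1 h hp (a - Real.pi), T1_eq, ← lintegral_indicator measurableSet_Ico,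
    ← lintegral_indicator measurableSet_Ico,
    ← lintegral_add_left_eq_self (μ := volume) ((Ico (a - Real.pi) _).indicator h) a]
  congr 1; ext x
  by_cases hx : x ∈ Ico (-Real.pi) (-Real.pi + 2 * Real.pi)
  · rw [indicator_of_mem hx, indicator_of_mem]
    constructor <;> linarith [hx.1, hx.2]
  · rw [indicator_of_notMem hx, indicator_of_notMem]
    intro h'
    exact hx ⟨by linarith [h'.1], by linarith [h'.2]⟩

lemma T1_ae_Ioo : (T1 : Set ℝ) =ᵐ[volume] Ioo (-Real.pi) Real.pi := by
  unfold T1; exact Ioo_ae_eq_Ico.symm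

lemma per_weak (h : ℝ → ℝ≥0∞) (hm : Measurable h) (hp : Function.Periodic h (2 * Real.pi))
    (l : ℝ) (hl : 0 < l) :
    volume {x | x ∈ T1 ∧ ∃ N : ℕ, 1 ≤ N ∧
      (ENNReal.ofReal (16 * l) < AA N h x ∨ ENNReal.ofReal (528 * l ^ 2) < QQ N h x)} ≤
      ENNReal.ofReal (28 / l) * ∫⁻ x in T1, h x := by
  have hpi := Real.pi_pos
  set J : Set ℝ := Ico (-(4 * Real.pi)) (4 * Real.pi) with hJ
  set H := J.indicator h with hH
  have hHm : Measurable H := hm.indicator measurableSet_Ico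
  obtain ⟨B, hB, hBx⟩ := line_weak H hHm l hl
  have hintH : ∫⁻ y, H y ≤ 4 * ∫⁻ x in T1, h x := by
    rw [hH, lintegral_indicator measurableSet_Ico]
    have hsub : J ⊆ (Ico (-(4 * Real.pi)) (-(4 * Real.pi) + 2 * Real.pi) ∪
        Ico (-(2 * Real.pi)) (-(2 * Real.pi) + 2 * Real.pi)) ∪
        (Ico 0 (0 + 2 * Real.pi) ∪ Ico (2 * Real.pi) (2 * Real.pi + 2 * Real.pi)) := by
      intro x hx
      simp only [mem_union, mem_Ico]
      have h1 := hx.1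
      have h2 := hx.2
      rcases lt_or_ge x 0 with h | h
      · rcases lt_or_ge x (-(2 * Real.pi)) with h' | h'
        · left; left; constructor <;> linarith
        · left; right; constructor <;> linarith
      · rcases lt_or_ge x (2 * Real.pi) with h' | h'
        · right; left; constructor <;> linarith
        · right; right; constructor <;> linarith
    refine (lintegral_mono_set hsub).trans ((lintegral_union_le _ _ _).trans
      ((add_le_add (lintegral_union_le _ _ _) (lintegral_union_le _ _ _)).trans ?_))
    simp only [per_lint_T1 h hp]
    refine le_of_eq ?_
    ring
  have hAle : ∀ N : ℕ, ∀ z : ℝ, |z| ≤ 2 * Real.pi → AA N h z ≤ ∫⁻ t, pker N t * H (z + t) := by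
    intro N z hz
    unfold AA
    rw [← lintegral_indicator measurableSet_Ioo]
    refine lintegral_mono fun t => ?_
    by_cases ht : t ∈ Ioo (-Real.pi) Real.pi
    · rw [indicator_of_mem ht]
      have : z + t ∈ J := by
        have := abs_le.1 hz
        constructor <;> linarith [ht.1, ht.2]
      rw [hH, indicator_of_mem this]
    · rw [indicator_of_notMem ht]; simp
  have hsub : {x | x ∈ T1 ∧ ∃ N : ℕ, 1 ≤ N ∧
      (ENNReal.ofReal (16 * l) < AA N h x ∨ ENNReal.ofReal (528 * l ^ 2) < QQ N h x)} ⊆ B := by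
    rintro x ⟨hxT, N, hN, hor⟩
    by_contra hxB
    obtain ⟨h1, h2⟩ := hBx x hxB N hN
    have hx1 : |x| ≤ Real.pi := abs_le.2 ⟨hxT.1, hxT.2.le⟩
    rcases hor with hor | hor
    · exact absurd ((hAle N x (by linarith)).trans h1) (not_le.2 hor)
    · refine absurd (le_trans ?_ h2) (not_le.2 hor)
      unfold QQ
      refine le_trans (setLIntegral_mono' (measurableSet_farSet N) fun u hu => ?_)
        (lintegral_mono_set fun u hu => hu.1)
      have hu1 : |x + u| ≤ 2 * Real.pi := (abs_add_le _ _).trans (by linarith [hu.2])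
      have : x + u ∈ J := by
        have := abs_le.1 hu1
        constructor <;> linarith
      have hh : H (x + u) = h (x + u) := by rw [hH, indicator_of_mem this]
      rw [hh]
      gcongr
      exact hAle N _ hu1
  refine (measure_mono hsub).trans (hB.trans ?_)
  calc _ ≤ ENNReal.ofReal (7 / l) * (4 * ∫⁻ x in T1, h x) := by gcongr
    _ = _ := by
      rw [← mul_assoc, ← ENNReal.ofReal_ofNat, ← ENNReal.ofReal_mul (by positivity)]
      congr 2; ring

lemma per_weak_AA (h : ℝ → ℝ≥0∞) (hm : Measurable h) (hp : Function.Periodic h (2 * Real.pi))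
    (l : ℝ) (hl : 0 < l) :
    volume {x | x ∈ T1 ∧ ∃ N : ℕ, 1 ≤ N ∧ ENNReal.ofReal l < AA N h x} ≤
      ENNReal.ofReal (500 / l) * ∫⁻ x in T1, h x := by
  have := per_weak h hm hp (l / 16) (by positivity)
  calc _ ≤ _ := measure_mono (by
        rintro x ⟨hx, N, hN, h1⟩
        exact ⟨hx, N, hN, Or.inl (by convert h1 using 2; ring)⟩)
    _ ≤ _ := this
    _ ≤ _ := by
        have h5 : 28 / (l / 16) ≤ 500 / l := by rw [div_div_eq_mul_div]; gcongr; norm_num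
        exact mul_le_mul' (ENNReal.ofReal_le_ofReal h5) le_rfl

lemma per_weak_QQ (h : ℝ → ℝ≥0∞) (hm : Measurable h) (hp : Function.Periodic h (2 * Real.pi))
    (l : ℝ) (hl : 0 < l) :
    volume {x | x ∈ T1 ∧ ∃ N : ℕ, 1 ≤ N ∧ ENNReal.ofReal (l ^ 2) < QQ N h x} ≤
      ENNReal.ofReal (700 / l) * ∫⁻ x in T1, h x := by
  have := per_weak h hm hp (l / 25) (by positivity)
  calc _ ≤ _ := measure_mono (by
        rintro x ⟨hx, N, hN, h1⟩
        refine ⟨hx, N, hN, Or.inr (lt_of_le_of_lt (ENNReal.ofReal_le_ofReal ?_) h1)⟩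
        have := sq_nonneg l
        nlinarith)
    _ ≤ _ := this
    _ ≤ _ := by
        have h5 : 28 / (l / 25) ≤ 700 / l := by rw [div_div_eq_mul_div]; gcongr; norm_num
        exact mul_le_mul' (ENNReal.ofReal_le_ofReal h5) le_rfl

lemma measurable_AA (N : ℕ) (h : ℝ → ℝ≥0∞) (hm : Measurable h) : Measurable (AA N h) := by
  unfold AA
  have : Measurable (fun p : ℝ × ℝ => pker N p.2 * h (p.1 + p.2)) :=
    ((measurable_pker N).comp measurable_snd).mul (hm.comp (measurable_fst.add measurable_snd))
  exact Measurable.lintegral_prod_right' (ν := volume.restrict (Ioo (-Real.pi) Real.pi)) this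

/-- sup over `N ≥ 1` of `AA N`. -/
def AS (h : ℝ → ℝ≥0∞) (x : ℝ) : ℝ≥0∞ := ⨆ N : ℕ, AA (N + 1) h x

lemma measurable_AS (h : ℝ → ℝ≥0∞) (hm : Measurable h) : Measurable (AS h) :=
  Measurable.iSup fun N => measurable_AA _ h hm

lemma AA_le_AS (N : ℕ) (hN : 1 ≤ N) (h : ℝ → ℝ≥0∞) (x : ℝ) : AA N h x ≤ AS h x := by
  obtain ⟨k, rfl⟩ := Nat.exists_eq_add_of_le' hN
  exact le_iSup (fun N => AA (N + 1) h x) k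

lemma AA_const (N : ℕ) (hN : 1 ≤ N) (l : ℝ) (hl : 0 ≤ l) (x : ℝ) :
    AA N (fun _ => ENNReal.ofReal l) x ≤ ENNReal.ofReal (16 * l) := by
  have := pker_growth N hN (fun _ => ENNReal.ofReal l) measurable_const x l 0 hl le_rfl (by
    intro r hr
    rw [setLIntegral_const, Real.volume_ball, ← ENNReal.ofReal_mul hl]
    apply ENNReal.ofReal_le_ofReal; nlinarith)
  simp only [mul_zero, add_zero, mul_one] at this
  exact (setLIntegral_le_lintegral _ _).trans this

lemma AA_add_le (N : ℕ) (a b h : ℝ → ℝ≥0∞) (ha : Measurable a) (hab : ∀ x, h x ≤ a x + b x) (x : ℝ) :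
    AA N h x ≤ AA N a x + AA N b x := by
  unfold AA
  rw [← lintegral_add_left]
  · refine lintegral_mono fun t => ?_
    rw [← mul_add]; gcongr; exact hab _
  · exact (measurable_pker N).mul (ha.comp (measurable_const_add x))

lemma level_sum (x : ℝ≥0∞) :
    x ≤ 17 + ∑' k : ℕ, if 17 * 2 ^ k < x then (17 * 2 ^ k : ℝ≥0∞) else 0 := by
  have key : ∀ n : ℕ, (∀ k < n, 17 * 2 ^ k < x) →
      (17 * 2 ^ n : ℝ≥0∞) ≤ 17 + ∑' k : ℕ, if 17 * 2 ^ k < x then (17 * 2 ^ k : ℝ≥0∞) else 0 := by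
    intro n hn
    have h1 : (17 * 2 ^ n : ℝ≥0∞) = 17 + ∑ k ∈ Finset.range n, (17 * 2 ^ k : ℝ≥0∞) := by
      clear hn
      induction n with
      | zero => simp
      | succ n ih => rw [Finset.sum_range_succ, ← add_assoc, ← ih]; ring
    rw [h1]
    gcongr
    refine le_trans (Finset.sum_le_sum fun k hk => ?_) (ENNReal.sum_le_tsum (Finset.range n))
    rw [if_pos (hn k (Finset.mem_range.1 hk))]
  by_cases hx : ∃ n : ℕ, x ≤ 17 * 2 ^ n
  · classical
    have := Nat.find_spec hx
    refine this.trans (key _ fun k hk => ?_)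
    exact not_le.1 (Nat.find_min hx hk)
  · push Not at hx
    have h2 : ∀ n : ℕ, (n : ℝ≥0∞) ≤
        17 + ∑' k : ℕ, if 17 * 2 ^ k < x then (17 * 2 ^ k : ℝ≥0∞) else 0 := by
      intro n
      refine le_trans ?_ (key n fun k _ => hx k)
      have : (n : ℝ≥0∞) ≤ 2 ^ n := by exact_mod_cast Nat.lt_two_pow_self.le
      refine this.trans ?_
      exact le_mul_of_one_le_left (by simp) (by norm_num)
    rw [ENNReal.eq_top_of_forall_nnreal_le (x := 17 + _) (fun r => ?_)]
    · exact le_top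
    · obtain ⟨n, hn⟩ := exists_nat_ge r
      exact le_trans (by exact_mod_cast hn) (h2 n)

lemma le_PhiY (u : ℝ) (hu : 0 ≤ u) : u ≤ 3 + PhiY u := by
  unfold PhiY logPlus
  split_ifs with h
  · rcases le_or_gt u 3 with h3 | h3
    · have := Real.log_nonneg h.le
      nlinarith
    · have : 1 ≤ Real.log u := by
        rw [Real.le_log_iff_exp_le (by linarith)]
        linarith [Real.exp_one_lt_d9]
      nlinarith
  · linarith

lemma PhiY_nonneg (u : ℝ) (hu : 0 ≤ u) : 0 ≤ PhiY u := by
  unfold PhiY logPlus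
  split_ifs with h
  · exact mul_nonneg hu (Real.log_nonneg h.le)
  · simp

lemma count_sum (u : ℝ) (hu : 0 ≤ u) :
    (∑' k : ℕ, if (2 : ℝ) ^ k < u then ENNReal.ofReal u else 0) ≤ ENNReal.ofReal (3 + 3 * PhiY u) := by
  set K := ⌈Real.logb 2 u⌉₊ with hK
  rcases le_or_gt u 1 with h1 | h1
  · have : ∀ k : ℕ, ¬ ((2 : ℝ) ^ k < u) := fun k => by
      have : (1 : ℝ) ≤ 2 ^ k := one_le_pow₀ (by norm_num)
      linarith
    simp [this]
  have hlog := Real.log_pos h1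
  rw [tsum_eq_sum (s := Finset.range K)]
  · calc _ ≤ ∑ k ∈ Finset.range K, ENNReal.ofReal u := Finset.sum_le_sum fun k _ => by
          split_ifs <;> simp
      _ = ENNReal.ofReal (K * u) := by
          rw [Finset.sum_const, Finset.card_range, nsmul_eq_mul, ENNReal.ofReal_mul (by positivity)]
          simp
      _ ≤ _ := by
          apply ENNReal.ofReal_le_ofReal
          have h2 : (K : ℝ) ≤ Real.logb 2 u + 1 := (Nat.ceil_lt_add_one (Real.logb_nonneg (by norm_num) h1.le)).le
          have h3 : Real.logb 2 u ≤ 2 * Real.log u := by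
            unfold Real.logb
            rw [div_le_iff₀ (Real.log_pos (by norm_num))]
            nlinarith [Real.log_two_gt_d9]
          have h4 := le_PhiY u hu
          have h5 : PhiY u = u * Real.log u := by simp [PhiY, logPlus, h1]
          nlinarith
  · intro k hk
    rw [if_neg]
    intro hlt
    apply hk
    rw [Finset.mem_range]
    have : (k : ℝ) < Real.logb 2 u := by
      rw [Real.lt_logb_iff_rpow_lt (by norm_num) (by linarith)]
      simpa using hlt
    exact_mod_cast this.trans_le (Nat.le_ceil _)

lemma AS_level (u : ℝ → ℝ) (hm : Measurable u) (hp : Function.Periodic u (2 * Real.pi))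
    (l : ℝ) (hl : 0 < l) :
    volume {x | x ∈ T1 ∧ ENNReal.ofReal (17 * l) < AS (fun x => ENNReal.ofReal (u x)) x} ≤
      ENNReal.ofReal (500 / l) * ∫⁻ x in T1, if l < u x then ENNReal.ofReal (u x) else 0 := by
  set h1 : ℝ → ℝ≥0∞ := fun x => if l < u x then ENNReal.ofReal (u x) else 0 with hh1
  have hm1 : Measurable h1 :=
    Measurable.ite (measurableSet_lt measurable_const hm) hm.ennreal_ofReal measurable_const
  have hp1 : Function.Periodic h1 (2 * Real.pi) := fun x => by simp only [hh1, hp x]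
  refine le_trans (measure_mono ?_) (per_weak_AA h1 hm1 hp1 l hl)
  rintro x ⟨hx, hlt⟩
  refine ⟨hx, ?_⟩
  obtain ⟨N, hN⟩ := lt_iSup_iff.1 hlt
  refine ⟨N + 1, by omega, ?_⟩
  by_contra hcon
  refine absurd hN (not_lt.2 ?_)
  refine (AA_add_le (N + 1) h1 (fun _ => ENNReal.ofReal l) _ hm1 (fun y => ?_) x).trans ?_
  · simp only [hh1]
    split_ifs with hy
    · exact le_self_add
    · rw [zero_add]; exact ENNReal.ofReal_le_ofReal (not_lt.1 hy)
  · refine (add_le_add (not_lt.1 hcon) (AA_const (N + 1) (by omega) l hl.le x)).trans ?_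
    rw [← ENNReal.ofReal_add (by positivity) (by positivity)]
    apply ENNReal.ofReal_le_ofReal; linarith

lemma measurableSet_T1 : MeasurableSet T1 := measurableSet_Ico
lemma volume_T1 : volume T1 = ENNReal.ofReal (2 * Real.pi) := by
  unfold T1; rw [Real.volume_Ico]; congr 1; ring

lemma AS_L1 (u : ℝ → ℝ) (hm : Measurable u) (h0 : ∀ x, 0 ≤ u x)
    (hp : Function.Periodic u (2 * Real.pi)) :
    ∫⁻ x in T1, AS (fun x => ENNReal.ofReal (u x)) x ≤
      200000 + 25500 * ∫⁻ x in T1, ENNReal.ofReal (PhiY (u x)) := by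
  set g := AS (fun x => ENNReal.ofReal (u x)) with hg
  have hgm : Measurable g := measurable_AS _ hm.ennreal_ofReal
  have h1 : ∀ k : ℕ, ∫⁻ x in T1, (if 17 * 2 ^ k < g x then (17 * 2 ^ k : ℝ≥0∞) else 0) ≤
      8500 * ∫⁻ x in T1, if (2 : ℝ) ^ k < u x then ENNReal.ofReal (u x) else 0 := by
    intro k
    have hms : MeasurableSet {x | (17 * 2 ^ k : ℝ≥0∞) < g x} := measurableSet_lt measurable_const hgm
    have e1 : ∀ x, (if 17 * 2 ^ k < g x then (17 * 2 ^ k : ℝ≥0∞) else 0) =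
        {x | (17 * 2 ^ k : ℝ≥0∞) < g x}.indicator (fun _ => 17 * 2 ^ k) x := fun x => by
      simp [indicator_apply]
    simp_rw [e1]
    rw [lintegral_indicator hms, setLIntegral_const, Measure.restrict_apply hms]
    have e2 : ENNReal.ofReal (17 * 2 ^ k) = 17 * 2 ^ k := by
      rw [ENNReal.ofReal_mul (by norm_num), ENNReal.ofReal_pow (by norm_num)]; simp
    have := AS_level u hm hp (2 ^ k) (by positivity)
    rw [e2] at this
    have e3 : {x | (17 * 2 ^ k : ℝ≥0∞) < g x} ∩ T1 = {x | x ∈ T1 ∧ (17 * 2 ^ k : ℝ≥0∞) < g x} := by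
      ext x; simp [and_comm]
    rw [e3]
    calc _ ≤ 17 * 2 ^ k * _ := mul_le_mul' le_rfl this
      _ = _ := by
        rw [← mul_assoc, ← e2, ← ENNReal.ofReal_mul (by positivity)]
        congr 1
        rw [show (17 : ℝ) * 2 ^ k * (500 / 2 ^ k) = 8500 by field_simp; norm_num]
        simp
  have mk : ∀ k : ℕ, Measurable fun x => if (2 : ℝ) ^ k < u x then ENNReal.ofReal (u x) else 0 :=
    fun k => Measurable.ite (measurableSet_lt measurable_const hm) hm.ennreal_ofReal measurable_const
  have mk2 : ∀ k : ℕ, Measurable fun x => if 17 * 2 ^ k < g x then (17 * 2 ^ k : ℝ≥0∞) else 0 :=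
    fun k => Measurable.ite (measurableSet_lt measurable_const hgm) measurable_const measurable_const
  have hpi : Real.pi < 3.15 := Real.pi_lt_d2
  calc ∫⁻ x in T1, g x
      ≤ ∫⁻ x in T1, (17 + ∑' k : ℕ, if 17 * 2 ^ k < g x then (17 * 2 ^ k : ℝ≥0∞) else 0) :=
        lintegral_mono fun x => level_sum _
    _ = 17 * volume T1 + ∑' k : ℕ, ∫⁻ x in T1, (if 17 * 2 ^ k < g x then (17 * 2 ^ k : ℝ≥0∞) else 0) := by
        rw [lintegral_add_left measurable_const, setLIntegral_const,
          lintegral_tsum fun k => (mk2 k).aemeasurable]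
    _ ≤ 17 * volume T1 + ∑' k : ℕ,
          8500 * ∫⁻ x in T1, if (2 : ℝ) ^ k < u x then ENNReal.ofReal (u x) else 0 := by
        gcongr with k; exact h1 k
    _ = 17 * volume T1 + 8500 * ∫⁻ x in T1, ∑' k : ℕ,
          if (2 : ℝ) ^ k < u x then ENNReal.ofReal (u x) else 0 := by
        rw [ENNReal.tsum_mul_left, lintegral_tsum fun k => (mk k).aemeasurable]
    _ ≤ 17 * volume T1 + 8500 * ∫⁻ x in T1, (3 + 3 * ENNReal.ofReal (PhiY (u x))) := by
        gcongr with x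
        refine (count_sum (u x) (h0 x)).trans (le_of_eq ?_)
        have := PhiY_nonneg _ (h0 x)
        rw [ENNReal.ofReal_add (by norm_num) (by positivity), ENNReal.ofReal_mul (by norm_num)]
        simp
    _ = (17 + 25500) * volume T1 + 25500 * ∫⁻ x in T1, ENNReal.ofReal (PhiY (u x)) := by
        rw [lintegral_add_left measurable_const, setLIntegral_const, lintegral_const_mul' _ _ (by simp)]
        ring
    _ ≤ _ := by
        gcongr
        rw [volume_T1, show (17 + 25500 : ℝ≥0∞) = ENNReal.ofReal 25517 by norm_num,
          ← ENNReal.ofReal_mul (by norm_num), show (200000 : ℝ≥0∞) = ENNReal.ofReal 200000 by simp]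
        apply ENNReal.ofReal_le_ofReal
        nlinarith

/-- biperiodicity, general codomain -/
def Bip {α : Type*} (f : ℝ × ℝ → α) : Prop :=
  ∀ x y : ℝ, f (x + 2 * Real.pi, y) = f (x, y) ∧ f (x, y + 2 * Real.pi) = f (x, y)

lemma Bip.comp {α β : Type*} {f : ℝ × ℝ → α} (hf : Bip f) (g : α → β) : Bip (fun p => g (f p)) :=
  fun x y => ⟨congrArg g (hf x y).1, congrArg g (hf x y).2⟩

lemma Bip.int {α : Type*} {f : ℝ × ℝ → α} (hf : Bip f) (a b : ℤ) (x y : ℝ) :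
    f (x + a * (2 * Real.pi), y + b * (2 * Real.pi)) = f (x, y) := by
  have h1 : Function.Periodic (fun x => f (x, y + b * (2 * Real.pi))) (2 * Real.pi) :=
    fun x => (hf x _).1
  have h2 : Function.Periodic (fun y => f (x, y)) (2 * Real.pi) := fun y => (hf x y).2
  have e1 := h1.int_mul a x
  have e2 := h2.int_mul b y
  exact e1.trans e2

lemma measurableSet_T2 : MeasurableSet T2 := measurableSet_T1.prod measurableSet_T1

lemma vol_T2_restrict : (volume : Measure (ℝ × ℝ)).restrict T2 =
    (volume.restrict T1).prod (volume.restrict T1) := by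
  rw [T2, Measure.prod_restrict]; rfl

lemma volume_T2 : volume T2 = ENNReal.ofReal (2 * Real.pi) * ENNReal.ofReal (2 * Real.pi) := by
  rw [T2, Measure.volume_eq_prod, Measure.prod_prod, volume_T1]

lemma shift_T2 (h : ℝ × ℝ → ℝ≥0∞) (hm : Measurable h) (hp : Bip h) (a : ℝ × ℝ) :
    ∫⁻ p in T2, h (p + a) = ∫⁻ p in T2, h p := by
  rw [vol_T2_restrict, lintegral_prod (fun p => h (p + a)) (hm.comp (measurable_id.add_const a)).aemeasurable,
    lintegral_prod _ hm.aemeasurable]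
  have e1 : ∀ x : ℝ, ∫⁻ y in T1, h ((x, y) + a) = ∫⁻ y in T1, h (a.1 + x, y) := by
    intro x
    rw [← per_lint_shift (fun y => h (a.1 + x, y)) (fun y => (hp _ _).2) a.2]
    congr 1; ext y
    congr 1; ext <;> simp [add_comm]
  simp_rw [e1]
  exact per_lint_shift (fun x => ∫⁻ y in T1, h (x, y))
    (fun x => lintegral_congr fun y => (hp x y).1) a.1

lemma transfer_eq (h : ℝ × ℝ → ℝ≥0∞) (hm : Measurable h) (hp : Bip h) (v : ℝ × ℝ) :
    ∫⁻ p in T2, ∫⁻ θ in T1, h (p + θ • v) = ENNReal.ofReal (2 * Real.pi) * ∫⁻ p in T2, h p := by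
  have hmm : Measurable fun q : (ℝ × ℝ) × ℝ => h (q.1 + q.2 • v) :=
    hm.comp (measurable_fst.add (measurable_snd.smul_const v))
  rw [lintegral_lintegral_swap hmm.aemeasurable]
  simp_rw [shift_T2 h hm hp]
  rw [lintegral_const, Measure.restrict_apply MeasurableSet.univ, univ_inter, volume_T1, mul_comm]

lemma transfer_le (f g : ℝ × ℝ → ℝ≥0∞) (hf : Measurable f) (hg : Measurable g)
    (pf : Bip f) (pg : Bip g) (v : ℝ × ℝ) (a K : ℝ≥0∞)
    (hle : ∀ p, ∫⁻ θ in T1, f (p + θ • v) ≤ a + K * ∫⁻ θ in T1, g (p + θ • v)) :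
    ∫⁻ p in T2, f p ≤ ENNReal.ofReal (2 * Real.pi) * a + K * ∫⁻ p in T2, g p := by
  have h0 : ENNReal.ofReal (2 * Real.pi) ≠ 0 := by simp [Real.pi_pos]
  have h1 : ENNReal.ofReal (2 * Real.pi) ≠ ∞ := ENNReal.ofReal_ne_top
  rw [← ENNReal.mul_le_mul_iff_right h0 h1, ← transfer_eq f hf pf v]
  have hmm : Measurable fun q : (ℝ × ℝ) × ℝ => g (q.1 + q.2 • v) :=
    hg.comp (measurable_fst.add (measurable_snd.smul_const v))
  calc _ ≤ ∫⁻ p in T2, (a + K * ∫⁻ θ in T1, g (p + θ • v)) := lintegral_mono hle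
    _ = a * volume T2 + K * (ENNReal.ofReal (2 * Real.pi) * ∫⁻ p in T2, g p) := by
      rw [lintegral_add_left measurable_const, setLIntegral_const, lintegral_const_mul,
        transfer_eq g hg pg v]
      exact hmm.lintegral_prod_right'
    _ = _ := by rw [volume_T2]; ring

lemma transfer_set (B : Set (ℝ × ℝ)) (g : ℝ × ℝ → ℝ≥0∞) (hB : MeasurableSet B) (hg : Measurable g)
    (pB : Bip (fun p => p ∈ B)) (pg : Bip g) (v : ℝ × ℝ) (K : ℝ≥0∞)
    (hle : ∀ p, volume {θ | θ ∈ T1 ∧ p + θ • v ∈ B} ≤ K * ∫⁻ θ in T1, g (p + θ • v)) :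
    volume {p | p ∈ T2 ∧ p ∈ B} ≤ K * ∫⁻ p in T2, g p := by
  classical
  have := transfer_le (B.indicator 1) g (measurable_one.indicator hB) hg
    (by
      intro x y
      have e : ∀ p, B.indicator (1 : ℝ × ℝ → ℝ≥0∞) p = (fun P : Prop => if P then 1 else 0) (p ∈ B) := by
        intro p; simp [indicator_apply]
      rw [e, e, e]
      exact (pB.comp (fun P : Prop => if P then (1 : ℝ≥0∞) else 0)) x y) pg v 0 K (by
      intro p
      rw [zero_add]
      refine le_trans (le_of_eq ?_) (hle p)
      have hms : MeasurableSet {θ : ℝ | p + θ • v ∈ B} :=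
        ((measurable_id.smul_const v).const_add p) hB
      have : ∀ θ : ℝ, B.indicator (1 : ℝ × ℝ → ℝ≥0∞) (p + θ • v) = {θ : ℝ | p + θ • v ∈ B}.indicator 1 θ := by
        intro θ; simp [indicator_apply]
      simp_rw [this]
      rw [lintegral_indicator_one hms, Measure.restrict_apply hms]
      congr 1; ext θ; simp [and_comm])
  rw [mul_zero, zero_add, lintegral_indicator_one hB, Measure.restrict_apply hB] at this
  refine le_trans (le_of_eq ?_) this
  congr 1; ext θ; simp [and_comm]

/-- restriction to a line -/
def lin {α : Type*} (v : ℝ × ℝ) (h : ℝ × ℝ → α) (p : ℝ × ℝ) (θ : ℝ) : α := h (p + θ • v)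

lemma lin_shift {α : Type*} (v : ℝ × ℝ) (h : ℝ × ℝ → α) (p : ℝ × ℝ) (θ : ℝ) :
    lin v h (p + θ • v) = fun τ => lin v h p (θ + τ) := by
  ext τ; simp only [lin, add_smul, add_assoc]

lemma AA_shift (N : ℕ) (k : ℝ → ℝ≥0∞) (θ : ℝ) :
    AA N (fun τ => k (θ + τ)) 0 = AA N k θ := by
  simp only [AA, zero_add]

lemma AS_shift (k : ℝ → ℝ≥0∞) (θ : ℝ) : AS (fun τ => k (θ + τ)) 0 = AS k θ := by
  simp only [AS, AA_shift]

lemma QQ_shift (N : ℕ) (k : ℝ → ℝ≥0∞) (θ : ℝ) :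
    QQ N (fun τ => k (θ + τ)) 0 = QQ N k θ := by
  simp only [QQ, AA, zero_add, add_assoc]

def AA2 (v : ℝ × ℝ) (N : ℕ) (h : ℝ × ℝ → ℝ≥0∞) (p : ℝ × ℝ) : ℝ≥0∞ := AA N (lin v h p) 0
def AS2 (v : ℝ × ℝ) (h : ℝ × ℝ → ℝ≥0∞) (p : ℝ × ℝ) : ℝ≥0∞ := AS (lin v h p) 0
def QQ2 (v : ℝ × ℝ) (N : ℕ) (h : ℝ × ℝ → ℝ≥0∞) (p : ℝ × ℝ) : ℝ≥0∞ := QQ N (lin v h p) 0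

lemma AA2_le_AS2 (v : ℝ × ℝ) (N : ℕ) (hN : 1 ≤ N) (h : ℝ × ℝ → ℝ≥0∞) (p : ℝ × ℝ) :
    AA2 v N h p ≤ AS2 v h p := AA_le_AS N hN _ _

lemma measurable_AA2 (v : ℝ × ℝ) (N : ℕ) (h : ℝ × ℝ → ℝ≥0∞) (hm : Measurable h) :
    Measurable (AA2 v N h) := by
  have : Measurable (fun q : (ℝ × ℝ) × ℝ => pker N q.2 * h (q.1 + (0 + q.2) • v)) :=
    ((measurable_pker N).comp measurable_snd).mul
      (hm.comp (measurable_fst.add ((measurable_snd.const_add 0).smul_const v)))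
  exact Measurable.lintegral_prod_right' (ν := volume.restrict (Ioo (-Real.pi) Real.pi)) this

lemma measurable_AS2 (v : ℝ × ℝ) (h : ℝ × ℝ → ℝ≥0∞) (hm : Measurable h) :
    Measurable (AS2 v h) := Measurable.iSup fun N => measurable_AA2 v (N + 1) h hm

lemma AA_lin (v : ℝ × ℝ) (N : ℕ) (h : ℝ × ℝ → ℝ≥0∞) (p : ℝ × ℝ) (θ : ℝ) :
    AA N (lin v h p) θ = AA2 v N h (p + θ • v) := by
  rw [AA2, lin_shift, AA_shift]

lemma AS_lin (v : ℝ × ℝ) (h : ℝ × ℝ → ℝ≥0∞) (p : ℝ × ℝ) (θ : ℝ) :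
    AS (lin v h p) θ = AS2 v h (p + θ • v) := by
  rw [AS2, lin_shift, AS_shift]

lemma QQ_lin (v : ℝ × ℝ) (N : ℕ) (h : ℝ × ℝ → ℝ≥0∞) (p : ℝ × ℝ) (θ : ℝ) :
    QQ N (lin v h p) θ = QQ2 v N h (p + θ • v) := by
  rw [QQ2, lin_shift, QQ_shift]

lemma measurable_QQ2 (v : ℝ × ℝ) (N : ℕ) (h : ℝ × ℝ → ℝ≥0∞) (hm : Measurable h) :
    Measurable (QQ2 v N h) := by
  unfold QQ2 QQ
  simp_rw [AA_lin, lin]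
  have hx : Measurable (fun q : (ℝ × ℝ) × ℝ => q.1 + (0 + q.2) • v) :=
    measurable_fst.add ((measurable_snd.const_add 0).smul_const v)
  have : Measurable (fun q : (ℝ × ℝ) × ℝ => ENNReal.ofReal (1 / (N * q.2 ^ 2)) *
      h (q.1 + (0 + q.2) • v) * AA2 v N h (q.1 + (0 + q.2) • v)) :=
    ((by fun_prop : Measurable fun q : (ℝ × ℝ) × ℝ => ENNReal.ofReal (1 / (N * q.2 ^ 2))).mul
      (hm.comp hx)).mul ((measurable_AA2 v N h hm).comp hx)
  exact Measurable.lintegral_prod_right' (ν := volume.restrict (farSet N)) this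

lemma lin_bip {α : Type*} (v : ℝ × ℝ) {h : ℝ × ℝ → α} (hp : Bip h) (x y : ℝ) :
    lin v h (x + 2 * Real.pi, y) = lin v h (x, y) ∧ lin v h (x, y + 2 * Real.pi) = lin v h (x, y) := by
  constructor <;> ext θ <;> simp only [lin]
  · have := (hp (x + θ * v.1) (y + θ * v.2)).1
    convert this using 2
    · ext <;> simp; ring
    · ext <;> simp
  · have := (hp (x + θ * v.1) (y + θ * v.2)).2
    convert this using 2
    · ext <;> simp; ring
    · ext <;> simp

lemma AA2_bip (v : ℝ × ℝ) (N : ℕ) {h : ℝ × ℝ → ℝ≥0∞} (hp : Bip h) : Bip (AA2 v N h) := fun x y => by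
  simp only [AA2, (lin_bip v hp x y).1, (lin_bip v hp x y).2, and_self]
lemma AS2_bip (v : ℝ × ℝ) {h : ℝ × ℝ → ℝ≥0∞} (hp : Bip h) : Bip (AS2 v h) := fun x y => by
  simp only [AS2, (lin_bip v hp x y).1, (lin_bip v hp x y).2, and_self]
lemma QQ2_bip (v : ℝ × ℝ) (N : ℕ) {h : ℝ × ℝ → ℝ≥0∞} (hp : Bip h) : Bip (QQ2 v N h) := fun x y => by
  simp only [QQ2, (lin_bip v hp x y).1, (lin_bip v hp x y).2, and_self]

lemma lin_periodic {α : Type*} (a b : ℤ) {h : ℝ × ℝ → α} (hp : Bip h) (p : ℝ × ℝ) :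
    Function.Periodic (lin ((a : ℝ), (b : ℝ)) h p) (2 * Real.pi) := by
  intro θ
  have := hp.int a b (p.1 + θ * a) (p.2 + θ * b)
  simp only [lin]
  convert this using 2
  · ext <;> simp <;> ring
  · ext <;> simp

lemma measurable_lin {α : Type*} [MeasurableSpace α] (v : ℝ × ℝ) {h : ℝ × ℝ → α} (hm : Measurable h)
    (p : ℝ × ℝ) : Measurable (lin v h p) :=
  hm.comp ((measurable_id.smul_const v).const_add p)

lemma weak_AS2 (a b : ℤ) (h : ℝ × ℝ → ℝ≥0∞) (hm : Measurable h) (hp : Bip h) (l : ℝ) (hl : 0 < l) :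
    volume {p | p ∈ T2 ∧ p ∈ {p | ENNReal.ofReal l < AS2 ((a : ℝ), (b : ℝ)) h p}} ≤
      ENNReal.ofReal (500 / l) * ∫⁻ p in T2, h p := by
  refine transfer_set _ h (measurableSet_lt measurable_const (measurable_AS2 _ h hm)) hm ?_ hp
    ((a : ℝ), (b : ℝ)) _ ?_
  · exact (AS2_bip ((a : ℝ), (b : ℝ)) hp).comp (fun x => ENNReal.ofReal l < x)
  · intro p
    refine le_trans (measure_mono ?_) (per_weak_AA (lin ((a : ℝ), (b : ℝ)) h p) (measurable_lin _ hm p)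
      (lin_periodic a b hp p) l hl)
    rintro θ ⟨h1, h2⟩
    refine ⟨h1, ?_⟩
    rw [mem_ofPred_eq, ← AS_lin] at h2
    obtain ⟨N, hN⟩ := lt_iSup_iff.1 h2
    exact ⟨N + 1, by omega, hN⟩

lemma weak_QQ2 (a b : ℤ) (h : ℝ × ℝ → ℝ≥0∞) (hm : Measurable h) (hp : Bip h) (l : ℝ) (hl : 0 < l) :
    volume {p | p ∈ T2 ∧ p ∈ {p | ∃ N : ℕ, 1 ≤ N ∧ ENNReal.ofReal (l ^ 2) < QQ2 ((a : ℝ), (b : ℝ)) N h p}} ≤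
      ENNReal.ofReal (700 / l) * ∫⁻ p in T2, h p := by
  refine transfer_set _ h ?_ hm ?_ hp ((a : ℝ), (b : ℝ)) _ ?_
  · have : {p | ∃ N : ℕ, 1 ≤ N ∧ ENNReal.ofReal (l ^ 2) < QQ2 ((a : ℝ), (b : ℝ)) N h p} =
      ⋃ N : ℕ, ⋃ _ : 1 ≤ N, {p | ENNReal.ofReal (l ^ 2) < QQ2 ((a : ℝ), (b : ℝ)) N h p} := by
      ext p; simp
    rw [this]
    exact MeasurableSet.iUnion fun N => MeasurableSet.iUnion fun _ =>
      measurableSet_lt measurable_const (measurable_QQ2 _ N h hm)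
  · intro x y
    simp only [mem_ofPred_eq, (QQ2_bip ((a : ℝ), (b : ℝ)) _ hp x y).1,
      (QQ2_bip ((a : ℝ), (b : ℝ)) _ hp x y).2, and_self]
  · intro p
    refine le_trans (measure_mono ?_) (per_weak_QQ (lin ((a : ℝ), (b : ℝ)) h p) (measurable_lin _ hm p)
      (lin_periodic a b hp p) l hl)
    rintro θ ⟨h1, N, hN, h2⟩
    refine ⟨h1, N, hN, ?_⟩
    rwa [QQ_lin]

lemma AS2_L1 (a b : ℤ) (u : ℝ × ℝ → ℝ) (hm : Measurable u) (hp : Bip u) (h0 : ∀ p, 0 ≤ u p) :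
    ∫⁻ p in T2, AS2 ((a : ℝ), (b : ℝ)) (fun p => ENNReal.ofReal (u p)) p ≤
      ENNReal.ofReal (2 * Real.pi) * 200000 + 25500 * ∫⁻ p in T2, ENNReal.ofReal (PhiY (u p)) := by
  have hPhi : Measurable PhiY := by
    unfold PhiY logPlus
    exact measurable_id.mul (Measurable.ite (measurableSet_lt measurable_const measurable_id)
      Real.measurable_log measurable_const)
  refine transfer_le _ _ (measurable_AS2 _ _ hm.ennreal_ofReal) (hPhi.comp hm).ennreal_ofReal
    (AS2_bip _ (hp.comp ENNReal.ofReal)) (hp.comp fun x => ENNReal.ofReal (PhiY x))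
    ((a : ℝ), (b : ℝ)) _ _ fun p => ?_
  have := AS_L1 (lin ((a : ℝ), (b : ℝ)) u p) (measurable_lin _ hm p) (fun _ => h0 _) (lin_periodic a b hp p)
  simp_rw [← AS_lin]
  exact this

lemma zyg_pt (w : ℂ) (h : 1 ≤ w.re) :
    |w.im| / 2 ≤ w.re * Real.log w.re + 6 / 5 * w.re - (w * Complex.log w).re := by
  have hw : w ≠ 0 := by rintro rfl; simp at h; linarith
  have hn : 0 < ‖w‖ := norm_pos_iff.2 hw
  have hre : (w * Complex.log w).re = w.re * Real.log ‖w‖ - w.im * Complex.arg w := by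
    rw [Complex.mul_re, Complex.log_re, Complex.log_im]
  have hsin : ‖w‖ * Real.sin (Complex.arg w) = w.im := Complex.norm_mul_sin_arg w
  have hsq : ‖w‖ ^ 2 = w.re ^ 2 + w.im ^ 2 := by
    rw [Complex.sq_norm, Complex.normSq_apply]; ring
  have hru : w.re ≤ ‖w‖ := Complex.re_le_norm w
  have hiu : |w.im| ≤ ‖w‖ := Complex.abs_im_le_norm w
  have h1 : |w.im| - w.re ≤ w.im * Complex.arg w := by
    set a := Complex.arg w with ha
    have hpi := Complex.arg_mem_Ioc w
    have h2 : Real.sin a ^ 2 ≤ Real.sin a * a := by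
      rcases le_total 0 a with h0 | h0
      · have := Real.sin_nonneg_of_nonneg_of_le_pi h0 hpi.2
        have := Real.sin_le h0
        nlinarith
      · have := Real.sin_nonpos_of_nonpos_of_neg_pi_le h0 hpi.1.le
        have := Real.le_sin h0
        nlinarith
    have h3 : ‖w‖ * Real.sin a ^ 2 ≤ w.im * a := by
      rw [← hsin, mul_assoc]; exact mul_le_mul_of_nonneg_left h2 hn.le
    have h4 : ‖w‖ - w.re ≤ ‖w‖ * Real.sin a ^ 2 := by
      have : ‖w‖ * (‖w‖ - w.re) ≤ ‖w‖ * (‖w‖ * Real.sin a ^ 2) := by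
        have : ‖w‖ * (‖w‖ * Real.sin a ^ 2) = w.im ^ 2 := by rw [← hsin]; ring
        rw [this]
        nlinarith
      exact le_of_mul_le_mul_left this hn
    linarith
  have h5 : Real.log ‖w‖ ≤ Real.log w.re + (|w.im| / w.re / 2 + 1 / 5) := by
    have hu : 0 < w.re := by linarith
    have e : ‖w‖ = w.re * 2 * (‖w‖ / w.re / 2) := by field_simp
    have hp : 0 < ‖w‖ / w.re / 2 := by positivity
    rw [e, Real.log_mul (by positivity) hp.ne', Real.log_mul hu.ne' (by norm_num)]
    have h6 := Real.log_le_sub_one_of_pos hp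
    have h7 : ‖w‖ / w.re ≤ 1 + |w.im| / w.re := by
      rw [← div_self hu.ne', ← add_div]
      gcongr
      have := Complex.norm_le_abs_re_add_abs_im w
      rwa [abs_of_pos hu] at this
    have h8 := Real.log_two_lt_d9
    linarith
  have hu : 0 < w.re := by linarith
  have h9 : w.re * Real.log ‖w‖ ≤ w.re * Real.log w.re + |w.im| / 2 + w.re / 5 := by
    have := mul_le_mul_of_nonneg_left h5 hu.le
    have e : w.re * (Real.log w.re + (|w.im| / w.re / 2 + 1 / 5)) =
      w.re * Real.log w.re + |w.im| / 2 + w.re / 5 := by field_simp; ring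
    linarith
  rw [hre]; linarith

lemma zyg_mean (F : ℂ → ℂ) (hF : Differentiable ℂ F)
    (h1 : ∀ θ : ℝ, 1 ≤ (F (circleMap 0 1 θ)).re) (h0 : (F 0).im = 0) :
    0 ≤ ∫ θ in (0 : ℝ)..(2 * Real.pi),
      (F (circleMap 0 1 θ) * Complex.log (F (circleMap 0 1 θ))).re := by
  have hsph : ∀ z ∈ Metric.sphere (0 : ℂ) 1, 1 ≤ (F z).re := by
    intro z hz
    rw [← abs_one (α := ℝ), ← range_circleMap] at hz
    obtain ⟨θ, rfl⟩ := hz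
    exact h1 θ
  have hball : ∀ z ∈ closure (Metric.ball (0 : ℂ) 1), 1 ≤ (F z).re := by
    intro z hz
    have := Complex.norm_le_of_forall_mem_frontier_norm_le (f := fun z => Complex.exp (-F z))
      (U := Metric.ball (0 : ℂ) 1) Metric.isBounded_ball (hF.neg.cexp.diffContOnCl) (C := Real.exp (-1))
      (fun w hw => by
        rw [frontier_ball _ one_ne_zero] at hw
        rw [Complex.norm_exp]
        apply Real.exp_le_exp.2
        have := hsph w hw
        simp; linarith) hz
    rw [Complex.norm_exp, Real.exp_le_exp] at this
    simp at this; linarith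
  have hG : DiffContOnCl ℂ (fun z => F z * Complex.log (F z)) (Metric.ball (0 : ℂ) |1|) := by
    rw [abs_one]
    refine DifferentiableOn.diffContOnCl fun z hz => ?_
    refine ((hF z).mul ((hF z).clog ?_)).differentiableWithinAt
    exact Or.inl (by linarith [hball z hz])
  have hm := hG.circleAverage
  have hcont : Continuous fun θ : ℝ => F (circleMap 0 1 θ) * Complex.log (F (circleMap 0 1 θ)) := by
    have hc : Continuous fun θ : ℝ => F (circleMap 0 1 θ) := hF.continuous.comp (continuous_circleMap 0 1)
    exact hc.mul (hc.clog fun θ => Or.inl (by linarith [h1 θ]))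
  have hre : ∫ θ in (0 : ℝ)..(2 * Real.pi),
      (F (circleMap 0 1 θ) * Complex.log (F (circleMap 0 1 θ))).re =
      (∫ θ in (0 : ℝ)..(2 * Real.pi),
      (F (circleMap 0 1 θ) * Complex.log (F (circleMap 0 1 θ)))).re := by
    have := Complex.reCLM.intervalIntegral_comp_comm (hcont.intervalIntegrable (μ := volume) 0 (2 * Real.pi))
    simpa using this
  rw [hre]
  rw [Real.circleAverage_def] at hm
  have h2 : (∫ θ in (0 : ℝ)..(2 * Real.pi),
      (F (circleMap 0 1 θ) * Complex.log (F (circleMap 0 1 θ)))) = (2 * Real.pi) • (F 0 * Complex.log (F 0)) := by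
    rw [← hm, smul_smul, mul_inv_cancel₀ (by positivity), one_smul]
  rw [h2, Complex.smul_re]
  have hF0 : 1 ≤ (F 0).re := hball 0 (subset_closure (Metric.mem_ball_self one_pos))
  rw [Complex.mul_re, h0, zero_mul, sub_zero, Complex.log_re]
  have : 0 ≤ Real.log ‖F 0‖ := Real.log_nonneg (hF0.trans (Complex.re_le_norm _))
  have hpi := Real.pi_pos
  have : 0 ≤ (F 0).re := by linarith
  simp only [smul_eq_mul]; positivity

lemma PhiY_posLog (t : ℝ) (ht : 0 ≤ t) : PhiY t = t * Real.posLog t := by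
  unfold PhiY logPlus
  split_ifs with h
  · rw [Real.posLog_eq_log]; rw [abs_of_nonneg ht]; exact h.le
  · rw [Real.posLog_eq_zero_iff _ |>.2]; rw [abs_of_nonneg ht]; exact not_lt.1 h

lemma one_add_log (t : ℝ) (ht : 0 ≤ t) :
    (1 + t) * Real.log (1 + t) + 6 / 5 * (1 + t) ≤ 10 + 6 * PhiY t := by
  have h3 := le_PhiY t ht
  have hl2 := Real.log_two_lt_d9
  have hl0 : 0 ≤ Real.log (1 + t) := Real.log_nonneg (by linarith)
  rcases le_or_gt t 1 with h | h
  · have h1 : Real.log (1 + t) ≤ Real.log 2 := Real.log_le_log (by linarith) (by linarith)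
    have := PhiY_nonneg t ht
    nlinarith
  · have h1 : Real.log (1 + t) ≤ Real.log (2 * t) := Real.log_le_log (by linarith) (by linarith)
    rw [Real.log_mul (by norm_num) (by linarith)] at h1
    have h5 : PhiY t = t * Real.log t := by simp [PhiY, logPlus, h]
    have := Real.log_pos h
    have h6 : (1 + t) * Real.log (1 + t) ≤ 2 * t * (Real.log 2 + Real.log t) := by
      apply mul_le_mul (by linarith) h1 hl0 (by linarith)
    nlinarith

/-- real sign of an integer -/
def sg (m : ℤ) : ℝ := (m.sign : ℝ)

def zc (r α : ℝ) (m : ℤ) : ℂ :=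
  if m = 0 then ((r * Real.cos α : ℝ) : ℂ) else (r : ℂ) * Complex.exp (((sg m * α : ℝ) : ℂ) * Complex.I)

lemma zc_pow (r α : ℝ) (m : ℤ) (θ : ℝ) :
    (zc r α m * (circleMap 0 1 θ) ^ m.natAbs).re = r * Real.cos (m * θ + α) ∧
    (zc r α m * (circleMap 0 1 θ) ^ m.natAbs).im = r * (sg m * Real.sin (m * θ + α)) := by
  unfold zc
  by_cases hm : m = 0
  · subst hm; simp [sg, -Complex.ofReal_cos]
  rw [if_neg hm]
  have e : (r : ℂ) * Complex.exp (((sg m * α : ℝ) : ℂ) * Complex.I) * (circleMap 0 1 θ) ^ m.natAbs =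
      r * Complex.exp (((sg m * (m * θ + α) : ℝ) : ℂ) * Complex.I) := by
    rw [circleMap, zero_add, Complex.ofReal_one, one_mul, ← Complex.exp_nat_mul, mul_assoc, ← Complex.exp_add]
    congr 2
    have : ((m.natAbs : ℕ) : ℂ) = ((sg m * m : ℝ) : ℂ) := by
      rw [sg, ← Int.cast_mul, Int.sign_mul_self_eq_abs, Complex.ofReal_intCast, Int.abs_eq_natAbs]; simp
    rw [this]; push_cast; ring
  rw [e, Complex.re_ofReal_mul, Complex.im_ofReal_mul, Complex.exp_ofReal_mul_I_re, Complex.exp_ofReal_mul_I_im]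
  rcases lt_or_gt_of_ne hm with h | h
  · simp [sg, Int.sign_eq_neg_one_of_neg h]
    constructor
    · left; rw [← Real.cos_neg]; congr 1; ring
    · rw [show -α + -((m : ℝ) * θ) = -(m * θ + α) by ring, Real.sin_neg, mul_neg]
  · simp [sg, Int.sign_eq_one_of_pos h]

lemma int_sub_abs (A P R : ℝ → ℝ) (hA : Continuous A) (hP : Continuous P) (hR : Continuous R)
    (hpt : ∀ θ, A θ ≤ P θ - 2 * R θ) (h0 : 0 ≤ ∫ θ in (0 : ℝ)..(2 * Real.pi), R θ) :
    ∫ θ in (0 : ℝ)..(2 * Real.pi), A θ ≤ ∫ θ in (0 : ℝ)..(2 * Real.pi), P θ := by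
  have hR2 : Continuous fun θ => 2 * R θ := by fun_prop
  have := intervalIntegral.integral_mono_on (μ := volume) (a := 0) (b := 2 * Real.pi) (by positivity)
    (hA.intervalIntegrable _ _) ((hP.intervalIntegrable _ _).sub (hR2.intervalIntegrable _ _))
    (fun θ _ => hpt θ)
  rw [intervalIntegral.integral_sub (hP.intervalIntegrable _ _) (hR2.intervalIntegrable _ _),
    intervalIntegral.integral_const_mul] at this
  linarith

lemma conj_real (n : ℕ) (r α : ℕ → ℝ) (m : ℕ → ℤ)
    (h0 : ∀ θ : ℝ, 0 ≤ ∑ i ∈ Finset.range n, r i * Real.cos (m i * θ + α i)) :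
    ∫ θ in (0 : ℝ)..(2 * Real.pi), |∑ i ∈ Finset.range n, r i * (sg (m i) * Real.sin (m i * θ + α i))| ≤
    ∫ θ in (0 : ℝ)..(2 * Real.pi), (20 + 12 * PhiY (∑ i ∈ Finset.range n, r i * Real.cos (m i * θ + α i))) := by
  set F : ℂ → ℂ := fun z => 1 + ∑ i ∈ Finset.range n, zc (r i) (α i) (m i) * z ^ (m i).natAbs with hFd
  have hF : Differentiable ℂ F := by fun_prop
  have hre : ∀ θ : ℝ, (F (circleMap 0 1 θ)).re = 1 + ∑ i ∈ Finset.range n, r i * Real.cos (m i * θ + α i) := by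
    intro θ; simp only [hFd, Complex.add_re, Complex.one_re, Complex.re_sum, (zc_pow _ _ _ θ).1]
  have him : ∀ θ : ℝ, (F (circleMap 0 1 θ)).im = ∑ i ∈ Finset.range n, r i * (sg (m i) * Real.sin (m i * θ + α i)) := by
    intro θ; simp only [hFd, Complex.add_im, Complex.one_im, Complex.im_sum, (zc_pow _ _ _ θ).2, zero_add]
  have hF0 : (F 0).im = 0 := by
    simp only [hFd, Complex.add_im, Complex.one_im, Complex.im_sum, zero_add]
    refine Finset.sum_eq_zero fun i _ => ?_
    by_cases hm : m i = 0
    · simp only [zc, hm, if_true, Int.natAbs_zero, pow_zero, mul_one, Complex.ofReal_im]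
    · rw [zero_pow (by simpa using hm)]; simp
  have hge : ∀ θ : ℝ, 1 ≤ (F (circleMap 0 1 θ)).re := fun θ => by rw [hre]; linarith [h0 θ]
  have hmean := zyg_mean F hF hge hF0
  have hcF : Continuous fun θ : ℝ => F (circleMap 0 1 θ) := hF.continuous.comp (continuous_circleMap 0 1)
  have hcont : Continuous fun θ : ℝ => (F (circleMap 0 1 θ) * Complex.log (F (circleMap 0 1 θ))).re :=
    Complex.continuous_re.comp (hcF.mul (hcF.clog fun θ => Or.inl (by linarith [hge θ])))
  have hpt : ∀ θ : ℝ, |∑ i ∈ Finset.range n, r i * (sg (m i) * Real.sin (m i * θ + α i))| ≤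
      (20 + 12 * ((∑ i ∈ Finset.range n, r i * Real.cos (m i * θ + α i)) *
        Real.posLog (∑ i ∈ Finset.range n, r i * Real.cos (m i * θ + α i)))) -
        2 * (F (circleMap 0 1 θ) * Complex.log (F (circleMap 0 1 θ))).re := by
    intro θ
    have h1 := zyg_pt _ (hge θ)
    rw [him, hre] at h1
    have h2 := one_add_log _ (h0 θ)
    rw [PhiY_posLog _ (h0 θ)] at h2
    linarith
  have hpi : (0 : ℝ) ≤ 2 * Real.pi := by positivity
  have hcP : Continuous fun θ : ℝ => 20 + 12 * ((∑ i ∈ Finset.range n, r i * Real.cos (m i * θ + α i)) *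
        Real.posLog (∑ i ∈ Finset.range n, r i * Real.cos (m i * θ + α i))) := by
    have h1 : Continuous fun θ : ℝ => ∑ i ∈ Finset.range n, r i * Real.cos (m i * θ + α i) := by fun_prop
    exact continuous_const.add (continuous_const.mul (h1.mul (Real.continuous_posLog.comp h1)))
  simp_rw [fun θ => PhiY_posLog _ (h0 θ)]
  exact int_sub_abs _ _ _ (by fun_prop) hcP hcont hpt hmean

lemma conj_lint (n : ℕ) (r α : ℕ → ℝ) (m : ℕ → ℤ)
    (h0 : ∀ θ : ℝ, 0 ≤ ∑ i ∈ Finset.range n, r i * Real.cos (m i * θ + α i)) :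
    ∫⁻ θ in T1, ENNReal.ofReal |∑ i ∈ Finset.range n, r i * (sg (m i) * Real.sin (m i * θ + α i))| ≤
    130 + 12 * ∫⁻ θ in T1,
      ENNReal.ofReal (PhiY (∑ i ∈ Finset.range n, r i * Real.cos (m i * θ + α i))) := by
  have hpi : (0 : ℝ) ≤ 2 * Real.pi := by positivity
  have h := conj_real n r α m h0
  set f := fun θ : ℝ => ∑ i ∈ Finset.range n, r i * Real.cos (m i * θ + α i) with hf
  set v := fun θ : ℝ => ∑ i ∈ Finset.range n, r i * (sg (m i) * Real.sin (m i * θ + α i)) with hv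
  have hfc : Continuous f := by fun_prop
  have hvc : Continuous v := by fun_prop
  have hfp : Function.Periodic f (2 * Real.pi) := by
    intro θ; simp only [hf]
    refine Finset.sum_congr rfl fun i _ => ?_
    rw [show (m i : ℝ) * (θ + 2 * Real.pi) + α i = (m i * θ + α i) + m i * (2 * Real.pi) by ring,
      Real.cos_add_int_mul_two_pi]
  have hvp : Function.Periodic v (2 * Real.pi) := by
    intro θ; simp only [hv]
    refine Finset.sum_congr rfl fun i _ => ?_
    rw [show (m i : ℝ) * (θ + 2 * Real.pi) + α i = (m i * θ + α i) + m i * (2 * Real.pi) by ring,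
      Real.sin_add_int_mul_two_pi]
  have hPc : Continuous fun θ => PhiY (f θ) := by
    have : (fun θ => PhiY (f θ)) = fun θ => f θ * Real.posLog (f θ) := by
      ext θ; exact PhiY_posLog _ (h0 θ)
    rw [this]; exact hfc.mul (Real.continuous_posLog.comp hfc)
  have conv : ∀ g : ℝ → ℝ, Continuous g → (∀ θ, 0 ≤ g θ) → Function.Periodic g (2 * Real.pi) →
      ∫⁻ θ in T1, ENNReal.ofReal (g θ) = ENNReal.ofReal (∫ θ in (0 : ℝ)..(2 * Real.pi), g θ) := by
    intro g gc g0 gp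
    rw [← per_lint_T1 _ (fun θ => by simp only [gp θ]) 0, zero_add,
      setLIntegral_congr (Ico_ae_eq_Ioc), intervalIntegral.integral_of_le hpi,
      ofReal_integral_eq_lintegral_ofReal]
    · exact (gc.integrableOn_Icc).mono_set Ioc_subset_Icc_self
    · exact Eventually.of_forall g0
  have hP0 : ∀ θ, 0 ≤ PhiY (f θ) := fun θ => PhiY_nonneg _ (h0 θ)
  change ∫⁻ θ in T1, ENNReal.ofReal |v θ| ≤ 130 + 12 * ∫⁻ θ in T1, ENNReal.ofReal (PhiY (f θ))
  rw [conv (fun θ => |v θ|) hvc.abs (fun _ => abs_nonneg _) (fun θ => by simp only [hvp θ]),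
    conv (fun θ => PhiY (f θ)) hPc hP0 (fun θ => by simp only [hfp θ])]
  have hP12 : Continuous fun θ => 12 * PhiY (f θ) := by fun_prop
  change ∫ θ in (0 : ℝ)..(2 * Real.pi), |v θ| ≤ ∫ θ in (0 : ℝ)..(2 * Real.pi), (20 + 12 * PhiY (f θ)) at h
  rw [intervalIntegral.integral_add (by simp) (hP12.intervalIntegrable _ _),
    intervalIntegral.integral_const, intervalIntegral.integral_const_mul] at h
  have hI : 0 ≤ ∫ θ in (0 : ℝ)..(2 * Real.pi), PhiY (f θ) := intervalIntegral.integral_nonneg hpi fun θ _ => hP0 θ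
  calc _ ≤ ENNReal.ofReal (130 + 12 * ∫ θ in (0 : ℝ)..(2 * Real.pi), PhiY (f θ)) := by
        apply ENNReal.ofReal_le_ofReal
        have := Real.pi_lt_d2
        simp only [smul_eq_mul] at h
        linarith
    _ = _ := by
        rw [ENNReal.ofReal_add (by norm_num) (by positivity), ENNReal.ofReal_mul (by norm_num)]; simp

/-- the open period interval -/
def II : Set ℝ := Ioo (-Real.pi) Real.pi
lemma measurableSet_II : MeasurableSet II := measurableSet_Ioo
lemma volume_II : volume II = ENNReal.ofReal (2 * Real.pi) := by
  unfold II; rw [Real.volume_Ioo]; congr 1; ring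
instance : IsFiniteMeasure (volume.restrict II) := ⟨by
  rw [Measure.restrict_apply MeasurableSet.univ, univ_inter, volume_II]; exact ENNReal.ofReal_lt_top⟩

/-- bounded measurable on `II` -/
def BM (a : ℝ → ℝ) : Prop := Measurable a ∧ ∃ C : ℝ, ∀ t ∈ II, |a t| ≤ C

lemma BM.mul {a b : ℝ → ℝ} (ha : BM a) (hb : BM b) : BM (fun t => a t * b t) := by
  obtain ⟨ma, C, hC⟩ := ha
  obtain ⟨mb, D, hD⟩ := hb
  refine ⟨ma.mul mb, C * D, fun t ht => ?_⟩
  rw [abs_mul]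
  exact mul_le_mul (hC t ht) (hD t ht) (abs_nonneg _) ((abs_nonneg _).trans (hC t ht))

lemma BM.integrable {a : ℝ → ℝ} (ha : BM a) : Integrable a (volume.restrict II) := by
  obtain ⟨ma, C, hC⟩ := ha
  refine Integrable.of_bound ma.aestronglyMeasurable C ?_
  exact (ae_restrict_iff' measurableSet_II).2 (Eventually.of_forall hC)

lemma BM_cos (j α : ℝ) : BM (fun t => Real.cos (j * t + α)) :=
  ⟨by fun_prop, 1, fun t _ => Real.abs_cos_le_one _⟩
lemma BM_cos' (j : ℝ) : BM (fun t => Real.cos (j * t)) :=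
  ⟨by fun_prop, 1, fun t _ => Real.abs_cos_le_one _⟩
lemma BM_sin' (j : ℝ) : BM (fun t => Real.sin (j * t)) :=
  ⟨by fun_prop, 1, fun t _ => Real.abs_sin_le_one _⟩

lemma int_II_neg (f : ℝ → ℝ) : ∫ t in II, f (-t) = ∫ t in II, f t := by
  have h := (Measure.measurePreserving_neg (volume : Measure ℝ)).setIntegral_preimage_emb
    (MeasurableEquiv.neg ℝ).measurableEmbedding f II
  have e : (Neg.neg : ℝ → ℝ) ⁻¹' II = II := by
    ext t; simp only [II, mem_preimage, mem_Ioo]; constructor <;> rintro ⟨h1, h2⟩ <;> constructor <;> linarith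
  rw [← h, e]

lemma int_II_odd (f : ℝ → ℝ) (hf : ∀ t, f (-t) = - f t) : ∫ t in II, f t = 0 := by
  have := int_II_neg f
  simp_rw [hf] at this
  rw [integral_neg] at this
  linarith

/-- `cot (t/2)` -/
def ct (t : ℝ) : ℝ := (Real.tan (t / 2))⁻¹

lemma ct_neg (t : ℝ) : ct (-t) = - ct t := by
  unfold ct; rw [neg_div, Real.tan_neg, inv_neg]

lemma measurable_ct : Measurable ct := by
  unfold ct
  have : (fun t : ℝ => (Real.tan (t / 2))⁻¹) = fun t => (Real.sin (t / 2) / Real.cos (t / 2))⁻¹ := by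
    ext t; rw [Real.tan_eq_sin_div_cos]
  rw [this]; fun_prop

lemma ct_bound (t : ℝ) (ht : t ∈ II) : |ct t| ≤ 2 / |t| := by
  wlog h : 0 ≤ t generalizing t
  · have := this (-t) ⟨by linarith [ht.2], by linarith [ht.1]⟩ (by linarith)
    rwa [ct_neg, abs_neg, abs_neg] at this
  rcases h.eq_or_lt with rfl | h
  · simp [ct]
  have h1 : t / 2 < Real.tan (t / 2) := Real.lt_tan (by linarith) (by linarith [ht.2])
  rw [ct, abs_inv, abs_of_pos (by linarith : 0 < Real.tan (t/2)), abs_of_pos h,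
    show 2 / t = (t / 2)⁻¹ by rw [inv_div]]
  exact inv_anti₀ (by linarith) h1.le

lemma BM_sin_ct (j : ℝ) : BM (fun t => Real.sin (j * t) * ct t) := by
  refine ⟨by have := measurable_ct; fun_prop, 2 * |j|, fun t ht => ?_⟩
  rcases eq_or_ne t 0 with rfl | h0
  · simp
  have hp : 0 < |t| := abs_pos.2 h0
  rw [abs_mul]
  calc _ ≤ |j * t| * (2 / |t|) := mul_le_mul Real.abs_sin_le_abs (ct_bound t ht) (abs_nonneg _) (abs_nonneg _)
    _ = _ := by rw [abs_mul]; field_simp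

lemma int_cos (k : ℤ) : ∫ t in II, Real.cos (k * t) = if k = 0 then 2 * Real.pi else 0 := by
  have hpi : (-Real.pi) ≤ Real.pi := by linarith [Real.pi_pos]
  split_ifs with h
  · subst h
    simp only [Int.cast_zero, zero_mul, Real.cos_zero]
    rw [setIntegral_const, measureReal_def, volume_II, ENNReal.toReal_ofReal (by positivity)]; simp
  · have hk : (k : ℝ) ≠ 0 := by exact_mod_cast h
    rw [II, ← integral_Ioc_eq_integral_Ioo, ← intervalIntegral.integral_of_le hpi,
      intervalIntegral.integral_comp_mul_left (fun x => Real.cos x) hk, integral_cos]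
    simp [Real.sin_int_mul_pi]

lemma ct_step (k t : ℝ) (ht : t ∈ II) (h0 : t ≠ 0) :
    Real.sin ((k + 1) * t) * ct t = Real.sin (k * t) * ct t + (Real.cos ((k + 1) * t) + Real.cos (k * t)) := by
  have hs : Real.sin (t / 2) ≠ 0 := by
    intro h
    rw [Real.sin_eq_zero_iff_of_lt_of_lt (by linarith [ht.1, Real.pi_pos]) (by linarith [ht.2, Real.pi_pos])] at h
    exact h0 (by linarith)
  have hc : Real.cos (t / 2) ≠ 0 :=
    (Real.cos_pos_of_mem_Ioo ⟨by linarith [ht.1], by linarith [ht.2]⟩).ne'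
  have e : t = 2 * (t / 2) := by ring
  have es : Real.sin t = 2 * Real.sin (t/2) * Real.cos (t/2) := by rw [← Real.sin_two_mul]; congr 1
  have ec : Real.cos t = 1 - 2 * Real.sin (t/2) ^ 2 := by
    have := Real.cos_two_mul (t/2)
    rw [← e] at this
    have := Real.sin_sq_add_cos_sq (t/2)
    linarith
  rw [ct, Real.tan_eq_sin_div_cos, add_mul, one_mul, Real.sin_add, Real.cos_add, es, ec, inv_div]
  field_simp
  have := Real.sin_sq_add_cos_sq (t/2)
  have h2 : Real.cos (t/2) ^ 2 = 1 - Real.sin (t/2) ^ 2 := by linarith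
  generalize Real.sin (t/2) = a at *
  generalize Real.cos (t/2) = b at *
  linear_combination 2 * a * Real.cos (k * t) * h2

lemma int_sin_ct_nat (k : ℕ) : ∫ t in II, Real.sin ((k : ℝ) * t) * ct t = if k = 0 then 0 else 2 * Real.pi := by
  induction k with
  | zero => simp
  | succ k ih =>
    have h1 : ∫ t in II, Real.sin (((k + 1 : ℕ) : ℝ) * t) * ct t =
        ∫ t in II, (Real.sin (k * t) * ct t + (Real.cos ((k + 1 : ℕ) * t) + Real.cos (k * t))) := by
      refine setIntegral_congr_ae measurableSet_II ?_
      have : ∀ᵐ t : ℝ, t ≠ 0 := by simp [ae_iff]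
      filter_upwards [this] with t h0 ht
      have := ct_step k t ht h0
      push_cast; exact this
    have c1 := int_cos (k + 1 : ℕ)
    have c2 := int_cos (k : ℕ)
    simp only [Int.cast_natCast] at c1 c2
    have hadd : Integrable (fun t => Real.cos ((k + 1 : ℕ) * t) + Real.cos (k * t)) (volume.restrict II) :=
      (BM_cos' _).integrable.add (BM_cos' _).integrable
    rw [h1, integral_add (BM_sin_ct k).integrable hadd,
      integral_add (BM_cos' _).integrable (BM_cos' _).integrable, ih, c1, c2]
    rcases Nat.eq_zero_or_pos k with rfl | hk
    · simp
    · have e1 : ¬ (k = 0) := hk.ne'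
      have e2 : ¬ ((k : ℤ) = 0) := by omega
      have e3 : ¬ (((k + 1 : ℕ) : ℤ) = 0) := by omega
      simp [e1, e2, e3]
      intro h; omega

lemma int_sin_ct (k : ℤ) : ∫ t in II, Real.sin (k * t) * ct t = 2 * Real.pi * sg k := by
  rcases Int.le_total 0 k with h | h
  · obtain ⟨n, rfl⟩ := Int.eq_ofNat_of_zero_le h
    have := int_sin_ct_nat n
    simp only [Int.cast_natCast]
    rw [this, sg]
    split_ifs with h0
    · simp [h0]
    · rw [Int.sign_eq_one_of_pos (by omega)]; simp
  · obtain ⟨n, hn⟩ := Int.eq_ofNat_of_zero_le (show 0 ≤ -k by omega)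
    obtain rfl : k = -(n : ℤ) := by omega
    have := int_sin_ct_nat n
    simp only [Int.cast_natCast, Int.cast_neg, neg_mul, Real.sin_neg, integral_neg]
    rw [this, sg]
    split_ifs with h0
    · simp [h0]
    · rw [Int.sign_eq_neg_one_of_neg (by omega)]; simp

def Dst (n : ℕ) (t : ℝ) : ℝ := Real.sin (n * t) * ct t / 2

def mm (n : ℕ) (j : ℤ) : ℝ := (sg (j + n) - sg (j - n)) / 2
def bb (n : ℕ) (j : ℤ) : ℝ := (sg (j + n) + sg (j - n)) / 2

lemma BM_Dst (n : ℕ) : BM (Dst n) := by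
  obtain ⟨h1, C, h2⟩ := BM_sin_ct n
  refine ⟨h1.div_const 2, C, fun t ht => ?_⟩
  rw [Dst, abs_div, abs_two]
  have := h2 t ht
  have := abs_nonneg (Real.sin (n * t) * ct t)
  linarith

lemma Dst_neg (n : ℕ) (t : ℝ) : Dst n (-t) = Dst n t := by
  simp [Dst, ct_neg]

lemma sg_neg (m : ℤ) : sg (-m) = - sg m := by simp [sg]

lemma int_Dst_cos (n : ℕ) (j : ℤ) : ∫ t in II, Dst n t * Real.cos (j * t) = Real.pi * mm n j := by
  have e : ∀ t, Dst n t * Real.cos (j * t) =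
      (1 / 4) * (Real.sin ((j + n : ℤ) * t) * ct t) - (1 / 4) * (Real.sin ((j - n : ℤ) * t) * ct t) := by
    intro t
    unfold Dst
    push_cast
    rw [add_mul, sub_mul, Real.sin_add, Real.sin_sub]; ring
  simp_rw [e]
  rw [integral_sub ((BM_sin_ct _).integrable.const_mul _) ((BM_sin_ct _).integrable.const_mul _),
    integral_const_mul, integral_const_mul, int_sin_ct, int_sin_ct, mm]
  ring

lemma int_cot_conj (n : ℕ) (j : ℤ) : ∫ t in II, Real.cos (n * t) * ct t * Real.sin (j * t) = 2 * Real.pi * bb n j := by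
  have e : ∀ t, Real.cos (n * t) * ct t * Real.sin (j * t) =
      (1 / 2) * (Real.sin ((j + n : ℤ) * t) * ct t) + (1 / 2) * (Real.sin ((j - n : ℤ) * t) * ct t) := by
    intro t
    push_cast
    rw [add_mul, sub_mul, Real.sin_add, Real.sin_sub]; ring
  simp_rw [e]
  rw [integral_add ((BM_sin_ct _).integrable.const_mul _) ((BM_sin_ct _).integrable.const_mul _),
    integral_const_mul, integral_const_mul, int_sin_ct, int_sin_ct, bb]
  ring

def dd (n : ℕ) (j : ℤ) : ℝ := if j = n ∨ j = -n then 1 else 0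

lemma int_cos_cos (n : ℕ) (hn : 1 ≤ n) (j : ℤ) :
    ∫ t in II, Real.cos (n * t) * Real.cos (j * t) = Real.pi * dd n j := by
  have e : ∀ t, Real.cos (n * t) * Real.cos (j * t) =
      (1 / 2) * (Real.cos ((j + n : ℤ) * t)) + (1 / 2) * (Real.cos ((j - n : ℤ) * t)) := by
    intro t
    push_cast
    rw [add_mul, sub_mul, Real.cos_add, Real.cos_sub]; ring
  simp_rw [e]
  rw [integral_add ((BM_cos' _).integrable.const_mul _) ((BM_cos' _).integrable.const_mul _),
    integral_const_mul, integral_const_mul, int_cos, int_cos, dd]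
  by_cases h1 : j + n = 0
  · rw [if_pos h1, if_neg (by omega), if_pos (by omega)]; ring
  by_cases h2 : j - n = 0
  · rw [if_neg h1, if_pos h2, if_pos (by omega)]; ring
  · rw [if_neg h1, if_neg h2, if_neg (by omega)]; ring

lemma sg_pos {m : ℤ} (h : 0 < m) : sg m = 1 := by rw [sg, Int.sign_eq_one_of_pos h]; simp
lemma sg_negv {m : ℤ} (h : m < 0) : sg m = -1 := by rw [sg, Int.sign_eq_neg_one_of_neg h]; simp
lemma sg_zero {m : ℤ} (h : m = 0) : sg m = 0 := by rw [sg, h]; simp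

lemma five (n : ℕ) (hn : 1 ≤ n) (j : ℤ) :
    (j < -n ∧ mm n j = 0 ∧ bb n j = -1 ∧ dd n j = 0) ∨ (j = -n ∧ mm n j = 1/2 ∧ bb n j = -1/2 ∧ dd n j = 1) ∨
    ((-n < j ∧ j < n) ∧ mm n j = 1 ∧ bb n j = 0 ∧ dd n j = 0) ∨
    (j = n ∧ mm n j = 1/2 ∧ bb n j = 1/2 ∧ dd n j = 1) ∨
    (n < j ∧ mm n j = 0 ∧ bb n j = 1 ∧ dd n j = 0) := by
  unfold mm bb dd
  rcases lt_trichotomy (j + n) 0 with h1 | h1 | h1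
  · left
    rw [sg_negv h1, sg_negv (show j - n < 0 by omega), if_neg (by omega)]
    refine ⟨by omega, ?_, ?_, ?_⟩ <;> norm_num
  · right; left
    rw [sg_zero h1, sg_negv (show j - n < 0 by omega), if_pos (by omega)]
    refine ⟨by omega, ?_, ?_, ?_⟩ <;> norm_num
  · rcases lt_trichotomy (j - n) 0 with h2 | h2 | h2
    · right; right; left
      rw [sg_pos h1, sg_negv h2, if_neg (by omega)]
      refine ⟨by omega, ?_, ?_, ?_⟩ <;> norm_num
    · right; right; right; left
      rw [sg_pos h1, sg_zero h2, if_pos (by omega)]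
      refine ⟨by omega, ?_, ?_, ?_⟩ <;> norm_num
    · right; right; right; right
      rw [sg_pos h1, sg_pos h2, if_neg (by omega)]
      refine ⟨by omega, ?_, ?_, ?_⟩ <;> norm_num

lemma mm_mul (n : ℕ) (hn : 1 ≤ n) (j k : ℤ) :
    mm n j * mm n k = 1 - sg (j - k) * (bb n j - bb n k) / 2 - sg (j + k) * (bb n j + bb n k) / 2
      - dd n j * dd n k / 4 := by
  rcases five n hn j with ⟨h1, a1, a2, a3⟩ | ⟨h1, a1, a2, a3⟩ | ⟨h1, a1, a2, a3⟩ | ⟨h1, a1, a2, a3⟩ | ⟨h1, a1, a2, a3⟩ <;>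
  rcases five n hn k with ⟨h2, b1, b2, b3⟩ | ⟨h2, b1, b2, b3⟩ | ⟨h2, b1, b2, b3⟩ | ⟨h2, b1, b2, b3⟩ | ⟨h2, b1, b2, b3⟩ <;>
  rw [a1, a2, a3, b1, b2, b3] <;>
  rcases lt_trichotomy (j - k) 0 with h3 | h3 | h3 <;>
  rcases lt_trichotomy (j + k) 0 with h4 | h4 | h4 <;>
  first
  | (exfalso; omega)
  | (simp only [sg_pos, sg_negv, sg_zero, h3, h4]; norm_num)

lemma vol_II2 : (volume : Measure (ℝ × ℝ)).restrict (II ×ˢ II) =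
    (volume.restrict II).prod (volume.restrict II) := by
  rw [Measure.prod_restrict]; rfl

/-- phase -/
def ph (j k : ℤ) (α : ℝ) (p : ℝ × ℝ) : ℝ := j * p.1 + k * p.2 + α

def tp (n : ℕ) (r α : ℕ → ℝ) (j k : ℕ → ℤ) (p : ℝ × ℝ) : ℝ :=
  ∑ i ∈ Finset.range n, r i * Real.cos (ph (j i) (k i) (α i) p)

def Gp (n : ℕ) (r α : ℕ → ℝ) (j k : ℕ → ℤ) (p : ℝ × ℝ) : ℝ :=
  ∑ i ∈ Finset.range n, r i * (sg (j i + k i) * Real.sin (ph (j i) (k i) (α i) p))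

def Gm (n : ℕ) (r α : ℕ → ℝ) (j k : ℕ → ℤ) (p : ℝ × ℝ) : ℝ :=
  ∑ i ∈ Finset.range n, r i * (sg (j i - k i) * Real.sin (ph (j i) (k i) (α i) p))

lemma tp_cont (n r α j k) : Continuous (tp n r α j k) := by unfold tp ph; fun_prop
lemma Gp_cont (n r α j k) : Continuous (Gp n r α j k) := by unfold Gp ph; fun_prop
lemma Gm_cont (n r α j k) : Continuous (Gm n r α j k) := by unfold Gm ph; fun_prop

lemma ph_x (j k : ℤ) (α x y : ℝ) : ph j k α (x + 2 * Real.pi, y) = ph j k α (x, y) + j * (2 * Real.pi) := by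
  unfold ph; ring
lemma ph_y (j k : ℤ) (α x y : ℝ) : ph j k α (x, y + 2 * Real.pi) = ph j k α (x, y) + k * (2 * Real.pi) := by
  unfold ph; ring

lemma tp_bip (n r α j k) : Bip (tp n r α j k) := fun x y => by
  simp only [tp, ph_x, ph_y, Real.cos_add_int_mul_two_pi, and_self]
lemma Gp_bip (n r α j k) : Bip (Gp n r α j k) := fun x y => by
  simp only [Gp, ph_x, ph_y, Real.sin_add_int_mul_two_pi, and_self]
lemma Gm_bip (n r α j k) : Bip (Gm n r α j k) := fun x y => by
  simp only [Gm, ph_x, ph_y, Real.sin_add_int_mul_two_pi, and_self]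

lemma measurable_PhiY : Measurable PhiY := by
  unfold PhiY logPlus
  exact measurable_id.mul (Measurable.ite (measurableSet_lt measurable_const measurable_id)
    Real.measurable_log measurable_const)

lemma ph_line (j k a b : ℤ) (α θ : ℝ) (p : ℝ × ℝ) :
    ph j k α (p + θ • ((a : ℝ), (b : ℝ))) = ((j * a + k * b : ℤ) : ℝ) * θ + ph j k α p := by
  unfold ph; push_cast; simp; ring

lemma Gp_L1 (n r α j k) (h0 : ∀ p, 0 ≤ tp n r α j k p) :
    ∫⁻ p in T2, ENNReal.ofReal |Gp n r α j k p| ≤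
      ENNReal.ofReal (2 * Real.pi) * 130 + 12 * ∫⁻ p in T2, ENNReal.ofReal (PhiY (tp n r α j k p)) := by
  have cG := Gp_cont n r α j k
  have cT := tp_cont n r α j k
  refine transfer_le _ _ cG.abs.measurable.ennreal_ofReal (measurable_PhiY.comp cT.measurable).ennreal_ofReal
    ((Gp_bip n r α j k).comp fun x => ENNReal.ofReal |x|)
    ((tp_bip n r α j k).comp fun x => ENNReal.ofReal (PhiY x)) (((1 : ℤ) : ℝ), ((1 : ℤ) : ℝ)) _ _ fun p => ?_
  have := conj_lint n r (fun i => ph (j i) (k i) (α i) p) (fun i => j i * 1 + k i * 1) (fun θ => by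
    have := h0 (p + θ • (((1 : ℤ) : ℝ), ((1 : ℤ) : ℝ)))
    simp only [tp, ph_line] at this
    exact this)
  simp only [Gp, tp, ph_line, mul_one, Function.comp_apply] at this ⊢
  exact this

lemma Gm_L1 (n r α j k) (h0 : ∀ p, 0 ≤ tp n r α j k p) :
    ∫⁻ p in T2, ENNReal.ofReal |Gm n r α j k p| ≤
      ENNReal.ofReal (2 * Real.pi) * 130 + 12 * ∫⁻ p in T2, ENNReal.ofReal (PhiY (tp n r α j k p)) := by
  have cG := Gm_cont n r α j k
  have cT := tp_cont n r α j k
  refine transfer_le _ _ cG.abs.measurable.ennreal_ofReal (measurable_PhiY.comp cT.measurable).ennreal_ofReal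
    ((Gm_bip n r α j k).comp fun x => ENNReal.ofReal |x|)
    ((tp_bip n r α j k).comp fun x => ENNReal.ofReal (PhiY x)) (((1 : ℤ) : ℝ), ((-1 : ℤ) : ℝ)) _ _ fun p => ?_
  have := conj_lint n r (fun i => ph (j i) (k i) (α i) p) (fun i => j i * 1 + k i * (-1)) (fun θ => by
    have := h0 (p + θ • (((1 : ℤ) : ℝ), ((-1 : ℤ) : ℝ)))
    simp only [tp, ph_line] at this
    exact this)
  simp only [Gm, tp, ph_line, mul_one, mul_neg, ← sub_eq_add_neg, Function.comp_apply] at this ⊢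
  exact this

def KK (a : ℝ → ℝ) (f : ℝ × ℝ → ℝ) (p : ℝ × ℝ) : ℝ :=
  ∫ q in II ×ˢ II, a q.1 * a q.2 * f (p + q)

lemma KK_integrable {a : ℝ → ℝ} (ha : BM a) (f : ℝ × ℝ → ℝ) (p : ℝ × ℝ)
    (hf : IntegrableOn (fun q => f (p + q)) (II ×ˢ II)) :
    IntegrableOn (fun q : ℝ × ℝ => a q.1 * a q.2 * f (p + q)) (II ×ˢ II) := by
  obtain ⟨ma, C, hC⟩ := ha
  refine Integrable.bdd_mul (c := C * C) hf ?_ ?_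
  · exact ((ma.comp measurable_fst).mul (ma.comp measurable_snd)).aestronglyMeasurable
  · refine (ae_restrict_iff' (measurableSet_II.prod measurableSet_II)).2 (Eventually.of_forall ?_)
    intro q hq
    rw [norm_mul]
    exact mul_le_mul (hC _ hq.1) (hC _ hq.2) (norm_nonneg _) ((abs_nonneg _).trans (hC _ hq.1))

lemma KK_atom {a : ℝ → ℝ} (ha : BM a) (hev : ∀ t, a (-t) = a t) (j k : ℤ) (α : ℝ) (p : ℝ × ℝ) :
    KK a (fun p => Real.cos (ph j k α p)) p =
      (∫ t in II, a t * Real.cos (j * t)) * (∫ t in II, a t * Real.cos (k * t)) * Real.cos (ph j k α p) := by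
  unfold KK
  rw [vol_II2]
  have hs : ∀ m : ℤ, ∫ t in II, a t * Real.sin (m * t) = 0 := fun m =>
    int_II_odd _ (fun t => by simp [hev])
  have e : ∀ q : ℝ × ℝ, a q.1 * a q.2 * Real.cos (ph j k α (p + q)) =
      ((Real.cos (ph j k α p) * ((a q.1 * Real.cos (j * q.1)) * (a q.2 * Real.cos (k * q.2))) -
      Real.cos (ph j k α p) * ((a q.1 * Real.sin (j * q.1)) * (a q.2 * Real.sin (k * q.2)))) -
      Real.sin (ph j k α p) * ((a q.1 * Real.sin (j * q.1)) * (a q.2 * Real.cos (k * q.2)))) -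
      Real.sin (ph j k α p) * ((a q.1 * Real.cos (j * q.1)) * (a q.2 * Real.sin (k * q.2))) := by
    intro q
    have : ph j k α (p + q) = ph j k α p + (j * q.1 + k * q.2) := by unfold ph; simp; ring
    rw [this, Real.cos_add, Real.cos_add (j * q.1), Real.sin_add (j * q.1)]
    ring
  simp_rw [e]
  have ic : ∀ m : ℤ, Integrable (fun t => a t * Real.cos (m * t)) (volume.restrict II) := fun m =>
    (ha.mul (BM_cos' m)).integrable
  have is : ∀ m : ℤ, Integrable (fun t => a t * Real.sin (m * t)) (volume.restrict II) := fun m =>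
    (ha.mul (BM_sin' m)).integrable
  have i1 := ((ic j).mul_prod (ic k)).const_mul (Real.cos (ph j k α p))
  have i2 := ((is j).mul_prod (is k)).const_mul (Real.cos (ph j k α p))
  have i3 := ((is j).mul_prod (ic k)).const_mul (Real.sin (ph j k α p))
  have i4 := ((ic j).mul_prod (is k)).const_mul (Real.sin (ph j k α p))
  rw [integral_sub (by exact (i1.sub i2).sub i3) i4, integral_sub (by exact i1.sub i2) i3, integral_sub i1 i2,
    integral_const_mul, integral_const_mul, integral_const_mul, integral_const_mul,
    integral_prod_mul (fun t => a t * Real.cos (j * t)) (fun t => a t * Real.cos (k * t)),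
    integral_prod_mul (fun t => a t * Real.sin (j * t)) (fun t => a t * Real.sin (k * t)),
    integral_prod_mul (fun t => a t * Real.sin (j * t)) (fun t => a t * Real.cos (k * t)),
    integral_prod_mul (fun t => a t * Real.cos (j * t)) (fun t => a t * Real.sin (k * t)), hs, hs]
  ring

lemma cont_int_II2 (f : ℝ × ℝ → ℝ) (hf : Continuous f) (p : ℝ × ℝ) :
    IntegrableOn (fun q => f (p + q)) (II ×ˢ II) := by
  have h : Continuous fun q => f (p + q) := hf.comp (continuous_const.add continuous_id)
  have hc : IsCompact (Icc (-Real.pi) Real.pi ×ˢ Icc (-Real.pi) Real.pi : Set (ℝ × ℝ)) :=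
    isCompact_Icc.prod isCompact_Icc
  exact (h.continuousOn.integrableOn_compact hc).mono_set (prod_mono Ioo_subset_Icc_self Ioo_subset_Icc_self)

lemma KK_tp {a : ℝ → ℝ} (ha : BM a) (hev : ∀ t, a (-t) = a t) (n r α j k) (p : ℝ × ℝ) :
    KK a (tp n r α j k) p = ∑ i ∈ Finset.range n, r i *
      ((∫ t in II, a t * Real.cos (j i * t)) * (∫ t in II, a t * Real.cos (k i * t)) *
        Real.cos (ph (j i) (k i) (α i) p)) := by
  have hh : ∀ i, Continuous (fun p => Real.cos (ph (j i) (k i) (α i) p)) := fun i => by unfold ph; fun_prop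
  have e : ∀ q : ℝ × ℝ, a q.1 * a q.2 * tp n r α j k (p + q) =
      ∑ i ∈ Finset.range n, r i * (a q.1 * a q.2 * (fun p => Real.cos (ph (j i) (k i) (α i) p)) (p + q)) := by
    intro q; simp only [tp, Finset.mul_sum]
    refine Finset.sum_congr rfl fun i _ => by ring
  have h1 : KK a (tp n r α j k) p = ∑ i ∈ Finset.range n, r i * KK a (fun p => Real.cos (ph (j i) (k i) (α i) p)) p := by
    unfold KK
    simp_rw [e]
    have hI : ∀ i ∈ Finset.range n, Integrable (fun q : ℝ × ℝ => r i * (a q.1 * a q.2 * Real.cos (ph (j i) (k i) (α i) (p + q))))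
      (volume.restrict (II ×ˢ II)) := fun i _ =>
        (KK_integrable ha (fun p => Real.cos (ph (j i) (k i) (α i) p)) p (cont_int_II2 _ (hh i) p)).const_mul (r i)
    rw [integral_finsetSum _ hI]
    simp_rw [integral_const_mul]
  rw [h1]
  refine Finset.sum_congr rfl fun i _ => ?_
  rw [KK_atom ha hev]

def TT (n : ℕ) (g : ℝ → ℝ) (x : ℝ) : ℝ :=
  (1 / (4 * Real.pi)) * ∫ u in II, Real.cos (n * u) * ct u * (g (x + u) - g (x - u))

lemma TT_sum (n N : ℕ) (c β : ℕ → ℝ) (m : ℕ → ℤ) :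
    TT n (fun x => ∑ i ∈ Finset.range N, c i * Real.sin (m i * x + β i)) 0 =
      ∑ i ∈ Finset.range N, c i * (bb n (m i) * Real.cos (β i)) := by
  unfold TT
  have e : ∀ u : ℝ, Real.cos (n * u) * ct u *
      (∑ i ∈ Finset.range N, c i * Real.sin (m i * (0 + u) + β i) -
       ∑ i ∈ Finset.range N, c i * Real.sin (m i * (0 - u) + β i)) =
      ∑ i ∈ Finset.range N, (2 * c i * Real.cos (β i)) * (Real.cos (n * u) * ct u * Real.sin (m i * u)) := by
    intro u
    rw [← Finset.sum_sub_distrib, Finset.mul_sum]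
    refine Finset.sum_congr rfl fun i _ => ?_
    rw [zero_add, zero_sub, mul_neg, Real.sin_add, Real.sin_add, Real.sin_neg, Real.cos_neg]; ring
  have hi : ∀ i, Integrable (fun u => Real.cos (n * u) * ct u * Real.sin (m i * u)) (volume.restrict II) := by
    intro i
    have := ((BM_cos' n).mul (BM_sin_ct (m i))).integrable
    refine this.congr (Eventually.of_forall fun u => ?_)
    simp only; ring
  simp_rw [e]
  rw [integral_finsetSum _ fun i _ => (hi i).const_mul _, Finset.mul_sum]
  refine Finset.sum_congr rfl fun i _ => ?_
  rw [integral_const_mul, int_cot_conj]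
  have := Real.pi_pos.ne'
  field_simp; ring

def ex : ℝ × ℝ := (((1 : ℤ) : ℝ), ((0 : ℤ) : ℝ))
def ey : ℝ × ℝ := (((0 : ℤ) : ℝ), ((1 : ℤ) : ℝ))

lemma TT_lin (n N : ℕ) (c β : ℕ → ℝ) (j k : ℕ → ℤ) (a b : ℤ) (p : ℝ × ℝ) :
    TT n (lin ((a : ℝ), (b : ℝ)) (fun p => ∑ i ∈ Finset.range N, c i * Real.sin (ph (j i) (k i) (β i) p)) p) 0 =
      ∑ i ∈ Finset.range N, c i * (bb n (j i * a + k i * b) * Real.cos (ph (j i) (k i) (β i) p)) := by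
  rw [← TT_sum n N c (fun i => ph (j i) (k i) (β i) p) (fun i => j i * a + k i * b)]
  congr 1
  ext x
  simp only [lin, ph_line]

/-- The modified partial sums. -/
def SS (n : ℕ) (f : ℝ × ℝ → ℝ) (p : ℝ × ℝ) : ℝ := (1 / Real.pi ^ 2) * KK (Dst n) f p
/-- Error term. -/
def EE (n : ℕ) (f : ℝ × ℝ → ℝ) (p : ℝ × ℝ) : ℝ :=
  (1 / (4 * Real.pi ^ 2)) * KK (fun t => Real.cos (n * t)) f p

lemma SS_identity (n : ℕ) (hn : 1 ≤ n) (N r α j k) (p : ℝ × ℝ) :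
    SS n (tp N r α j k) p = tp N r α j k p
      - (1/2) * TT n (lin ex (Gm N r α j k) p) 0 + (1/2) * TT n (lin ey (Gm N r α j k) p) 0
      - (1/2) * TT n (lin ex (Gp N r α j k) p) 0 - (1/2) * TT n (lin ey (Gp N r α j k) p) 0
      - EE n (tp N r α j k) p := by
  have eGm : Gm N r α j k = fun p => ∑ i ∈ Finset.range N, (r i * sg (j i - k i)) * Real.sin (ph (j i) (k i) (α i) p) := by
    ext p; simp only [Gm, mul_assoc]
  have eGp : Gp N r α j k = fun p => ∑ i ∈ Finset.range N, (r i * sg (j i + k i)) * Real.sin (ph (j i) (k i) (α i) p) := by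
    ext p; simp only [Gp, mul_assoc]
  have hc : BM (fun t => Real.cos (n * t)) := BM_cos' n
  rw [SS, EE, KK_tp (BM_Dst n) (Dst_neg n), KK_tp hc (fun t => by simp), eGm, eGp, ex, ey]
  rw [TT_lin, TT_lin, TT_lin, TT_lin, tp]
  simp only [Finset.mul_sum, ← Finset.sum_sub_distrib, ← Finset.sum_add_distrib]
  refine Finset.sum_congr rfl fun i _ => ?_
  rw [int_Dst_cos, int_Dst_cos, int_cos_cos n hn, int_cos_cos n hn]
  simp only [mul_one, mul_zero, add_zero, zero_add]
  have h := mm_mul n hn (j i) (k i)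
  have hpi := Real.pi_pos.ne'
  have e1 : 1 / Real.pi ^ 2 * (r i * (Real.pi * mm n (j i) * (Real.pi * mm n (k i)) * Real.cos (ph (j i) (k i) (α i) p)))
    = r i * (mm n (j i) * mm n (k i)) * Real.cos (ph (j i) (k i) (α i) p) := by field_simp
  have e2 : 1 / (4 * Real.pi ^ 2) * (r i * (Real.pi * dd n (j i) * (Real.pi * dd n (k i)) * Real.cos (ph (j i) (k i) (α i) p)))
    = r i * (dd n (j i) * dd n (k i) / 4) * Real.cos (ph (j i) (k i) (α i) p) := by field_simp
  rw [e1, e2, h]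
  ring

def DD (M : ℕ) (w : ℝ) : ℂ := ∑ i ∈ Finset.range (2 * M), Complex.exp (Complex.I * w) ^ i

def JJ (M : ℕ) (w : ℝ) : ℝ := ‖DD M w‖ ^ 2

lemma JJ_cont (M : ℕ) : Continuous (JJ M) := by unfold JJ DD; fun_prop

lemma JJ_nonneg (M : ℕ) (w : ℝ) : 0 ≤ JJ M w := by unfold JJ; positivity

lemma JJ_periodic (M : ℕ) : Function.Periodic (JJ M) (2 * Real.pi) := by
  intro w
  unfold JJ DD
  have : Complex.exp (Complex.I * ((w + 2 * Real.pi : ℝ) : ℂ)) = Complex.exp (Complex.I * w) := by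
    rw [Complex.exp_eq_exp_iff_exists_int]; exact ⟨1, by push_cast; ring⟩
  rw [this]

lemma JJ_neg (M : ℕ) (w : ℝ) : JJ M (-w) = JJ M w := by
  unfold JJ
  have : DD M (-w) = (starRingEnd ℂ) (DD M w) := by
    unfold DD
    rw [map_sum]
    refine Finset.sum_congr rfl fun i _ => ?_
    rw [map_pow, ← Complex.exp_conj]
    simp
  rw [this, RCLike.norm_conj]

lemma JJ_le (M : ℕ) (hM : 1 ≤ M) (w : ℝ) (hw : w ∈ II) : JJ M w ≤ Real.pi ^ 2 * M ^ 2 * psi (M * w) := by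
  have hM' : (1 : ℝ) ≤ M := by exact_mod_cast hM
  have hM0 : (0 : ℝ) < M := by linarith
  have hpi := Real.pi_gt_three
  by_cases h : |(M : ℝ) * w| ≤ 1
  · rw [psi, if_pos h, mul_one]
    have : ‖DD M w‖ ≤ 2 * M := by
      unfold DD
      refine (norm_sum_le _ _).trans ?_
      have : ∀ i ∈ Finset.range (2 * M), ‖Complex.exp (Complex.I * w) ^ i‖ ≤ 1 := fun i _ => by
        rw [norm_pow, mul_comm, Complex.norm_exp_ofReal_mul_I, one_pow]
      refine (Finset.sum_le_sum this).trans ?_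
      simp
    unfold JJ
    calc ‖DD M w‖ ^ 2 ≤ (2 * (M : ℝ)) ^ 2 := by gcongr
      _ = 4 * (M : ℝ) ^ 2 := by ring
      _ ≤ _ := by gcongr; nlinarith
  · rw [psi, if_neg h]
    push Not at h
    set y := |(M : ℝ) * w| with hy
    have hyw : y = M * |w| := by rw [hy, abs_mul, abs_of_pos hM0]
    have hw0 : 0 < |w| := by
      by_contra hc
      have : |w| = 0 := le_antisymm (not_lt.1 hc) (abs_nonneg _)
      rw [hyw, this] at h; norm_num at h
    have hs : |w| / Real.pi ≤ |Real.sin (w / 2)| := by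
      have h1 : |w| / 2 ≤ Real.pi / 2 := by
        have := abs_lt.2 ⟨hw.1, hw.2⟩; linarith
      have h2 := Real.mul_le_sin (x := |w| / 2) (by positivity) h1
      have h3 : Real.sin (|w| / 2) ≤ |Real.sin (w / 2)| := by
        rcases abs_cases w with ⟨e, _⟩ | ⟨e, _⟩
        · rw [e]; exact le_abs_self _
        · rw [e, neg_div, Real.sin_neg]; exact neg_le_abs _
      calc |w| / Real.pi = 2 / Real.pi * (|w| / 2) := by ring
        _ ≤ _ := h2.trans h3
    have hD : ‖DD M w‖ * (2 * |Real.sin (w / 2)|) ≤ 2 := by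
      have h1 : ‖Complex.exp (Complex.I * w) - 1‖ = 2 * |Real.sin (w / 2)| := by
        rw [Complex.norm_exp_I_mul_ofReal_sub_one, norm_mul, Real.norm_eq_abs, Real.norm_eq_abs]; norm_num
      rw [← h1, ← norm_mul]
      unfold DD
      rw [geom_sum_mul]
      refine (norm_sub_le _ _).trans ?_
      rw [norm_pow, mul_comm, Complex.norm_exp_ofReal_mul_I, one_pow, norm_one]; norm_num
    have hD2 : ‖DD M w‖ * |w| ≤ Real.pi := by
      have h1 : ‖DD M w‖ * (|w| / Real.pi) ≤ ‖DD M w‖ * |Real.sin (w / 2)| := by gcongr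
      have h2 : ‖DD M w‖ * (|w| / Real.pi) ≤ 1 := by linarith
      rw [mul_div_assoc', div_le_one Real.pi_pos] at h2
      exact h2
    have hD3 : ‖DD M w‖ * y ≤ Real.pi * M := by rw [hyw]; nlinarith
    have hsq : √y ≤ y := by rw [Real.sqrt_le_left (by linarith)]; nlinarith
    have hsp : 0 < √y := Real.sqrt_pos.2 (by linarith)
    rw [mul_one_div, le_div_iff₀ (by positivity)]
    unfold JJ
    calc ‖DD M w‖ ^ 2 * (y * √y) ≤ ‖DD M w‖ ^ 2 * (y * y) := by gcongr
      _ = (‖DD M w‖ * y) ^ 2 := by ring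
      _ ≤ (Real.pi * M) ^ 2 := by gcongr
      _ = _ := by ring

lemma cos_sum_le (M : ℕ) (a w : ℝ) :
    |∑ i ∈ Finset.range (2 * M), ∑ l ∈ Finset.range (2 * M), Real.cos ((a + i - l) * w)| ≤ JJ M w := by
  have e : ∑ i ∈ Finset.range (2 * M), ∑ l ∈ Finset.range (2 * M), Real.cos ((a + i - l) * w) =
      (Complex.exp (Complex.I * (a * w : ℝ)) * (DD M w * (starRingEnd ℂ) (DD M w))).re := by
    unfold DD
    rw [map_sum, Finset.sum_mul_sum, Finset.mul_sum, Complex.re_sum]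
    refine Finset.sum_congr rfl fun i _ => ?_
    rw [Finset.mul_sum, Complex.re_sum]
    refine Finset.sum_congr rfl fun l _ => ?_
    rw [map_pow, ← Complex.exp_conj, ← Complex.exp_nat_mul, ← Complex.exp_nat_mul, ← Complex.exp_add, ← Complex.exp_add,
      ← Complex.exp_ofReal_mul_I_re]
    congr 2
    simp only [map_mul, Complex.conj_I, Complex.conj_ofReal]
    push_cast; ring
  rw [e]
  refine (Complex.abs_re_le_norm _).trans ?_
  rw [norm_mul, norm_mul, RCLike.norm_conj, mul_comm Complex.I, Complex.norm_exp_ofReal_mul_I, one_mul, JJ, sq]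

lemma pair_count (M : ℕ) (x : ℤ → ℝ) (hx : ∀ n, 0 ≤ x n) :
    M * ∑ k ∈ Finset.range M, x k ≤ ∑ i ∈ Finset.range (2 * M), ∑ l ∈ Finset.range (2 * M), x ((i : ℤ) - l) := by
  rw [Finset.sum_comm]
  have h1 : ∑ l ∈ Finset.range M, ∑ i ∈ Finset.range (2 * M), x ((i : ℤ) - l) ≤
      ∑ l ∈ Finset.range (2 * M), ∑ i ∈ Finset.range (2 * M), x ((i : ℤ) - l) :=
    Finset.sum_le_sum_of_subset_of_nonneg (Finset.range_subset_range.2 (by omega))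
      (fun _ _ _ => Finset.sum_nonneg fun _ _ => hx _)
  refine le_trans ?_ h1
  have h2 : ∀ l ∈ Finset.range M, ∑ k ∈ Finset.range M, x k ≤ ∑ i ∈ Finset.range (2 * M), x ((i : ℤ) - l) := by
    intro l hl
    have hl' := Finset.mem_range.1 hl
    have e : ∑ k ∈ Finset.range M, x k = ∑ i ∈ Finset.Ico l (l + M), x ((i : ℤ) - l) := by
      rw [Finset.sum_Ico_eq_sum_range]
      simp
    rw [e]
    refine Finset.sum_le_sum_of_subset_of_nonneg ?_ (fun _ _ _ => hx _)
    intro i hi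
    rw [Finset.mem_Ico] at hi
    exact Finset.mem_range.2 (by omega)
  refine le_trans (le_of_eq ?_) (Finset.sum_le_sum h2)
  simp

lemma farSet_sub_II (M : ℕ) : farSet M ⊆ II := fun u hu => by
  have := abs_lt.1 hu.2; exact ⟨this.1, this.2⟩

instance (M : ℕ) : IsFiniteMeasure (volume.restrict (farSet M)) := ⟨by
  rw [Measure.restrict_apply_univ]
  refine (measure_mono (farSet_sub_II M)).trans_lt ?_
  rw [volume_II]; exact ENNReal.ofReal_lt_top⟩

lemma far_inner (g : ℝ → ℝ≥0∞) (hp : Function.Periodic g (2 * Real.pi)) (M : ℕ) (hM : 1 ≤ M) (u : ℝ) :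
    ∫⁻ v in farSet M, g v * ENNReal.ofReal (JJ M (v - u)) ≤ ENNReal.ofReal (Real.pi ^ 2 * M) * AA M g u := by
  have hM0 : (0 : ℝ) < M := by exact_mod_cast hM
  have hper : Function.Periodic (fun v => g v * ENNReal.ofReal (JJ M (v - u))) (2 * Real.pi) := fun v => by
    simp only
    rw [hp v, show v + 2 * Real.pi - u = (v - u) + 2 * Real.pi by ring, JJ_periodic]
  calc ∫⁻ v in farSet M, g v * ENNReal.ofReal (JJ M (v - u)) ≤ ∫⁻ v in T1, g v * ENNReal.ofReal (JJ M (v - u)) := by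
        refine lintegral_mono_set ((farSet_sub_II M).trans ?_)
        exact Ioo_subset_Ico_self
    _ = ∫⁻ t in T1, g (u + t) * ENNReal.ofReal (JJ M (u + t - u)) := (per_lint_shift _ hper u).symm
    _ = ∫⁻ t in II, g (u + t) * ENNReal.ofReal (JJ M (u + t - u)) := by
        rw [setLIntegral_congr T1_ae_Ioo]; rfl
    _ ≤ ∫⁻ t in II, ENNReal.ofReal (Real.pi ^ 2 * M) * (pker M t * g (u + t)) := by
        refine setLIntegral_mono' measurableSet_II fun t ht => ?_
        rw [← mul_assoc, mul_comm (g (u + t)), pker, ← ENNReal.ofReal_mul (by positivity), add_sub_cancel_left]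
        gcongr
        refine (JJ_le M hM t ht).trans (le_of_eq ?_)
        ring
    _ = _ := by rw [lintegral_const_mul' _ _ ENNReal.ofReal_ne_top]; rfl

lemma far_energy (g : ℝ → ℝ) (hg : BM g) (hp : Function.Periodic g (2 * Real.pi)) (M : ℕ) (hM : 1 ≤ M) (a : ℝ) :
    ENNReal.ofReal (∑ i ∈ Finset.range (2 * M), ∑ l ∈ Finset.range (2 * M),
      ((∫ u in farSet M, Real.cos ((a + i - l) * u) * (ct u * g u)) ^ 2 +
       (∫ u in farSet M, Real.sin ((a + i - l) * u) * (ct u * g u)) ^ 2)) ≤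
    ENNReal.ofReal (4 * Real.pi ^ 2 * M ^ 2) * QQ M (fun t => ENNReal.ofReal |g t|) 0 := by
  have hM0 : (0 : ℝ) < M := by exact_mod_cast hM
  set μ := (volume : Measure ℝ).restrict (farSet M) with hμ
  obtain ⟨mg, C, hC⟩ := hg
  have mct := measurable_ct
  have hb : ∀ t ∈ farSet M, |ct t * g t| ≤ 2 * M * C := by
    intro t ht
    have h1 := ct_bound t (farSet_sub_II M ht)
    have h2 : 2 / |t| ≤ 2 * M := by
      have : 0 < |t| := lt_trans (by positivity) ht.1
      rw [div_le_iff₀ this]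
      have := ht.1
      rw [div_lt_iff₀ hM0] at this
      linarith
    rw [abs_mul]
    exact mul_le_mul (h1.trans h2) (hC t (farSet_sub_II M ht)) (abs_nonneg _) (by positivity)
  have hI : ∀ b : ℝ → ℝ, Measurable b → (∀ t, |b t| ≤ 1) → Integrable (fun u => b u * (ct u * g u)) μ := by
    intro b mb hb1
    refine Measure.integrableOn_of_bounded (s := farSet M) (M := 2 * M * C) (measure_ne_top_of_subset (farSet_sub_II M) (by rw [volume_II]; exact ENNReal.ofReal_ne_top)) (mb.mul (mct.mul mg)).aestronglyMeasurable ?_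
    refine (ae_restrict_iff' (measurableSet_farSet M)).2 (Eventually.of_forall fun t ht => ?_)
    rw [Real.norm_eq_abs, abs_mul]
    calc |b t| * |ct t * g t| ≤ 1 * (2 * M * C) := mul_le_mul (hb1 t) (hb t ht) (abs_nonneg _) zero_le_one
      _ = _ := one_mul _
  have hIc : ∀ n : ℝ, Integrable (fun u => Real.cos (n * u) * (ct u * g u)) μ := fun n =>
    hI _ (by fun_prop) fun t => Real.abs_cos_le_one _
  have hIs : ∀ n : ℝ, Integrable (fun u => Real.sin (n * u) * (ct u * g u)) μ := fun n =>
    hI _ (by fun_prop) fun t => Real.abs_sin_le_one _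
  have ide : ∀ n : ℝ, (∫ u, Real.cos (n * u) * (ct u * g u) ∂μ) ^ 2 + (∫ u, Real.sin (n * u) * (ct u * g u) ∂μ) ^ 2 =
      ∫ z, Real.cos (n * (z.2 - z.1)) * ((ct z.1 * g z.1) * (ct z.2 * g z.2)) ∂(μ.prod μ) := by
    intro n
    rw [sq, sq, ← integral_prod_mul, ← integral_prod_mul, ← integral_add ((hIc n).mul_prod (hIc n)) ((hIs n).mul_prod (hIs n))]
    refine integral_congr_ae (Eventually.of_forall fun z => ?_)
    simp only [mul_sub, Real.cos_sub]
    ring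
  have iint : ∀ n : ℝ, Integrable (fun z : ℝ × ℝ => Real.cos (n * (z.2 - z.1)) * ((ct z.1 * g z.1) * (ct z.2 * g z.2))) (μ.prod μ) := by
    intro n
    refine (((hIc n).mul_prod (hIc n)).add ((hIs n).mul_prod (hIs n))).congr (Eventually.of_forall fun z => ?_)
    simp only [Pi.add_apply, mul_sub, Real.cos_sub]
    ring
  simp_rw [ide]
  have esum : ∑ i ∈ Finset.range (2 * M), ∑ l ∈ Finset.range (2 * M),
      ∫ z, Real.cos ((a + i - l) * (z.2 - z.1)) * ((ct z.1 * g z.1) * (ct z.2 * g z.2)) ∂(μ.prod μ) =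
      ∫ z, (∑ i ∈ Finset.range (2 * M), ∑ l ∈ Finset.range (2 * M), Real.cos ((a + i - l) * (z.2 - z.1))) * ((ct z.1 * g z.1) * (ct z.2 * g z.2)) ∂(μ.prod μ) := by
    simp_rw [Finset.sum_mul]
    rw [integral_finsetSum _ fun i _ => integrable_finsetSum _ fun l _ => iint _]
    refine Finset.sum_congr rfl fun i _ => ?_
    rw [integral_finsetSum _ fun l _ => iint _]
  rw [esum]
  set h : ℝ → ℝ≥0∞ := fun t => ENNReal.ofReal |g t| with hh
  have mh : Measurable h := mg.abs.ennreal_ofReal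
  have ph : Function.Periodic h (2 * Real.pi) := fun t => by simp only [hh, hp t]
  have mJ := (JJ_cont M).measurable
  set G : ℝ × ℝ → ℝ≥0∞ := fun z => ENNReal.ofReal (2 / z.1 ^ 2) * h z.1 * (h z.2 * ENNReal.ofReal (JJ M (z.2 - z.1))) with hG
  have mG : Measurable G := by
    have m1 : Measurable fun z : ℝ × ℝ => h z.1 := mh.comp measurable_fst
    have m2 : Measurable fun z : ℝ × ℝ => h z.2 := mh.comp measurable_snd
    have m3 : Measurable fun z : ℝ × ℝ => JJ M (z.2 - z.1) := mJ.comp (measurable_snd.sub measurable_fst)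
    have m4 : Measurable fun z : ℝ × ℝ => 2 / z.1 ^ 2 := by fun_prop
    exact (m4.ennreal_ofReal.mul m1).mul (m2.mul m3.ennreal_ofReal)
  have hGint : ∫⁻ z, G z ∂(μ.prod μ) ≤ ENNReal.ofReal (2 * Real.pi ^ 2 * M ^ 2) * QQ M h 0 := by
    rw [lintegral_prod _ mG.aemeasurable]
    calc ∫⁻ u, ∫⁻ v, G (u, v) ∂μ ∂μ ≤ ∫⁻ u, ENNReal.ofReal (2 * Real.pi ^ 2 * M ^ 2) * (ENNReal.ofReal (1 / (M * u ^ 2)) * h (0 + u) * AA M h (0 + u)) ∂μ := by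
          refine lintegral_mono fun u => ?_
          simp only [hG, zero_add]
          rw [lintegral_const_mul' _ _ (ENNReal.mul_ne_top ENNReal.ofReal_ne_top (by simp [hh]))]
          refine (mul_le_mul_right (far_inner h ph M hM u) _).trans (le_of_eq ?_)
          have : ENNReal.ofReal (2 * Real.pi ^ 2 * M ^ 2) * ENNReal.ofReal (1 / (M * u ^ 2)) =
            ENNReal.ofReal (2 / u ^ 2) * ENNReal.ofReal (Real.pi ^ 2 * M) := by
            rw [← ENNReal.ofReal_mul (by positivity), ← ENNReal.ofReal_mul (by positivity)]
            congr 1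
            by_cases hu : u = 0
            · simp [hu]
            · field_simp
          rw [← mul_assoc, ← mul_assoc (ENNReal.ofReal (2 * Real.pi ^ 2 * M ^ 2)), ← mul_assoc (ENNReal.ofReal (2 * Real.pi ^ 2 * M ^ 2)), this]
          ring
      _ = _ := by rw [lintegral_const_mul' _ _ ENNReal.ofReal_ne_top]; rfl
  have hmem : ∀ᵐ z ∂(μ.prod μ), z ∈ farSet M ×ˢ farSet M := by
    rw [hμ, Measure.prod_restrict]
    exact ae_restrict_mem ((measurableSet_farSet M).prod (measurableSet_farSet M))
  refine (ENNReal.ofReal_le_ofReal (Real.le_norm_self _)).trans ?_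
  rw [ofReal_norm]
  refine (enorm_integral_le_lintegral_enorm _).trans ?_
  calc ∫⁻ z, ‖(∑ i ∈ Finset.range (2 * M), ∑ l ∈ Finset.range (2 * M), Real.cos ((a + i - l) * (z.2 - z.1))) * ((ct z.1 * g z.1) * (ct z.2 * g z.2))‖ₑ ∂(μ.prod μ)
      ≤ ∫⁻ z, (G z + G z.swap) ∂(μ.prod μ) := by
        refine lintegral_mono_ae ?_
        filter_upwards [hmem] with z hz
        have p1 : 0 < |z.1| := lt_trans (by positivity) hz.1.1
        have p2 : 0 < |z.2| := lt_trans (by positivity) hz.2.1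
        have b1 := ct_bound z.1 (farSet_sub_II M hz.1)
        have b2 := ct_bound z.2 (farSet_sub_II M hz.2)
        have bJ := cos_sum_le M a (z.2 - z.1)
        have J0 := JJ_nonneg M (z.2 - z.1)
        simp only [hG, hh, Prod.fst_swap, Prod.snd_swap]
        rw [← neg_sub z.2 z.1, JJ_neg, ← ENNReal.ofReal_mul (by positivity), ← ENNReal.ofReal_mul (by positivity),
          ← ENNReal.ofReal_mul (by positivity), ← ENNReal.ofReal_mul (by positivity), ← ENNReal.ofReal_mul (by positivity), ← ENNReal.ofReal_mul (by positivity),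
          ← ENNReal.ofReal_add (by positivity) (by positivity), ← ofReal_norm]
        refine ENNReal.ofReal_le_ofReal ?_
        rw [Real.norm_eq_abs, abs_mul, abs_mul, abs_mul, abs_mul]
        have key : 2 / |z.1| * (2 / |z.2|) ≤ 2 / z.1 ^ 2 + 2 / z.2 ^ 2 := by
          have : 0 ≤ 2 * (1 / |z.1| - 1 / |z.2|) ^ 2 := by positivity
          rw [← sq_abs z.1, ← sq_abs z.2]
          have e : 2 / |z.1| ^ 2 + 2 / |z.2| ^ 2 - 2 / |z.1| * (2 / |z.2|) = 2 * (1 / |z.1| - 1 / |z.2|) ^ 2 := by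
            field_simp; ring
          linarith
        have kk : |ct z.1| * |ct z.2| ≤ 2 / z.1 ^ 2 + 2 / z.2 ^ 2 :=
          (mul_le_mul b1 b2 (abs_nonneg _) (by positivity)).trans key
        calc _ ≤ JJ M (z.2 - z.1) * (|ct z.1| * |g z.1| * (|ct z.2| * |g z.2|)) := by gcongr
          _ = (|ct z.1| * |ct z.2|) * (JJ M (z.2 - z.1) * |g z.1| * |g z.2|) := by ring
          _ ≤ (2 / z.1 ^ 2 + 2 / z.2 ^ 2) * (JJ M (z.2 - z.1) * |g z.1| * |g z.2|) := by gcongr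
          _ = _ := by ring
    _ = 2 * ∫⁻ z, G z ∂(μ.prod μ) := by
        rw [lintegral_add_left mG, lintegral_prod_swap, two_mul]
    _ ≤ 2 * (ENNReal.ofReal (2 * Real.pi ^ 2 * M ^ 2) * QQ M h 0) := by gcongr
    _ = _ := by
        rw [← mul_assoc]; congr 1
        rw [← ENNReal.ofReal_ofNat, ← ENNReal.ofReal_mul (by norm_num)]; congr 1; ring

lemma int_sym (S : Set ℝ) (hS : MeasurableSet S) (hs : ∀ u, -u ∈ S ↔ u ∈ S) (f : ℝ → ℝ) :
    ∫ t in S, f (-t) = ∫ t in S, f t := by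
  rw [← integral_indicator hS, ← integral_indicator hS, ← integral_neg_eq_self]
  congr 1; ext t
  by_cases h : t ∈ S
  · rw [indicator_of_mem ((hs t).2 h), indicator_of_mem h, neg_neg]
  · rw [indicator_of_notMem (fun h' => h ((hs t).1 h')), indicator_of_notMem h]

lemma osc (g : ℝ → ℝ) (hg : BM g) (hp : Function.Periodic g (2 * Real.pi))
    (hd : IntegrableOn (fun u => ct u * (g u - g (-u))) II) (M : ℕ) (hM : 1 ≤ M) (a : ℕ) (A Q : ℝ)
    (hA0 : 0 ≤ A) (hQ0 : 0 ≤ Q)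
    (hA : AA M (fun t => ENNReal.ofReal |g t|) 0 ≤ ENNReal.ofReal A)
    (hQ : QQ M (fun t => ENNReal.ofReal |g t|) 0 ≤ ENNReal.ofReal Q) :
    ∃ c : ℝ, (1 / (M : ℝ)) * ∑ k ∈ Finset.range M, |TT (a + k) g 0 - c| ≤ A + √Q := by
  have hM1 : (1 : ℝ) ≤ M := by exact_mod_cast hM
  have hM0 : (0 : ℝ) < M := by exact_mod_cast hM
  have hpi := Real.pi_gt_three
  have mg := hg.1
  have mF := measurableSet_farSet M
  set near := II \ farSet M with hnear
  have mN : MeasurableSet near := measurableSet_II.diff mF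
  have sF : ∀ u, -u ∈ farSet M ↔ u ∈ farSet M := fun u => by simp [farSet]
  have sI : ∀ u, -u ∈ II ↔ u ∈ II := fun u => by simp only [II, mem_Ioo]; constructor <;> rintro ⟨h1, h2⟩ <;> constructor <;> linarith
  have sN : ∀ u, -u ∈ near ↔ u ∈ near := fun u => by simp only [hnear, Set.mem_sdiff, sF, sI]
  have nu : ∀ u ∈ near, |u| ≤ 1 / M := by
    intro u hu
    by_contra hc
    exact hu.2 ⟨not_le.1 hc, abs_lt.2 ⟨hu.1.1, hu.1.2⟩⟩
  set ρ : ℝ → ℝ → ℝ := fun n u => Real.cos (n * u) * ct u * (g (0 + u) - g (0 - u)) with hρ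
  have iρ : ∀ n, IntegrableOn (ρ n) II := by
    intro n
    have : Integrable (fun u => Real.cos (n * u) * (ct u * (g u - g (-u)))) (volume.restrict II) := by
      refine Integrable.bdd_mul (c := 1) hd (by fun_prop) (Eventually.of_forall fun u => ?_)
      exact Real.abs_cos_le_one _
    refine this.congr (Eventually.of_forall fun u => ?_)
    simp only [hρ, zero_add, zero_sub]; ring
  have split : ∀ n, ∫ u in II, ρ n u = (∫ u in farSet M, ρ n u) + ∫ u in near, ρ n u := by
    intro n
    rw [← integral_inter_add_sdiff mF (iρ n), inter_eq_self_of_subset_right (farSet_sub_II M)]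
  -- near part
  have nsub : near ⊆ II := sdiff_subset
  have hgN : IntegrableOn (fun u => |g u|) near := IntegrableOn.mono_set (show IntegrableOn (fun u => |g u|) II volume from hg.integrable.abs) nsub
  have hgN' : IntegrableOn (fun u => |g (-u)|) near := by
    obtain ⟨C, hC⟩ := hg.2
    refine Measure.integrableOn_of_bounded (M := C) (measure_ne_top_of_subset nsub (by rw [volume_II]; exact ENNReal.ofReal_ne_top)) ((mg.comp measurable_neg).abs).aestronglyMeasurable ?_
    refine (ae_restrict_iff' mN).2 (Eventually.of_forall fun t ht => ?_)
    rw [Real.norm_eq_abs, abs_abs]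
    exact hC _ ((sI t).2 (nsub ht))
  have hAr : M * ∫ u in near, |g u| ≤ A := by
    rw [← ENNReal.ofReal_le_ofReal_iff hA0, ENNReal.ofReal_mul hM0.le,
      ofReal_integral_eq_lintegral_ofReal hgN (Eventually.of_forall fun _ => abs_nonneg _),
      ← lintegral_const_mul' _ _ ENNReal.ofReal_ne_top]
    refine le_trans ?_ hA
    unfold AA
    calc ∫⁻ u in near, ENNReal.ofReal M * ENNReal.ofReal |g u| ≤ ∫⁻ u in near, pker M u * ENNReal.ofReal |g (0 + u)| := by
          refine setLIntegral_mono' mN fun u hu => ?_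
          rw [pker, psi, if_pos, mul_one, zero_add]
          rw [abs_mul, abs_of_pos hM0]
          have := nu u hu
          rw [le_div_iff₀ hM0] at this
          linarith
      _ ≤ _ := lintegral_mono_set nsub
  have nearb : ∀ k < M, |(∫ u in near, ρ ((a + k : ℕ) : ℝ) u) - ∫ u in near, ρ a u| ≤ 4 * A := by
    intro k hk
    rw [← integral_sub ((iρ _).mono_set nsub) ((iρ _).mono_set nsub)]
    have hb : ∀ u ∈ near, ‖ρ ((a + k : ℕ) : ℝ) u - ρ a u‖ ≤ 2 * M * (|g u| + |g (-u)|) := by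
      intro u hu
      have e : ρ ((a + k : ℕ) : ℝ) u - ρ a u = (Real.cos ((a + k : ℕ) * u) - Real.cos (a * u)) * ct u * (g u - g (-u)) := by
        simp only [hρ, zero_add, zero_sub]; ring
      rw [e, Real.norm_eq_abs, abs_mul, abs_mul]
      by_cases h0 : u = 0
      · subst h0; simp; positivity
      have hu0 : 0 < |u| := abs_pos.2 h0
      have h1 : |Real.cos ((a + k : ℕ) * u) - Real.cos (a * u)| ≤ M * |u| := by
        refine (Real.abs_cos_sub_cos_le _ _).trans ?_
        push_cast
        rw [← sub_mul, add_sub_cancel_left, abs_mul, Nat.abs_cast]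
        have : (k : ℝ) ≤ M := by exact_mod_cast hk.le
        gcongr
      have h2 := ct_bound u hu.1
      calc _ ≤ M * |u| * (2 / |u|) * (|g u| + |g (-u)|) := by
            gcongr
            exact abs_sub _ _
        _ = _ := by field_simp
    refine (norm_integral_le_of_norm_le ((hgN.add hgN').const_mul (2 * M : ℝ)) ((ae_restrict_iff' mN).2 (Eventually.of_forall hb))).trans ?_
    rw [integral_const_mul]
    have e2 : ∫ u in near, (|g u| + |g (-u)|) = 2 * ∫ u in near, |g u| := by
      rw [integral_add hgN hgN', int_sym near mN sN (fun u => |g u|)]; ring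
    simp only [Pi.add_apply]
    rw [e2]
    linarith
  -- far part
  set Cn : ℤ → ℝ := fun n => ∫ u in farSet M, Real.cos ((a + n) * u) * (ct u * g u) with hCn
  set Sn : ℤ → ℝ := fun n => ∫ u in farSet M, Real.sin ((a + n) * u) * (ct u * g u) with hSn
  have hEn := (far_energy g hg hp M hM a).trans (mul_le_mul_right hQ _)
  rw [← ENNReal.ofReal_mul (by positivity), ENNReal.ofReal_le_ofReal_iff (by positivity)] at hEn
  have hpc := pair_count M (fun n => Cn n ^ 2 + Sn n ^ 2) (fun n => by positivity)
  have hsq : ∑ k ∈ Finset.range M, Cn k ^ 2 ≤ 4 * Real.pi ^ 2 * M * Q := by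
    have h1 : ∑ k ∈ Finset.range M, Cn k ^ 2 ≤ ∑ k ∈ Finset.range M, (Cn k ^ 2 + Sn k ^ 2) :=
      Finset.sum_le_sum fun k _ => by nlinarith [sq_nonneg (Sn k)]
    have h2 : M * ∑ k ∈ Finset.range M, (Cn k ^ 2 + Sn k ^ 2) ≤ 4 * Real.pi ^ 2 * M ^ 2 * Q := by
      refine hpc.trans (le_trans (le_of_eq ?_) hEn)
      refine Finset.sum_congr rfl fun i _ => Finset.sum_congr rfl fun l _ => ?_
      simp only [hCn, hSn]
      push_cast
      simp only [add_sub_assoc]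
    refine h1.trans (le_of_mul_le_mul_left (h2.trans (le_of_eq ?_)) hM0)
    ring
  have hsum : ∑ k ∈ Finset.range M, |Cn k| ≤ 2 * Real.pi * M * √Q := by
    refine abs_le_of_sq_le_sq' ?_ (by positivity) |>.2
    have := sq_sum_le_card_mul_sum_sq (s := Finset.range M) (f := fun k : ℕ => |Cn k|)
    simp only [sq_abs, Finset.card_range] at this
    refine this.trans ?_
    rw [mul_pow, Real.sq_sqrt hQ0]
    calc (M : ℝ) * ∑ k ∈ Finset.range M, Cn k ^ 2 ≤ M * (4 * Real.pi ^ 2 * M * Q) := by gcongr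
      _ = _ := by ring
  have farE : ∀ k : ℕ, ∫ u in farSet M, ρ ((a + k : ℕ) : ℝ) u = 2 * Cn k := by
    intro k
    obtain ⟨C, hC⟩ := hg.2
    have iC : IntegrableOn (fun u => Real.cos ((a + (k : ℤ)) * u) * (ct u * g u)) (farSet M) := by
      refine Measure.integrableOn_of_bounded (M := 1 * (2 * M * C)) (measure_ne_top_of_subset (farSet_sub_II M) (by rw [volume_II]; exact ENNReal.ofReal_ne_top)) (Measurable.mul (by fun_prop) (measurable_ct.mul mg)).aestronglyMeasurable ?_
      refine (ae_restrict_iff' mF).2 (Eventually.of_forall fun t ht => ?_)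
      have h1 := ct_bound t (farSet_sub_II M ht)
      have h2 : 2 / |t| ≤ 2 * M := by
        have : 0 < |t| := lt_trans (by positivity) ht.1
        rw [div_le_iff₀ this]
        have := ht.1
        rw [div_lt_iff₀ hM0] at this
        linarith
      rw [Real.norm_eq_abs, abs_mul, abs_mul]
      exact mul_le_mul (Real.abs_cos_le_one _) (mul_le_mul (h1.trans h2) (hC t (farSet_sub_II M ht)) (abs_nonneg _) (by positivity)) (by positivity) zero_le_one
    have iC' : IntegrableOn (fun u => Real.cos ((a + (k : ℤ)) * (-u)) * (ct (-u) * g (-u))) (farSet M) := by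
      rw [← integrable_indicator_iff mF] at iC ⊢
      have := iC.comp_neg
      refine this.congr (Eventually.of_forall fun u => ?_)
      beta_reduce
      by_cases h : u ∈ farSet M
      · rw [indicator_of_mem ((sF u).2 h), indicator_of_mem h]
      · rw [indicator_of_notMem (fun h' => h ((sF u).1 h')), indicator_of_notMem h]
    have e := int_sym (farSet M) mF sF (fun u => Real.cos ((a + (k : ℤ)) * u) * (ct u * g u))
    have : 2 * Cn k = (∫ u in farSet M, Real.cos ((a + (k : ℤ)) * u) * (ct u * g u)) + ∫ u in farSet M, Real.cos ((a + (k : ℤ)) * (-u)) * (ct (-u) * g (-u)) := by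
      rw [e, two_mul]
    rw [this, ← integral_add iC iC']
    refine integral_congr_ae (Eventually.of_forall fun u => ?_)
    simp only [hρ, ct_neg, mul_neg, Real.cos_neg, zero_add, zero_sub]
    push_cast; ring
  refine ⟨(1 / (4 * Real.pi)) * ∫ u in near, ρ a u, ?_⟩
  have hterm : ∀ k ∈ Finset.range M, |TT (a + k) g 0 - (1 / (4 * Real.pi)) * ∫ u in near, ρ a u| ≤
      (1 / (4 * Real.pi)) * (2 * |Cn k| + 4 * A) := by
    intro k hk
    have e : TT (a + k) g 0 - (1 / (4 * Real.pi)) * ∫ u in near, ρ a u =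
        (1 / (4 * Real.pi)) * (2 * Cn k + ((∫ u in near, ρ ((a + k : ℕ) : ℝ) u) - ∫ u in near, ρ a u)) := by
      have : TT (a + k) g 0 = (1 / (4 * Real.pi)) * ∫ u in II, ρ ((a + k : ℕ) : ℝ) u := rfl
      rw [this, split, farE]; ring
    rw [e, abs_mul, abs_of_nonneg (by positivity : (0:ℝ) ≤ 1 / (4 * Real.pi))]
    gcongr
    refine (abs_add_le _ _).trans (add_le_add ?_ (nearb k (Finset.mem_range.1 hk)))
    rw [abs_mul, abs_two]
  calc (1 / (M : ℝ)) * ∑ k ∈ Finset.range M, |TT (a + k) g 0 - (1 / (4 * Real.pi)) * ∫ u in near, ρ a u|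
      ≤ (1 / (M : ℝ)) * ∑ k ∈ Finset.range M, (1 / (4 * Real.pi)) * (2 * |Cn k| + 4 * A) := by
        gcongr with k hk; exact hterm k hk
    _ = (1 / (M : ℝ)) * ((1 / (4 * Real.pi)) * (2 * (∑ k ∈ Finset.range M, |Cn k|) + M * (4 * A))) := by
        rw [← Finset.mul_sum, Finset.sum_add_distrib, ← Finset.mul_sum]; simp
    _ ≤ (1 / (M : ℝ)) * ((1 / (4 * Real.pi)) * (2 * (2 * Real.pi * M * √Q) + M * (4 * A))) := by gcongr
    _ = A / Real.pi + √Q := by field_simp; ring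
    _ ≤ _ := by gcongr; exact div_le_self hA0 (by linarith)

lemma Dst_zero' (n : ℕ) : Dst n 0 = 0 := by simp [Dst]

lemma Dst_le_n (n : ℕ) (t : ℝ) (ht : t ∈ II) : |Dst n t| ≤ n := by
  by_cases h0 : t = 0
  · subst h0; rw [Dst_zero']; simp
  have hp : 0 < |t| := abs_pos.2 h0
  have h1 : |Real.sin (n * t)| ≤ n * |t| := by
    refine (Real.abs_sin_le_abs).trans ?_
    rw [abs_mul, Nat.abs_cast]
  have h2 := ct_bound t ht
  rw [Dst, abs_div, abs_mul, abs_two]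
  calc |Real.sin (n * t)| * |ct t| / 2 ≤ n * |t| * (2 / |t|) / 2 := by gcongr
    _ = n := by field_simp

lemma ct_mul_sum (t : ℝ) (ht : t ∈ II) (X : ℝ) : |ct t / 2 * X| ≤ 1 / |t| * |X| := by
  have h2 := ct_bound t ht
  rw [abs_mul, abs_div, abs_two]
  have : |ct t| / 2 ≤ 1 / |t| := by
    calc |ct t| / 2 ≤ (2 / |t|) / 2 := by gcongr
      _ = _ := by ring
  gcongr

lemma Dst_step (n : ℕ) (t : ℝ) (ht : t ∈ II) : |Dst (n + 1) t - Dst n t| ≤ 1 := by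
  by_cases h0 : t = 0
  · subst h0; simp [Dst_zero']
  have := ct_step n t ht h0
  have e : Dst (n + 1) t - Dst n t = (Real.cos ((n + 1) * t) + Real.cos (n * t)) / 2 := by
    unfold Dst; push_cast; rw [this]; ring
  rw [e, abs_div, abs_two, div_le_one two_pos]
  refine (abs_add_le _ _).trans ?_
  linarith [Real.abs_cos_le_one ((n + 1) * t), Real.abs_cos_le_one (n * t)]

lemma half_sin (w : ℝ) (hw : |w| ≤ Real.pi) : |w| / Real.pi ≤ |Real.sin (w / 2)| := by
  have h1 : |w| / 2 ≤ Real.pi / 2 := by linarith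
  have h2 := Real.mul_le_sin (x := |w| / 2) (by positivity) h1
  have h3 : Real.sin (|w| / 2) ≤ |Real.sin (w / 2)| := by
    rcases abs_cases w with ⟨e, _⟩ | ⟨e, _⟩
    · rw [e]; exact le_abs_self _
    · rw [e, neg_div, Real.sin_neg]; exact neg_le_abs _
  calc |w| / Real.pi = 2 / Real.pi * (|w| / 2) := by ring
    _ ≤ _ := h2.trans h3

lemma sin_tele (N : ℕ) (w : ℝ) :
    2 * Real.sin (w / 2) * ∑ n ∈ Finset.range N, Real.sin (((n + 1 : ℕ) : ℝ) * w) =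
      Real.cos (w / 2) - Real.cos ((N + 1 / 2) * w) := by
  induction N with
  | zero => simp; ring_nf
  | succ N ih =>
    rw [Finset.sum_range_succ, mul_add, ih]
    push_cast
    have e1 : ((N : ℝ) + 1 / 2) * w = (N + 1) * w - w / 2 := by ring
    have e2 : ((N : ℝ) + 1 + 1 / 2) * w = (N + 1) * w + w / 2 := by ring
    rw [e1, e2, Real.cos_sub, Real.cos_add]; ring

lemma cos_tele (N : ℕ) (w : ℝ) :
    2 * Real.sin (w / 2) * ∑ n ∈ Finset.range N, Real.cos (((n + 1 : ℕ) : ℝ) * w) =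
      Real.sin ((N + 1 / 2) * w) - Real.sin (w / 2) := by
  induction N with
  | zero => simp; ring_nf
  | succ N ih =>
    rw [Finset.sum_range_succ, mul_add, ih]
    push_cast
    have e1 : ((N : ℝ) + 1 / 2) * w = (N + 1) * w - w / 2 := by ring
    have e2 : ((N : ℝ) + 1 + 1 / 2) * w = (N + 1) * w + w / 2 := by ring
    rw [e1, e2, Real.sin_sub, Real.sin_add]; ring

lemma sin_sum_bd (N : ℕ) (w : ℝ) : |Real.sin (w / 2)| * |∑ n ∈ Finset.range N, Real.sin (((n + 1 : ℕ) : ℝ) * w)| ≤ 1 := by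
  have := congrArg abs (sin_tele N w)
  rw [abs_mul, abs_mul, abs_two] at this
  have h2 : |Real.cos (w / 2) - Real.cos ((N + 1 / 2) * w)| ≤ 2 := by
    refine (abs_sub _ _).trans ?_
    linarith [Real.abs_cos_le_one (w / 2), Real.abs_cos_le_one ((N + 1 / 2) * w)]
  linarith

lemma cos_sum_bd (N : ℕ) (w : ℝ) : |Real.sin (w / 2)| * |∑ n ∈ Finset.range N, Real.cos (((n + 1 : ℕ) : ℝ) * w)| ≤ 1 := by
  have := congrArg abs (cos_tele N w)
  rw [abs_mul, abs_mul, abs_two] at this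
  have h2 : |Real.sin ((N + 1 / 2) * w) - Real.sin (w / 2)| ≤ 2 := by
    refine (abs_sub _ _).trans ?_
    linarith [Real.abs_sin_le_one (w / 2), Real.abs_sin_le_one ((N + 1 / 2) * w)]
  linarith

lemma Dst_sum (N : ℕ) (t : ℝ) (ht : t ∈ II) (h0 : t ≠ 0) :
    |∑ n ∈ Finset.range N, Dst (n + 1) t| ≤ Real.pi / t ^ 2 := by
  have hp : 0 < |t| := abs_pos.2 h0
  have e : ∑ n ∈ Finset.range N, Dst (n + 1) t = ct t / 2 * ∑ n ∈ Finset.range N, Real.sin (((n + 1 : ℕ) : ℝ) * t) := by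
    rw [Finset.mul_sum]; refine Finset.sum_congr rfl fun n _ => ?_
    unfold Dst; ring
  rw [e]
  refine (ct_mul_sum t ht _).trans ?_
  have h1 := sin_sum_bd N t
  have h2 := half_sin t (abs_lt.2 ⟨ht.1, ht.2⟩).le
  set X := |∑ n ∈ Finset.range N, Real.sin (((n + 1 : ℕ) : ℝ) * t)|
  have h3 : |t| / Real.pi * X ≤ 1 := (mul_le_mul_of_nonneg_right h2 (abs_nonneg _)).trans h1
  have h4 : X ≤ Real.pi / |t| := by
    rw [le_div_iff₀ hp]
    rw [div_mul_eq_mul_div, div_le_one Real.pi_pos] at h3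
    linarith
  calc 1 / |t| * X ≤ 1 / |t| * (Real.pi / |t|) := by gcongr
    _ = _ := by rw [← sq_abs t]; field_simp

lemma abel (a b : ℕ → ℝ) (N : ℕ) : ∑ i ∈ Finset.range N, a i * b i =
    (∑ i ∈ Finset.range N, a i) * b N - ∑ i ∈ Finset.range N, (∑ j ∈ Finset.range (i + 1), a j) * (b (i + 1) - b i) := by
  induction N with
  | zero => simp
  | succ N ih => rw [Finset.sum_range_succ, ih, Finset.sum_range_succ (fun i => (∑ j ∈ Finset.range (i + 1), a j) * (b (i + 1) - b i)),
      Finset.sum_range_succ a]; ring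

/-- unnormalised averaged kernel -/
def KN (N : ℕ) (t s : ℝ) : ℝ := ∑ n ∈ Finset.range N, Dst (n + 1) t * Dst (n + 1) s

lemma KN_comm (N : ℕ) (t s : ℝ) : KN N t s = KN N s t := by
  unfold KN; exact Finset.sum_congr rfl fun n _ => mul_comm _ _

lemma KN_abs (N : ℕ) (t s : ℝ) : KN N |t| |s| = KN N t s := by
  have : ∀ n (t : ℝ), Dst n |t| = Dst n t := fun n t => by
    rcases abs_cases t with ⟨e, _⟩ | ⟨e, _⟩ <;> rw [e]
    exact Dst_neg n t
  unfold KN; simp only [this]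

lemma KN_1 (N : ℕ) (t s : ℝ) (ht : t ∈ II) (hs : s ∈ II) : |KN N t s| ≤ N ^ 3 := by
  unfold KN
  refine (Finset.abs_sum_le_sum_abs _ _).trans ?_
  have : ∀ n ∈ Finset.range N, |Dst (n + 1) t * Dst (n + 1) s| ≤ (N : ℝ) ^ 2 := by
    intro n hn
    have hn' : ((n + 1 : ℕ) : ℝ) ≤ N := by exact_mod_cast Finset.mem_range.1 hn
    rw [abs_mul, sq]
    exact mul_le_mul ((Dst_le_n _ t ht).trans hn') ((Dst_le_n _ s hs).trans hn') (abs_nonneg _) (by positivity)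
  refine (Finset.sum_le_sum this).trans ?_
  simp; ring_nf; rfl

lemma KN_2 (N : ℕ) (hN : 1 ≤ N) (t s : ℝ) (ht : t ∈ II) (hs : s ∈ II) (h0 : t ≠ 0) :
    |KN N t s| ≤ 3 * Real.pi * N / t ^ 2 := by
  have hN1 : (1 : ℝ) ≤ N := by exact_mod_cast hN
  unfold KN
  rw [abel]
  refine (abs_sub _ _).trans ?_
  have h1 : |(∑ i ∈ Finset.range N, Dst (i + 1) t) * Dst (N + 1) s| ≤ Real.pi / t ^ 2 * (N + 1) := by
    rw [abs_mul]
    refine mul_le_mul (Dst_sum N t ht h0) ?_ (abs_nonneg _) (by positivity)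
    have := Dst_le_n (N + 1) s hs
    push_cast at this; exact this
  have h2 : |∑ i ∈ Finset.range N, (∑ j ∈ Finset.range (i + 1), Dst (j + 1) t) * (Dst (i + 1 + 1) s - Dst (i + 1) s)| ≤
      N * (Real.pi / t ^ 2) := by
    refine (Finset.abs_sum_le_sum_abs _ _).trans ?_
    have : ∀ i ∈ Finset.range N, |(∑ j ∈ Finset.range (i + 1), Dst (j + 1) t) * (Dst (i + 1 + 1) s - Dst (i + 1) s)| ≤ Real.pi / t ^ 2 * 1 := by
      intro i _
      rw [abs_mul]
      exact mul_le_mul (Dst_sum _ t ht h0) (Dst_step _ s hs) (abs_nonneg _) (by positivity)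
    refine (Finset.sum_le_sum this).trans ?_
    simp
  have h3 : 3 * Real.pi * N / t ^ 2 = Real.pi / t ^ 2 * (3 * N) := by ring
  have h4 : 0 ≤ Real.pi / t ^ 2 := by positivity
  rw [h3]
  nlinarith

lemma KN_3 (N : ℕ) (t s : ℝ) (ht : t ∈ Ioo 0 Real.pi) (hs : s ∈ Ioo 0 Real.pi) (hne : t ≠ s) :
    |KN N t s| ≤ Real.pi / (t * s * |t - s|) := by
  have hpi := Real.pi_pos
  have ht' : t ∈ II := ⟨by linarith [ht.1], ht.2⟩
  have hs' : s ∈ II := ⟨by linarith [hs.1], hs.2⟩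
  have e : KN N t s = ct t / 2 * (ct s / 2 * ((∑ n ∈ Finset.range N, Real.cos (((n + 1 : ℕ) : ℝ) * (t - s)) -
      ∑ n ∈ Finset.range N, Real.cos (((n + 1 : ℕ) : ℝ) * (t + s))) / 2)) := by
    rw [← Finset.sum_sub_distrib, Finset.sum_div, Finset.mul_sum, Finset.mul_sum]
    unfold KN
    refine Finset.sum_congr rfl fun n _ => ?_
    rw [mul_sub, mul_add, Real.cos_sub, Real.cos_add]
    unfold Dst; ring
  rw [e]
  refine (ct_mul_sum t ht' _).trans ?_
  have hd : 0 < |t - s| := abs_pos.2 (sub_ne_zero.2 hne)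
  have hst : |Real.sin ((t - s) / 2)| ≤ |Real.sin ((t + s) / 2)| := by
    have e1 : (t - s) / 2 = t / 2 - s / 2 := by ring
    have e2 : (t + s) / 2 = t / 2 + s / 2 := by ring
    rw [e1, e2, Real.sin_sub, Real.sin_add]
    have p1 : 0 ≤ Real.sin (t / 2) := Real.sin_nonneg_of_nonneg_of_le_pi (by linarith [ht.1]) (by linarith [ht.2])
    have p2 : 0 ≤ Real.sin (s / 2) := Real.sin_nonneg_of_nonneg_of_le_pi (by linarith [hs.1]) (by linarith [hs.2])
    have p3 : 0 ≤ Real.cos (t / 2) := Real.cos_nonneg_of_neg_pi_div_two_le_of_le (by linarith [ht.1]) (by linarith [ht.2])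
    have p4 : 0 ≤ Real.cos (s / 2) := Real.cos_nonneg_of_neg_pi_div_two_le_of_le (by linarith [hs.1]) (by linarith [hs.2])
    have q1 := mul_nonneg p1 p4
    have q2 := mul_nonneg p3 p2
    rw [abs_of_nonneg (add_nonneg q1 q2)]
    exact abs_le.2 ⟨by linarith, by linarith⟩
  have hh := half_sin (t - s) (abs_le.2 ⟨by linarith [ht.1, hs.2], by linarith [ht.2, hs.1]⟩)
  have hB : ∀ w, |t - s| / Real.pi ≤ |Real.sin (w / 2)| →
      |∑ n ∈ Finset.range N, Real.cos (((n + 1 : ℕ) : ℝ) * w)| ≤ Real.pi / |t - s| := by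
    intro w hw
    have h1 := cos_sum_bd N w
    set X := |∑ n ∈ Finset.range N, Real.cos (((n + 1 : ℕ) : ℝ) * w)|
    have h3 : |t - s| / Real.pi * X ≤ 1 := (mul_le_mul_of_nonneg_right hw (abs_nonneg _)).trans h1
    rw [le_div_iff₀ hd]
    rw [div_mul_eq_mul_div, div_le_one Real.pi_pos] at h3
    linarith
  have b1 := hB _ hh
  have b2 := hB (t + s) (hh.trans hst)
  have b3 : |(∑ n ∈ Finset.range N, Real.cos (((n + 1 : ℕ) : ℝ) * (t - s)) -
      ∑ n ∈ Finset.range N, Real.cos (((n + 1 : ℕ) : ℝ) * (t + s))) / 2| ≤ Real.pi / |t - s| := by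
    rw [abs_div, abs_two, div_le_iff₀ two_pos]
    refine (abs_sub _ _).trans ?_
    linarith
  rw [abs_of_pos ht.1]
  calc 1 / t * |ct s / 2 * _| ≤ 1 / t * (1 / |s| * (Real.pi / |t - s|)) := by
        have := ht.1
        gcongr
        refine (ct_mul_sum s hs' _).trans ?_
        gcongr
    _ = _ := by rw [abs_of_pos hs.1]; have := ht.1.ne'; have := hs.1.ne'; field_simp

lemma psi_of_le {w : ℝ} (h : |w| ≤ 1) : psi w = 1 := by simp [psi, h]
lemma psi_of_gt {w : ℝ} (h : 1 < |w|) : psi w = 1 / (|w| * √|w|) := by simp [psi, not_le.2 h]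
lemma psi_le_one (w : ℝ) : psi w ≤ 1 := by
  by_cases h : |w| ≤ 1
  · rw [psi_of_le h]
  · push Not at h
    rw [psi_of_gt h, div_le_one (by positivity)]
    have : 1 ≤ √|w| := Real.one_le_sqrt.2 h.le
    nlinarith
lemma psi_anti {w v : ℝ} (h : |v| ≤ |w|) : psi w ≤ psi v := by
  by_cases hv : |v| ≤ 1
  · rw [psi_of_le hv]; exact psi_le_one w
  · push Not at hv
    rw [psi_of_gt hv, psi_of_gt (hv.trans_le h)]
    gcongr
lemma psi_sq {w : ℝ} (h : 1 < |w|) : 1 / w ^ 2 ≤ psi w := by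
  rw [psi_of_gt h, ← sq_abs, sq]
  have h1 : √|w| ≤ |w| := by
    rw [Real.sqrt_le_left (by positivity)]; nlinarith
  gcongr

lemma ker_abs (T S k : ℝ) (hT : 0 ≤ T) (hS : 0 ≤ S) (h1 : k ≤ 1) (h2 : 0 < T → k ≤ 3 * Real.pi / T ^ 2)
    (h3 : 0 < S → k ≤ 3 * Real.pi / S ^ 2)
    (h4 : 0 < T → 0 < S → T ≠ S → k ≤ Real.pi / (T * S * |T - S|)) :
    k ≤ 3 * Real.pi * (psi T * psi S + psi T * psi (T - S)) := by
  have hpi := Real.pi_gt_three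
  have p1 := psi_nonneg T
  have p2 := psi_nonneg S
  have p3 := psi_nonneg (T - S)
  by_cases cT : |T| ≤ 1
  · rw [psi_of_le cT]
    by_cases cS : |S| ≤ 1
    · rw [psi_of_le cS]; nlinarith
    · push Not at cS
      have h5 := psi_sq cS
      rw [abs_of_nonneg hS] at cS
      have := h3 (by linarith)
      have e : 3 * Real.pi / S ^ 2 = 3 * Real.pi * (1 / S ^ 2) := by ring
      rw [e] at this
      nlinarith
  · push Not at cT
    have h5 := psi_sq cT
    have cT' := cT
    rw [abs_of_nonneg hT] at cT'
    have e : 3 * Real.pi / T ^ 2 = 3 * Real.pi * (1 / T ^ 2) := by ring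
    have h6 := h2 (by linarith)
    rw [e] at h6
    by_cases cS : |S| ≤ 1
    · rw [psi_of_le cS]; nlinarith [mul_nonneg p1 p3]
    · push Not at cS
      by_cases cD : |T - S| ≤ 1
      · rw [psi_of_le cD]; nlinarith [mul_nonneg p1 p2]
      · push Not at cD
        have cS' := cS
        rw [abs_of_nonneg hS] at cS'
        have h7 := h4 (by linarith) (by linarith) (fun h => by rw [h] at cD; norm_num at cD)
        rw [psi_of_gt cT, psi_of_gt cS, psi_of_gt cD, abs_of_nonneg hT, abs_of_nonneg hS]
        set D := |T - S|
        have hD : T ≤ S + D := by have := le_abs_self (T - S); linarith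
        set c := √T
        set a := √S
        set b := √D
        have ec : T = c * c := (Real.mul_self_sqrt hT).symm
        have ea : S = a * a := (Real.mul_self_sqrt hS).symm
        have eb : D = b * b := (Real.mul_self_sqrt (by positivity)).symm
        have c0 : 0 < c := Real.sqrt_pos.2 (by linarith)
        have a0 : 0 < a := Real.sqrt_pos.2 (by linarith)
        have b0 : 0 < b := Real.sqrt_pos.2 (by linarith)
        rw [ec, ea, eb] at hD h7 ⊢
        have hc : c ≤ a + b := by
          by_contra hh; push Not at hh
          nlinarith [mul_pos a0 b0]
        have key : c * a * b ≤ a ^ 3 + b ^ 3 := by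
          have q1 : c * (a * b) ≤ (a + b) * (a * b) := by gcongr
          nlinarith [mul_nonneg (add_pos a0 b0).le (sq_nonneg (a - b))]
        refine h7.trans ?_
        have e2 : 3 * Real.pi * (1 / (c * c * c) * (1 / (a * a * a)) + 1 / (c * c * c) * (1 / (b * b * b))) =
          3 * Real.pi * (a ^ 3 + b ^ 3) / (c ^ 3 * a ^ 3 * b ^ 3) := by field_simp; ring
        rw [e2]
        have e3 : Real.pi / (c * c * (a * a) * (b * b)) = Real.pi * (c * a * b) / (c ^ 3 * a ^ 3 * b ^ 3) := by
          field_simp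
        rw [e3]
        gcongr
        nlinarith

lemma KN_bound (N : ℕ) (hN : 1 ≤ N) (t s : ℝ) (ht : t ∈ II) (hs : s ∈ II) :
    |KN N t s| ≤ 3 * Real.pi * N ^ 3 * (psi (N * t) * psi (N * s) + psi (N * t) * psi (N * (s - t))
      + psi (N * t) * psi (N * (t + s))) := by
  have hN0 : (0 : ℝ) < N := by exact_mod_cast hN
  have hpi := Real.pi_pos
  have ht' : |t| < Real.pi := abs_lt.2 ⟨ht.1, ht.2⟩
  have hs' : |s| < Real.pi := abs_lt.2 ⟨hs.1, hs.2⟩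
  have htI : |t| ∈ II := ⟨by linarith [abs_nonneg t], ht'⟩
  have hsI : |s| ∈ II := ⟨by linarith [abs_nonneg s], hs'⟩
  have key := ker_abs (N * |t|) (N * |s|) (|KN N t s| / N ^ 3) (by positivity) (by positivity)
    (by rw [div_le_one (by positivity)]; exact KN_1 N t s ht hs)
    (fun h => by
      have h0 : t ≠ 0 := by rintro rfl; simp at h
      have := KN_2 N hN t s ht hs h0
      rw [div_le_iff₀ (by positivity)]
      refine this.trans (le_of_eq ?_)
      rw [mul_pow, sq_abs]; field_simp)
    (fun h => by
      have h0 : s ≠ 0 := by rintro rfl; simp at h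
      have := KN_2 N hN s t hs ht h0
      rw [KN_comm] at this
      rw [div_le_iff₀ (by positivity)]
      refine this.trans (le_of_eq ?_)
      rw [mul_pow, sq_abs]; field_simp)
    (fun h1 h2 h3 => by
      have q1 : 0 < |t| := by by_contra hh; have : |t| = 0 := le_antisymm (not_lt.1 hh) (abs_nonneg _); simp [this] at h1
      have q2 : 0 < |s| := by by_contra hh; have : |s| = 0 := le_antisymm (not_lt.1 hh) (abs_nonneg _); simp [this] at h2
      have q3 : |t| ≠ |s| := fun h => h3 (by rw [h])
      have := KN_3 N |t| |s| ⟨q1, ht'⟩ ⟨q2, hs'⟩ q3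
      rw [KN_abs] at this
      rw [div_le_iff₀ (by positivity)]
      refine this.trans (le_of_eq ?_)
      rw [← mul_sub, abs_mul, abs_of_pos hN0]
      have : 0 < |(|t| - |s|)| := abs_pos.2 (sub_ne_zero.2 q3)
      field_simp)
  rw [div_le_iff₀ (by positivity)] at key
  refine key.trans ?_
  have e1 : ∀ t : ℝ, psi (N * |t|) = psi (N * t) := fun t => by
    rcases abs_cases t with ⟨e, _⟩ | ⟨e, _⟩ <;> rw [e]
    rw [mul_neg, psi_neg]
  have e2 : psi (N * |t| - N * |s|) ≤ psi (N * (s - t)) + psi (N * (t + s)) := by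
    rw [← mul_sub, ← e1 (|t| - |s|)]
    have : |(|t| - |s|)| = |s - t| ∨ |(|t| - |s|)| = |t + s| := by
      rcases abs_cases t with ⟨e, _⟩ | ⟨e, _⟩ <;> rcases abs_cases s with ⟨e', _⟩ | ⟨e', _⟩ <;> rw [e, e']
      · left; rw [abs_sub_comm]
      · right; congr 1; ring
      · right; rw [← abs_neg]; congr 1; ring
      · left; congr 1; ring
    rcases this with h | h <;> rw [h, e1]
    · linarith [psi_nonneg (N * (t + s))]
    · linarith [psi_nonneg (N * (s - t))]
  rw [e1, e1]
  have := mul_le_mul_of_nonneg_left e2 (psi_nonneg (N * t))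
  have h9 : (0 : ℝ) ≤ 3 * Real.pi * N ^ 3 := by positivity
  nlinarith [mul_le_mul_of_nonneg_left this h9]

lemma pker_anti (N : ℕ) {w v : ℝ} (h : |v| ≤ |w|) : pker N w ≤ pker N v := by
  unfold pker
  refine ENNReal.ofReal_le_ofReal ?_
  refine mul_le_mul_of_nonneg_left (psi_anti ?_) (by positivity)
  rw [abs_mul, abs_mul]; gcongr

lemma KN_pker (N : ℕ) (hN : 1 ≤ N) (t s : ℝ) (ht : t ∈ II) (hs : s ∈ II) :
    ENNReal.ofReal |(1 / N) * KN N t s| ≤ ENNReal.ofReal (3 * Real.pi) * (pker N t * pker N s + pker N t * pker N (s - t)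
      + pker N t * pker N (t + s)) := by
  have hN0 : (0 : ℝ) < N := by exact_mod_cast hN
  have hh : ∀ w, 0 ≤ N * psi (N * w) := fun w => mul_nonneg hN0.le (psi_nonneg _)
  unfold pker
  rw [← ENNReal.ofReal_mul (hh _), ← ENNReal.ofReal_mul (hh _), ← ENNReal.ofReal_mul (hh _),
    ← ENNReal.ofReal_add (mul_nonneg (hh _) (hh _)) (mul_nonneg (hh _) (hh _)),
    ← ENNReal.ofReal_add (add_nonneg (mul_nonneg (hh _) (hh _)) (mul_nonneg (hh _) (hh _))) (mul_nonneg (hh _) (hh _)),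
    ← ENNReal.ofReal_mul (by positivity)]
  refine ENNReal.ofReal_le_ofReal ?_
  rw [abs_mul, abs_of_pos (by positivity : (0:ℝ) < 1 / N), one_div, inv_mul_le_iff₀ hN0]
  refine (KN_bound N hN t s ht hs).trans (le_of_eq ?_)
  ring

/-- windows -/
lemma window (N : ℕ) (h : ℝ → ℝ≥0∞) (hm : Measurable h) (hp : Function.Periodic h (2 * Real.pi)) (t : ℝ) (ht : t ∈ II) :
    ∫⁻ s in II, pker N (s - t) * h s ≤ 3 * AA N h t := by
  have hpi := Real.pi_pos
  set R : ℝ → ℝ≥0∞ := fun w => II.indicator (pker N) w with hR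
  have mR : Measurable R := (measurable_pker N).indicator measurableSet_II
  have hk : ∀ k : ℤ, ∫⁻ s, R (s - t - k * (2 * Real.pi)) * h s = AA N h t := by
    intro k
    rw [← lintegral_add_right_eq_self _ (t + k * (2 * Real.pi))]
    unfold AA
    rw [← lintegral_indicator measurableSet_Ioo]
    refine lintegral_congr fun s => ?_
    have e1 : s + (t + k * (2 * Real.pi)) - t - k * (2 * Real.pi) = s := by ring
    have e2 : h (s + (t + k * (2 * Real.pi))) = h (t + s) := by
      have := hp.int_mul k (t + s)
      rw [← this]; congr 1; ring
    rw [e1, e2]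
    by_cases hs : s ∈ II
    · rw [hR]; simp only [indicator_of_mem hs]; rw [indicator_of_mem (show s ∈ Ioo _ _ from hs)]
    · rw [hR]; simp only [indicator_of_notMem hs]; rw [indicator_of_notMem (show s ∉ Ioo _ _ from hs)]; simp
  calc ∫⁻ s in II, pker N (s - t) * h s ≤ ∫⁻ s in II, (R (s - t - (0 : ℤ) * (2 * Real.pi)) * h s
        + R (s - t - (1 : ℤ) * (2 * Real.pi)) * h s + R (s - t - (-1 : ℤ) * (2 * Real.pi)) * h s) := by
        refine lintegral_mono_ae ?_
        have n1 : ∀ᵐ s : ℝ, s ≠ t + Real.pi := by simp [ae_iff]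
        have n2 : ∀ᵐ s : ℝ, s ≠ t - Real.pi := by simp [ae_iff]
        filter_upwards [ae_restrict_mem measurableSet_II, ae_restrict_of_ae n1, ae_restrict_of_ae n2] with s hs m1 m2
        rw [← add_mul, ← add_mul]
        refine mul_le_mul_left ?_ _
        have s1 := hs.1
        have s2 := hs.2
        have t1 := ht.1
        have t2 := ht.2
        rcases lt_trichotomy (s - t) (-Real.pi) with h1 | h1 | h1
        · refine le_trans ?_ le_add_self
          have : s - t - ((-1 : ℤ) : ℝ) * (2 * Real.pi) ∈ II := ⟨by push_cast; linarith, by push_cast; linarith⟩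
          rw [hR]; simp only [indicator_of_mem this]
          refine pker_anti N ?_
          push_cast
          rw [abs_of_neg (by linarith : s - t < 0), abs_le]; constructor <;> linarith
        · exact absurd (by linarith) m2
        · rcases lt_trichotomy (s - t) (Real.pi) with h2 | h2 | h2
          · refine le_trans ?_ le_self_add
            refine le_trans ?_ le_self_add
            have : s - t - ((0 : ℤ) : ℝ) * (2 * Real.pi) ∈ II := ⟨by push_cast; linarith, by push_cast; linarith⟩
            rw [hR]; simp only [indicator_of_mem this]
            simp
          · exact absurd (by linarith) m1
          · refine le_trans ?_ le_self_add
            refine le_trans ?_ le_add_self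
            have : s - t - ((1 : ℤ) : ℝ) * (2 * Real.pi) ∈ II := ⟨by push_cast; linarith, by push_cast; linarith⟩
            rw [hR]; simp only [indicator_of_mem this]
            refine pker_anti N ?_
            push_cast
            rw [abs_of_pos (by linarith : 0 < s - t), abs_le]; constructor <;> linarith
    _ ≤ ∫⁻ s, (R (s - t - (0 : ℤ) * (2 * Real.pi)) * h s
        + R (s - t - (1 : ℤ) * (2 * Real.pi)) * h s + R (s - t - (-1 : ℤ) * (2 * Real.pi)) * h s) :=
        setLIntegral_le_lintegral _ _
    _ = AA N h t + AA N h t + AA N h t := by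
        rw [lintegral_add_left, lintegral_add_left, hk, hk, hk]
        · exact (mR.comp (by fun_prop)).mul hm
        · exact ((mR.comp (by fun_prop)).mul hm).add ((mR.comp (by fun_prop)).mul hm)
    _ = _ := by ring

lemma AA2_eq (v : ℝ × ℝ) (N : ℕ) (h : ℝ × ℝ → ℝ≥0∞) (p : ℝ × ℝ) :
    AA2 v N h p = ∫⁻ t in II, pker N t * h (p + t • v) := by
  unfold AA2 AA lin II; simp only [zero_add]

lemma AA2_le_of (v : ℝ × ℝ) (N : ℕ) (hN : 1 ≤ N) (g h : ℝ × ℝ → ℝ≥0∞) (hgh : ∀ p, g p ≤ h p) (p : ℝ × ℝ) :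
    ∫⁻ t in II, pker N t * g (p + t • v) ≤ AS2 v h p := by
  refine le_trans ?_ (AA2_le_AS2 v N hN h p)
  rw [AA2_eq]
  exact lintegral_mono fun t => mul_le_mul_right (hgh _) _

lemma mean_lint (N : ℕ) (hN : 1 ≤ N) (F : ℝ × ℝ → ℝ≥0∞) (hm : Measurable F) (hp : Bip F) (p : ℝ × ℝ) :
    ∫⁻ q in II ×ˢ II, (pker N q.1 * pker N q.2 + pker N q.1 * pker N (q.2 - q.1)
      + pker N q.1 * pker N (q.1 + q.2)) * F (p + q) ≤
      3 * (AS2 ex (AS2 ey F) p + AS2 (((1:ℤ):ℝ), ((1:ℤ):ℝ)) (AS2 ey F) p + AS2 (((1:ℤ):ℝ), ((-1:ℤ):ℝ)) (AS2 ey F) p) := by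
  have mp := measurable_pker N
  have mF : Measurable fun q : ℝ × ℝ => F (p + q) := hm.comp (measurable_const.add measurable_id)
  have m1 : Measurable fun q : ℝ × ℝ => pker N q.1 := mp.comp measurable_fst
  have m2 : Measurable fun q : ℝ × ℝ => pker N q.2 := mp.comp measurable_snd
  have m3 : Measurable fun q : ℝ × ℝ => pker N (q.2 - q.1) := mp.comp (measurable_snd.sub measurable_fst)
  have m4 : Measurable fun q : ℝ × ℝ => pker N (q.1 + q.2) := mp.comp (measurable_fst.add measurable_snd)
  have M1 : Measurable fun q : ℝ × ℝ => pker N q.1 * pker N q.2 * F (p + q) := (m1.mul m2).mul mF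
  have M2 : Measurable fun q : ℝ × ℝ => pker N q.1 * pker N (q.2 - q.1) * F (p + q) := (m1.mul m3).mul mF
  have M3 : Measurable fun q : ℝ × ℝ => pker N q.1 * pker N (q.1 + q.2) * F (p + q) := (m1.mul m4).mul mF
  have M4 : Measurable fun q : ℝ × ℝ => pker N q.1 * pker N q.2 * F (p + q) + pker N q.1 * pker N (q.2 - q.1) * F (p + q) := M1.add M2
  have hAS : ∀ q, AA2 ey N F q ≤ AS2 ey F q := fun q => AA2_le_AS2 ey N hN F q
  have hsh : ∀ t s : ℝ, F (p + (t, s)) = lin ey F (p + t • ex) s := fun t s => by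
    unfold lin; congr 1; ext <;> simp [ex, ey]
  have per : ∀ t : ℝ, Function.Periodic (lin ey F (p + t • ex)) (2 * Real.pi) := fun t => lin_periodic 0 1 hp _
  have ml : ∀ t : ℝ, Measurable (lin ey F (p + t • ex)) := fun t => measurable_lin _ hm _
  have fin : ∀ t, pker N t ≠ ∞ := fun t => ENNReal.ofReal_ne_top
  rw [vol_II2]
  have T1 : ∫⁻ q, (pker N q.1 * pker N q.2) * F (p + q) ∂((volume.restrict II).prod (volume.restrict II)) ≤
      AS2 ex (AS2 ey F) p := by
    rw [lintegral_prod _ M1.aemeasurable]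
    refine le_trans (le_of_eq ?_) (AA2_le_of ex N hN (AA2 ey N F) _ hAS p)
    refine lintegral_congr fun t => ?_
    simp only [mul_assoc]
    rw [lintegral_const_mul' _ _ (fin t)]
    congr 1
    rw [AA2_eq]
    refine lintegral_congr fun s => ?_
    rw [hsh]; rfl
  have T2 : ∫⁻ q, (pker N q.1 * pker N (q.2 - q.1)) * F (p + q) ∂((volume.restrict II).prod (volume.restrict II)) ≤
      3 * AS2 (((1:ℤ):ℝ), ((1:ℤ):ℝ)) (AS2 ey F) p := by
    rw [lintegral_prod _ M2.aemeasurable]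
    refine le_trans ?_ (mul_le_mul_right (AA2_le_of (((1:ℤ):ℝ), ((1:ℤ):ℝ)) N hN (AA2 ey N F) _ hAS p) 3)
    rw [← lintegral_const_mul' _ _ (by simp)]
    refine setLIntegral_mono' measurableSet_II fun t ht => ?_
    simp only [mul_assoc]
    rw [lintegral_const_mul' _ _ (fin t), mul_left_comm]
    refine mul_le_mul_right ?_ _
    have := window N _ (ml t) (per t) t ht
    rw [AA_lin] at this
    have e : p + t • ex + t • ey = p + t • (((1:ℤ):ℝ), ((1:ℤ):ℝ)) := by ext <;> simp [ex, ey]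
    rw [e] at this
    refine le_trans (le_of_eq ?_) this
    refine lintegral_congr fun s => ?_
    rw [hsh]
  have T3 : ∫⁻ q, (pker N q.1 * pker N (q.1 + q.2)) * F (p + q) ∂((volume.restrict II).prod (volume.restrict II)) ≤
      3 * AS2 (((1:ℤ):ℝ), ((-1:ℤ):ℝ)) (AS2 ey F) p := by
    rw [lintegral_prod _ M3.aemeasurable]
    refine le_trans ?_ (mul_le_mul_right (AA2_le_of (((1:ℤ):ℝ), ((-1:ℤ):ℝ)) N hN (AA2 ey N F) _ hAS p) 3)
    rw [← lintegral_const_mul' _ _ (by simp)]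
    refine setLIntegral_mono' measurableSet_II fun t ht => ?_
    simp only [mul_assoc]
    rw [lintegral_const_mul' _ _ (fin t), mul_left_comm]
    refine mul_le_mul_right ?_ _
    have := window N _ (ml t) (per t) (-t) ⟨by linarith [ht.2], by linarith [ht.1]⟩
    rw [AA_lin] at this
    have e : p + t • ex + (-t) • ey = p + t • (((1:ℤ):ℝ), ((-1:ℤ):ℝ)) := by ext <;> simp [ex, ey]
    rw [e] at this
    refine le_trans (le_of_eq ?_) this
    refine lintegral_congr fun s => ?_
    rw [hsh]; congr 2; ring
  simp only [add_mul]
  rw [lintegral_add_left M4, lintegral_add_left M1]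
  calc _ ≤ AS2 ex (AS2 ey F) p + 3 * AS2 (((1:ℤ):ℝ), ((1:ℤ):ℝ)) (AS2 ey F) p + 3 * AS2 (((1:ℤ):ℝ), ((-1:ℤ):ℝ)) (AS2 ey F) p :=
        add_le_add (add_le_add T1 T2) T3
    _ ≤ 3 * AS2 ex (AS2 ey F) p + 3 * AS2 (((1:ℤ):ℝ), ((1:ℤ):ℝ)) (AS2 ey F) p + 3 * AS2 (((1:ℤ):ℝ), ((-1:ℤ):ℝ)) (AS2 ey F) p := by
        gcongr
        calc AS2 ex (AS2 ey F) p = 1 * AS2 ex (AS2 ey F) p := (one_mul _).symm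
          _ ≤ _ := by gcongr; norm_num
    _ = _ := by ring

/-- maximal function controlling the means -/
def MM (F : ℝ × ℝ → ℝ≥0∞) (p : ℝ × ℝ) : ℝ≥0∞ :=
  AS2 ex (AS2 ey F) p + AS2 (((1:ℤ):ℝ), ((1:ℤ):ℝ)) (AS2 ey F) p + AS2 (((1:ℤ):ℝ), ((-1:ℤ):ℝ)) (AS2 ey F) p

lemma mean_bound (N : ℕ) (hN : 1 ≤ N) (f : ℝ × ℝ → ℝ) (hm : Measurable f) (hp : Bip f) (p : ℝ × ℝ)
    (hi : IntegrableOn (fun q => f (p + q)) (II ×ˢ II)) :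
    ENNReal.ofReal |(1 / (N:ℝ)) * ∑ k ∈ Finset.range N, SS (k + 1) f p| ≤ 3 * MM (fun q => ENNReal.ofReal |f q|) p := by
  have e : (1 / (N:ℝ)) * ∑ k ∈ Finset.range N, SS (k + 1) f p =
      (1 / Real.pi ^ 2) * ∫ q in II ×ˢ II, ((1 / (N:ℝ)) * KN N q.1 q.2) * f (p + q) := by
    unfold SS KK KN
    rw [← Finset.mul_sum, ← integral_finsetSum _ (fun k _ => KK_integrable (BM_Dst (k+1)) f p hi), mul_left_comm,
      ← integral_const_mul]
    congr 1
    refine integral_congr_ae (.of_forall fun q => ?_)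
    simp only
    rw [mul_assoc, Finset.sum_mul]
  have hpi := Real.pi_gt_three
  rw [e, abs_mul, ENNReal.ofReal_mul (abs_nonneg _)]
  have h1 : ENNReal.ofReal |∫ q in II ×ˢ II, ((1 / (N:ℝ)) * KN N q.1 q.2) * f (p + q)| ≤
      ENNReal.ofReal (3 * Real.pi) * (3 * MM (fun q => ENNReal.ofReal |f q|) p) := by
    have h2 := mean_lint N hN (fun q => ENNReal.ofReal |f q|) (by fun_prop) (hp.comp fun x => ENNReal.ofReal |x|) p
    refine le_trans ?_ (mul_le_mul_right h2 _)
    rw [← lintegral_const_mul' _ _ ENNReal.ofReal_ne_top]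
    rw [← Real.norm_eq_abs, ofReal_norm]
    refine (enorm_integral_le_lintegral_enorm _).trans ?_
    refine setLIntegral_mono' (measurableSet_II.prod measurableSet_II) fun q hq => ?_
    rw [← ofReal_norm, Real.norm_eq_abs, abs_mul, ENNReal.ofReal_mul (abs_nonneg _), ← mul_assoc]
    exact mul_le_mul_left (KN_pker N hN q.1 q.2 hq.1 hq.2) _
  refine (mul_le_mul_right h1 _).trans ?_
  rw [← mul_assoc, ← ENNReal.ofReal_mul (abs_nonneg _)]
  calc _ ≤ ENNReal.ofReal 1 * (3 * MM (fun q => ENNReal.ofReal |f q|) p) := by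
        gcongr
        rw [abs_of_pos (by positivity)]
        rw [one_div, inv_mul_le_iff₀ (by positivity)]; nlinarith
    _ = _ := by simp

lemma weak_MM (u : ℝ × ℝ → ℝ) (hm : Measurable u) (hp : Bip u) (h0 : ∀ p, 0 ≤ u p) (l : ℝ) (hl : 0 < l) :
    volume {p | p ∈ T2 ∧ ENNReal.ofReal l < 3 * MM (fun q => ENNReal.ofReal |u q|) p} ≤
      ENNReal.ofReal (13500 / l) * (ENNReal.ofReal (2 * Real.pi) * 200000 + 25500 * ∫⁻ p in T2, ENNReal.ofReal (PhiY (u p))) := by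
  have h1 := AS2_L1 0 1 u hm hp h0
  have e0 : (fun q => ENNReal.ofReal |u q|) = fun q => ENNReal.ofReal (u q) := by
    funext q; rw [abs_of_nonneg (h0 q)]
  rw [e0]
  set F := (fun q => ENNReal.ofReal (u q)) with hF
  have mF : Measurable (AS2 ey F) := measurable_AS2 _ _ (by fun_prop)
  have pF : Bip (AS2 ey F) := AS2_bip _ (hp.comp ENNReal.ofReal)
  have w := fun a b => (weak_AS2 a b (AS2 ey F) mF pF (l / 9) (by positivity)).trans (mul_le_mul_right h1 _)
  have hsub : {p | p ∈ T2 ∧ ENNReal.ofReal l < 3 * MM F p} ⊆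
      ({p | p ∈ T2 ∧ p ∈ {p | ENNReal.ofReal (l/9) < AS2 ((((1:ℤ):ℝ), ((0:ℤ):ℝ))) (AS2 ey F) p}} ∪
      {p | p ∈ T2 ∧ p ∈ {p | ENNReal.ofReal (l/9) < AS2 ((((1:ℤ):ℝ), ((1:ℤ):ℝ))) (AS2 ey F) p}}) ∪
      {p | p ∈ T2 ∧ p ∈ {p | ENNReal.ofReal (l/9) < AS2 ((((1:ℤ):ℝ), ((-1:ℤ):ℝ))) (AS2 ey F) p}} := by
    rintro p ⟨hp2, h⟩
    by_contra hc
    simp only [mem_union, mem_ofPred_eq, not_or, not_and, not_lt] at hc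
    obtain ⟨⟨c1, c2⟩, c3⟩ := hc
    have : 3 * MM F p ≤ 3 * (ENNReal.ofReal (l/9) + ENNReal.ofReal (l/9) + ENNReal.ofReal (l/9)) := by
      unfold MM
      gcongr
      · exact c1 hp2
      · exact c2 hp2
      · exact c3 hp2
    rw [← ENNReal.ofReal_add (by positivity) (by positivity), ← ENNReal.ofReal_add (by positivity) (by positivity)] at this
    have e3 : (3 : ℝ≥0∞) = ENNReal.ofReal 3 := by simp
    rw [e3, ← ENNReal.ofReal_mul (by norm_num)] at this
    have e4 : 3 * (l / 9 + l / 9 + l / 9) = l := by ring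
    rw [e4] at this
    exact absurd h (not_lt.2 (by rw [e3]; exact this))
  refine (measure_mono hsub).trans ((measure_union_le _ _).trans ?_)
  refine (add_le_add ((measure_union_le _ _).trans (add_le_add (w 1 0) (w 1 1))) (w 1 (-1))).trans ?_
  rw [← add_mul, ← add_mul]
  refine mul_le_mul_left (le_of_eq ?_) _
  rw [← ENNReal.ofReal_add (by positivity) (by positivity), ← ENNReal.ofReal_add (by positivity) (by positivity)]
  congr 1; field_simp; norm_num

/-- discrete BMO type bound up to `K` -/
def BdK (K : ℕ) (ξ : ℕ → ℝ) (L : ℝ) : Prop :=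
  (∀ p M : ℕ, 1 ≤ M → p + M ≤ K → ∃ c : ℝ, (1 / (M : ℝ)) * ∑ k ∈ Finset.range M, |ξ (p + k) - c| ≤ L) ∧
  (∀ N : ℕ, 1 ≤ N → N ≤ K → |(1 / (N : ℝ)) * ∑ k ∈ Finset.range N, ξ k| ≤ L)

lemma BdK.mono {K : ℕ} {ξ : ℕ → ℝ} {L L' : ℝ} (h : BdK K ξ L) (hL : L ≤ L') : BdK K ξ L' :=
  ⟨fun p M h1 h2 => (h.1 p M h1 h2).imp fun _ hc => hc.trans hL, fun N h1 h2 => (h.2 N h1 h2).trans hL⟩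

lemma BdK.anti {K K' : ℕ} {ξ : ℕ → ℝ} {L : ℝ} (h : BdK K ξ L) (hK : K' ≤ K) : BdK K' ξ L :=
  ⟨fun p M h1 h2 => h.1 p M h1 (h2.trans hK), fun N h1 h2 => h.2 N h1 (h2.trans hK)⟩

lemma BdK.sub {K : ℕ} {ξ η : ℕ → ℝ} {L L' : ℝ} (h : BdK K ξ L) (h' : BdK K η L') :
    BdK K (fun k => ξ k - η k) (L + L') := by
  refine ⟨fun p M h1 h2 => ?_, fun N h1 h2 => ?_⟩
  · obtain ⟨c, hc⟩ := h.1 p M h1 h2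
    obtain ⟨d, hd⟩ := h'.1 p M h1 h2
    refine ⟨c - d, ?_⟩
    refine le_trans ?_ (add_le_add hc hd)
    rw [← mul_add, ← Finset.sum_add_distrib]
    gcongr with k _
    have e : ξ (p + k) - η (p + k) - (c - d) = (ξ (p + k) - c) - (η (p + k) - d) := by ring
    rw [e]; exact abs_sub _ _
  · rw [Finset.sum_sub_distrib, mul_sub]
    exact (abs_sub _ _).trans (add_le_add (h.2 N h1 h2) (h'.2 N h1 h2))

lemma avg_le (M : ℕ) (hM : 1 ≤ M) (a : ℕ → ℝ) (ε : ℝ) (h : ∀ k < M, a k ≤ ε) :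
    (1 / (M : ℝ)) * ∑ k ∈ Finset.range M, a k ≤ ε := by
  have hM0 : (0 : ℝ) < M := by exact_mod_cast hM
  rw [one_div, inv_mul_le_iff₀ hM0]
  refine (Finset.sum_le_sum fun k hk => h k (Finset.mem_range.1 hk)).trans ?_
  simp

lemma BdK_small {K : ℕ} {ξ : ℕ → ℝ} {ε : ℝ} (h : ∀ k < K, |ξ k| ≤ ε) : BdK K ξ ε := by
  refine ⟨fun p M h1 h2 => ⟨0, ?_⟩, fun N h1 h2 => ?_⟩
  · refine avg_le M h1 _ _ fun k hk => ?_
    rw [sub_zero]; exact h _ (by omega)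
  · have hN0 : (0 : ℝ) < N := by exact_mod_cast h1
    rw [abs_mul, abs_of_pos (by positivity : (0:ℝ) < 1 / N)]
    refine le_trans ?_ (avg_le N h1 (fun k => |ξ k|) ε fun k hk => h k (by omega))
    gcongr
    exact Finset.abs_sum_le_sum_abs _ _

lemma BdK.pert {K : ℕ} {ξ η : ℕ → ℝ} {L ε : ℝ} (h : BdK K η L) (he : ∀ k < K, |η k - ξ k| ≤ ε) : BdK K ξ (L + ε) := by
  have := h.sub (BdK_small (ξ := fun k => η k - ξ k) he)
  simpa using this

lemma stepFun_cell (ξ : ℕ → ℝ) (n k : ℕ) (hk : k ≤ n) (t : ℝ) (h1 : (k : ℝ) / (n + 1) < t) (h2 : t < ((k : ℝ) + 1) / (n + 1)) :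
    stepFun ξ n t = ξ k := by
  have hn : (0 : ℝ) < (n : ℝ) + 1 := by positivity
  unfold stepFun
  rw [Finset.sum_eq_single k]
  · exact indicator_of_mem (show t ∈ Icc _ _ from ⟨h1.le, h2.le⟩) _
  · intro j _ hj
    refine indicator_of_notMem (fun hm => hj ?_) _
    have a1 := hm.1
    have a2 := hm.2
    rw [div_lt_iff₀ hn] at h1
    rw [lt_div_iff₀ hn] at h2
    rw [div_le_iff₀ hn] at a1
    rw [le_div_iff₀ hn] at a2
    have b1 : (j : ℝ) < k + 1 := by linarith
    have b2 : (k : ℝ) < j + 1 := by linarith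
    have b1' : j < k + 1 := by exact_mod_cast b1
    have b2' : k < j + 1 := by exact_mod_cast b2
    omega
  · intro h; exact absurd (Finset.mem_range.2 (by omega)) h

lemma ae_notgrid (n : ℕ) : ∀ᵐ t : ℝ, ∀ k : ℕ, t ≠ (k : ℝ) / (n + 1) := by
  rw [ae_all_iff]; intro k; simp [ae_iff]

lemma measurable_stepFun (ξ : ℕ → ℝ) (n : ℕ) : Measurable (stepFun ξ n) := by
  unfold stepFun
  exact Finset.measurable_sum _ fun k _ => measurable_const.indicator measurableSet_Icc

lemma stepFun_integrable (ξ : ℕ → ℝ) (n : ℕ) : Integrable (stepFun ξ n) := by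
  unfold stepFun
  refine integrable_finsetSum _ fun k _ => ?_
  rw [integrable_indicator_iff measurableSet_Icc]
  exact integrableOn_const (by simp)

lemma stepFun_mean (ξ : ℕ → ℝ) (n : ℕ) :
    ∫ t in Icc (0:ℝ) 1, stepFun ξ n t = (1 / ((n + 1 : ℕ) : ℝ)) * ∑ k ∈ Finset.range (n + 1), ξ k := by
  have hn : (0 : ℝ) < (n : ℝ) + 1 := by positivity
  unfold stepFun
  rw [integral_finsetSum _ fun k _ => ?_, Finset.mul_sum]
  · refine Finset.sum_congr rfl fun k hk => ?_
    have hk' : (k : ℝ) + 1 ≤ n + 1 := by exact_mod_cast Finset.mem_range.1 hk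
    rw [setIntegral_indicator measurableSet_Icc]
    have : Icc (0:ℝ) 1 ∩ Icc ((k : ℝ) / ((n : ℝ) + 1)) (((k : ℝ) + 1) / ((n : ℝ) + 1)) =
        Icc ((k : ℝ) / ((n : ℝ) + 1)) (((k : ℝ) + 1) / ((n : ℝ) + 1)) := by
      apply inter_eq_right.2
      exact Icc_subset_Icc (by positivity) (by rw [div_le_one hn]; exact hk')
    rw [this, setIntegral_const, Real.volume_real_Icc_of_le (by gcongr; linarith)]
    push_cast; simp only [smul_eq_mul]; field_simp; ring
  · refine Integrable.integrableOn ?_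
    rw [integrable_indicator_iff measurableSet_Icc]
    exact integrableOn_const (by simp)

lemma osc_le (g : ℝ → ℝ) (a b c : ℝ) (hab : a < b) (hg : Integrable g) (L : ℝ)
    (h : ∫ t in Icc a b, |g t - c| ≤ L * (b - a)) :
    (b - a)⁻¹ * ∫ t in Icc a b, |g t - (b - a)⁻¹ * ∫ s in Icc a b, g s| ≤ 2 * L := by
  have hl : 0 < b - a := by linarith
  have ic : ∀ d : ℝ, IntegrableOn (fun t => g t - d) (Icc a b) := fun d => hg.integrableOn.sub (integrableOn_const (by simp))
  have iv : volume.real (Icc a b) = b - a := Real.volume_real_Icc_of_le hab.le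
  set m := (b - a)⁻¹ * ∫ s in Icc a b, g s with hm
  have hmc : |c - m| ≤ L := by
    have e : m - c = (b - a)⁻¹ * ∫ s in Icc a b, (g s - c) := by
      rw [integral_sub hg.integrableOn (integrableOn_const (by simp)), setIntegral_const, iv, mul_sub, ← hm]
      simp only [smul_eq_mul]; field_simp
    rw [abs_sub_comm, e, abs_mul, abs_of_pos (by positivity), inv_mul_le_iff₀ hl]
    exact (abs_integral_le_integral_abs).trans (h.trans (by rw [mul_comm]))
  rw [inv_mul_le_iff₀ hl]
  calc ∫ t in Icc a b, |g t - m| ≤ ∫ t in Icc a b, (|g t - c| + |c - m|) := by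
        refine integral_mono (ic m).abs ((ic c).abs.add (integrableOn_const (by simp))) fun t => ?_
        have : g t - m = (g t - c) + (c - m) := by ring
        simp only
        rw [this]; exact abs_add_le _ _
    _ = (∫ t in Icc a b, |g t - c|) + (b - a) * |c - m| := by
        rw [integral_add (ic c).abs (integrableOn_const (by simp)), setIntegral_const, iv]; rfl
    _ ≤ L * (b - a) + (b - a) * L := by gcongr
    _ = _ := by ring

lemma step_osc (ξ : ℕ → ℝ) (L : ℝ) (hL : 0 ≤ L) (n : ℕ) (h : BdK (n + 1) ξ L) (a b : ℝ) (ha : 0 ≤ a) (hab : a < b) (hb : b ≤ 1) :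
    ∃ c, ∫ t in Icc a b, |stepFun ξ n t - c| ≤ (3 * L) * (b - a) := by
  have hn : (0 : ℝ) < (n : ℝ) + 1 := by positivity
  set p := ⌊((n : ℝ) + 1) * a⌋₊ with hp
  set q := ⌈((n : ℝ) + 1) * b⌉₊ with hq
  have hp1 : (p : ℝ) ≤ (n + 1) * a := Nat.floor_le (by positivity)
  have hp2 : (n + 1) * a < (p : ℝ) + 1 := Nat.lt_floor_add_one _
  have hq1 : (n + 1) * b ≤ (q : ℝ) := Nat.le_ceil _
  have hq2 : (q : ℝ) < (n + 1) * b + 1 := Nat.ceil_lt_add_one (by nlinarith)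
  have hpq : p < q := by
    have : (p : ℝ) < q := by nlinarith
    exact_mod_cast this
  have hqn : q ≤ n + 1 := by
    refine Nat.ceil_le.2 ?_
    push_cast; nlinarith
  obtain ⟨M, hM⟩ : ∃ M, q = p + M := ⟨q - p, by omega⟩
  have hM1 : 1 ≤ M := by omega
  obtain ⟨c, hc⟩ := h.1 p M hM1 (by omega)
  refine ⟨c, ?_⟩
  have hM0 : (0 : ℝ) < M := by exact_mod_cast hM1
  rw [one_div, inv_mul_le_iff₀ hM0] at hc
  set W : ℕ → Set ℝ := fun k => Icc a b ∩ Icc (((p + k : ℕ) : ℝ) / (n + 1)) ((((p + k : ℕ) : ℝ) + 1) / (n + 1)) with hW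
  have mW : ∀ k, MeasurableSet (W k) := fun k => measurableSet_Icc.inter measurableSet_Icc
  have fW : ∀ k, volume (W k) ≠ ∞ := fun k => ((measure_mono inter_subset_left).trans_lt (by simp : volume (Icc a b) < ∞)).ne
  have vW1 : ∀ k, volume.real (W k) ≤ b - a := fun k => by
    rw [← Real.volume_real_Icc_of_le hab.le]
    exact measureReal_mono inter_subset_left (by simp)
  have vW2 : ∀ k, volume.real (W k) ≤ 1 / (n + 1) := fun k => by
    refine (measureReal_mono inter_subset_right (by simp)).trans ?_
    rw [Real.volume_real_Icc_of_le (by gcongr; linarith)]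
    refine le_of_eq ?_
    field_simp; ring
  set w := min (b - a) (1 / ((n : ℝ) + 1)) with hw
  have vW : ∀ k, volume.real (W k) ≤ w := fun k => le_min (vW1 k) (vW2 k)
  have iW : ∀ k, Integrable ((W k).indicator fun _ => |ξ (p + k) - c|) := fun k => by
    rw [integrable_indicator_iff (mW k)]; exact integrableOn_const (fW k)
  have s1 : ∫ t in Icc a b, |stepFun ξ n t - c| ≤ ∫ t, ∑ k ∈ Finset.range M, (W k).indicator (fun _ => |ξ (p + k) - c|) t := by
    rw [← integral_indicator measurableSet_Icc]
    refine integral_mono_ae ?_ (integrable_finsetSum _ fun k _ => iW k) ?_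
    · rw [integrable_indicator_iff measurableSet_Icc]
      exact ((stepFun_integrable ξ n).integrableOn.sub (integrableOn_const (by simp))).abs
    · filter_upwards [ae_notgrid n] with t ht
      have nn : ∀ k ∈ Finset.range M, 0 ≤ (W k).indicator (fun _ => |ξ (p + k) - c|) t :=
        fun k _ => indicator_nonneg (fun _ _ => abs_nonneg _) _
      by_cases hI : t ∈ Icc a b
      · rw [indicator_of_mem hI]
        set k := ⌊((n : ℝ) + 1) * t⌋₊ with hk
        have hk1 : (k : ℝ) ≤ (n + 1) * t := Nat.floor_le (mul_nonneg hn.le (ha.trans hI.1))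
        have hk2 : (n + 1) * t < (k : ℝ) + 1 := Nat.lt_floor_add_one _
        have hk3 : (k : ℝ) / (n + 1) < t := by
          refine lt_of_le_of_ne ?_ (ht k).symm
          rw [div_le_iff₀ hn]; linarith
        have hk4 : t < ((k : ℝ) + 1) / (n + 1) := by rw [lt_div_iff₀ hn]; linarith
        have hpk : p ≤ k := Nat.floor_le_floor (by have := hI.1; gcongr)
        have hkq : k < q := by
          have : (k : ℝ) < q := by
            rw [div_lt_iff₀ hn] at hk3
            have := hI.2
            nlinarith
          exact_mod_cast this
        obtain ⟨j, hj⟩ : ∃ j, k = p + j := ⟨k - p, by omega⟩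
        rw [stepFun_cell ξ n k (by omega) t hk3 hk4]
        refine le_trans (le_of_eq ?_) (Finset.single_le_sum nn (Finset.mem_range.2 (show j < M by omega)))
        rw [indicator_of_mem, hj]
        refine ⟨hI, ?_⟩
        rw [← hj]; exact ⟨hk3.le, hk4.le⟩
      · rw [indicator_of_notMem hI]
        exact Finset.sum_nonneg nn
  refine s1.trans ?_
  rw [integral_finsetSum _ fun k _ => iW k]
  have s2 : ∀ k ∈ Finset.range M, ∫ t, (W k).indicator (fun _ => |ξ (p + k) - c|) t ≤ w * |ξ (p + k) - c| := by
    intro k _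
    rw [integral_indicator (mW k), setIntegral_const]
    exact mul_le_mul_of_nonneg_right (vW k) (abs_nonneg _)
  refine (Finset.sum_le_sum s2).trans ?_
  rw [← Finset.mul_sum]
  have w0 : 0 ≤ w := le_min (by linarith) (by positivity)
  have s3 : w * M ≤ 3 * (b - a) := by
    by_cases h3 : M ≤ 3
    · have h3' : (M : ℝ) ≤ 3 := by exact_mod_cast h3
      calc w * M ≤ (b - a) * 3 := by
            refine mul_le_mul (min_le_left _ _) h3' hM0.le (by linarith)
        _ = _ := by ring
    · have h3' : (4 : ℝ) ≤ M := by exact_mod_cast (by omega : 4 ≤ M)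
      have hMr : (q : ℝ) = p + M := by rw [hM]; push_cast; rfl
      have h5 : (M : ℝ) - 2 ≤ (n + 1) * (b - a) := by linarith
      calc w * M ≤ 1 / (n + 1) * M := by gcongr; exact min_le_right _ _
        _ ≤ 1 / (n + 1) * (3 * ((n + 1) * (b - a))) := by gcongr; linarith
        _ = _ := by field_simp
  calc _ ≤ w * (M * L) := by gcongr
    _ = (w * M) * L := by ring
    _ ≤ (3 * (b - a)) * L := by gcongr
    _ = _ := by ring

lemma bmoSeq_le (ξ : ℕ → ℝ) (L : ℝ) (hL : 0 ≤ L) (h : ∀ K, BdK K ξ L) : bmoSeq ξ ≤ 7 * L := by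
  refine ciSup_le fun n => ?_
  unfold bmoNorm
  have h1 : (⨆ I : {p : ℝ × ℝ // 0 ≤ p.1 ∧ p.1 < p.2 ∧ p.2 ≤ 1},
      (I.1.2 - I.1.1)⁻¹ * ∫ t in Set.Icc I.1.1 I.1.2, |stepFun ξ n t - (I.1.2 - I.1.1)⁻¹ * ∫ s in Set.Icc I.1.1 I.1.2, stepFun ξ n s|) ≤ 6 * L := by
    have : Nonempty {p : ℝ × ℝ // 0 ≤ p.1 ∧ p.1 < p.2 ∧ p.2 ≤ 1} := ⟨⟨(0, 1), by norm_num⟩⟩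
    refine ciSup_le fun I => ?_
    obtain ⟨⟨a, b⟩, ha, hab, hb⟩ := I
    obtain ⟨c, hc⟩ := step_osc ξ L hL n (h _) a b ha hab hb
    refine (osc_le _ a b c hab (stepFun_integrable ξ n) _ hc).trans (by linarith)
  have h2 : |∫ t in Set.Icc (0 : ℝ) 1, stepFun ξ n t| ≤ L := by
    rw [stepFun_mean]; exact (h (n + 1)).2 (n + 1) (by omega) le_rfl
  linarith

/-- sine polynomial -/
def sp (n : ℕ) (c β : ℕ → ℝ) (j k : ℕ → ℤ) (p : ℝ × ℝ) : ℝ :=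
  ∑ i ∈ Finset.range n, c i * Real.sin (ph (j i) (k i) (β i) p)

lemma sp_cont (n c β j k) : Continuous (sp n c β j k) := by unfold sp ph; fun_prop
lemma sp_bip (n c β j k) : Bip (sp n c β j k) := fun x y => by
  simp only [sp, ph_x, ph_y, Real.sin_add_int_mul_two_pi, and_self]

lemma Gp_sp (n r α j k) : Gp n r α j k = sp n (fun i => r i * sg (j i + k i)) α j k := by
  funext p; unfold Gp sp; simp only [mul_assoc]
lemma Gm_sp (n r α j k) : Gm n r α j k = sp n (fun i => r i * sg (j i - k i)) α j k := by
  funext p; unfold Gm sp; simp only [mul_assoc]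

lemma osc2 (n c β) (j k : ℕ → ℤ) (a b : ℤ) (p : ℝ × ℝ) (l : ℝ) (hl : 0 < l)
    (h1 : AS2 ((a : ℝ), (b : ℝ)) (fun q => ENNReal.ofReal |sp n c β j k q|) p ≤ ENNReal.ofReal l)
    (h2 : ∀ M : ℕ, 1 ≤ M → QQ2 ((a : ℝ), (b : ℝ)) M (fun q => ENNReal.ofReal |sp n c β j k q|) p ≤ ENNReal.ofReal (l ^ 2))
    (M : ℕ) (hM : 1 ≤ M) (s : ℕ) :
    ∃ d : ℝ, (1 / (M : ℝ)) * ∑ i ∈ Finset.range M, |TT (s + i) (lin ((a : ℝ), (b : ℝ)) (sp n c β j k) p) 0 - d| ≤ 2 * l := by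
  have hlin : ∀ u, lin ((a : ℝ), (b : ℝ)) (sp n c β j k) p u =
      ∑ i ∈ Finset.range n, c i * Real.sin (((j i * a + k i * b : ℤ) : ℝ) * u + ph (j i) (k i) (β i) p) := fun u => by
    unfold lin sp; simp only [ph_line]
  have := osc (lin ((a : ℝ), (b : ℝ)) (sp n c β j k) p)
    ⟨measurable_lin _ (sp_cont n c β j k).measurable p, ∑ i ∈ Finset.range n, |c i|, fun t _ => by
      rw [hlin]
      refine (Finset.abs_sum_le_sum_abs _ _).trans (Finset.sum_le_sum fun i _ => ?_)
      rw [abs_mul]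
      exact mul_le_of_le_one_right (abs_nonneg _) (Real.abs_sin_le_one _)⟩
    (lin_periodic a b (sp_bip n c β j k) p)
    (by
      have e : (fun u => ct u * (lin ((a : ℝ), (b : ℝ)) (sp n c β j k) p u - lin ((a : ℝ), (b : ℝ)) (sp n c β j k) p (-u))) =
          fun u => ∑ i ∈ Finset.range n, (2 * c i * Real.cos (ph (j i) (k i) (β i) p)) *
            (Real.sin (((j i * a + k i * b : ℤ) : ℝ) * u) * ct u) := by
        funext u
        rw [hlin, hlin, ← Finset.sum_sub_distrib, Finset.mul_sum]
        refine Finset.sum_congr rfl fun i _ => ?_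
        rw [mul_neg, neg_add_eq_sub, Real.sin_sub, Real.sin_add]; ring
      rw [e]
      exact integrable_finsetSum _ fun i _ => ((BM_sin_ct _).integrable).const_mul _)
    M hM s l (l ^ 2) hl.le (by positivity)
    ((AA2_le_AS2 ((a : ℝ), (b : ℝ)) M hM _ p).trans h1) (h2 M hM)
  rw [Real.sqrt_sq hl.le] at this
  obtain ⟨d, hd⟩ := this
  exact ⟨d, hd.trans (by linarith)⟩

lemma II2_lint (h : ℝ × ℝ → ℝ≥0∞) : ∫⁻ q in II ×ˢ II, h q = ∫⁻ q in T2, h q := by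
  rw [vol_II2, vol_T2_restrict]
  have : (volume : Measure ℝ).restrict II = volume.restrict T1 := (Measure.restrict_congr_set T1_ae_Ioo).symm
  rw [this]

lemma II2_shift (h : ℝ × ℝ → ℝ≥0∞) (hm : Measurable h) (hp : Bip h) (p : ℝ × ℝ) :
    ∫⁻ q in II ×ˢ II, h (p + q) = ∫⁻ q in T2, h q := by
  rw [II2_lint, ← shift_T2 h hm hp p]
  simp only [add_comm]

lemma KK_le (a : ℝ → ℝ) (C : ℝ) (hC : 0 ≤ C) (ha : ∀ t ∈ II, |a t| ≤ C) (f : ℝ × ℝ → ℝ) (hm : Measurable f) (hp : Bip f) (p : ℝ × ℝ) :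
    ENNReal.ofReal |KK a f p| ≤ ENNReal.ofReal (C ^ 2) * ∫⁻ q in T2, ENNReal.ofReal |f q| := by
  unfold KK
  rw [← II2_shift (fun q => ENNReal.ofReal |f q|) (by fun_prop) (hp.comp fun x => ENNReal.ofReal |x|) p,
    ← Real.norm_eq_abs, ofReal_norm]
  refine (enorm_integral_le_lintegral_enorm _).trans ?_
  rw [← lintegral_const_mul' _ _ ENNReal.ofReal_ne_top]
  refine setLIntegral_mono' (measurableSet_II.prod measurableSet_II) fun q hq => ?_
  rw [← ofReal_norm, Real.norm_eq_abs, abs_mul, ENNReal.ofReal_mul (abs_nonneg _)]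
  refine mul_le_mul_left (ENNReal.ofReal_le_ofReal ?_) _
  rw [abs_mul, sq]
  exact mul_le_mul (ha _ hq.1) (ha _ hq.2) (abs_nonneg _) hC

lemma volume_T2' : volume T2 = ENNReal.ofReal (4 * Real.pi ^ 2) := by
  rw [volume_T2, ← ENNReal.ofReal_mul (by positivity)]; congr 1; ring

lemma L1_le (f : ℝ × ℝ → ℝ) (h0 : ∀ p, 0 ≤ f p) (hm : Measurable f) :
    ∫⁻ q in T2, ENNReal.ofReal |f q| ≤ 200 + ∫⁻ q in T2, ENNReal.ofReal (PhiY (f q)) := by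
  calc ∫⁻ q in T2, ENNReal.ofReal |f q| ≤ ∫⁻ q in T2, (3 + ENNReal.ofReal (PhiY (f q))) := by
        refine lintegral_mono fun q => ?_
        rw [abs_of_nonneg (h0 q)]
        refine (ENNReal.ofReal_le_ofReal (le_PhiY _ (h0 q))).trans ?_
        rw [ENNReal.ofReal_add (by norm_num) (PhiY_nonneg _ (h0 q))]
        simp
    _ = 3 * volume T2 + ∫⁻ q in T2, ENNReal.ofReal (PhiY (f q)) := by
        rw [lintegral_add_left measurable_const]; simp
    _ ≤ _ := by
        gcongr
        rw [volume_T2']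
        have : (3 : ℝ≥0∞) = ENNReal.ofReal 3 := by simp
        rw [this, ← ENNReal.ofReal_mul (by norm_num)]
        refine ENNReal.ofReal_le_of_le_toReal ?_
        have := Real.pi_lt_d2
        have := Real.pi_pos
        simp; nlinarith

lemma EE_le (n N : ℕ) (r α j k) (h0 : ∀ p, 0 ≤ tp N r α j k p) (p : ℝ × ℝ) (e : ℝ) (he : 0 ≤ e)
    (hJ : ∫⁻ q in T2, ENNReal.ofReal |tp N r α j k q| ≤ ENNReal.ofReal (4 * Real.pi ^ 2 * e)) :
    |EE n (tp N r α j k) p| ≤ e := by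
  have h1 := (KK_le (fun t => Real.cos (n * t)) 1 zero_le_one (fun t _ => Real.abs_cos_le_one _) _
    (tp_cont N r α j k).measurable (tp_bip N r α j k) p)
  simp only [one_pow, ENNReal.ofReal_one, one_mul] at h1
  have h2 := h1.trans hJ
  rw [ENNReal.ofReal_le_ofReal_iff (by positivity)] at h2
  unfold EE
  rw [abs_mul, abs_of_pos (by positivity), one_div, inv_mul_le_iff₀ (by positivity)]
  exact h2

/-- good points -/
def Good (G : ℝ × ℝ → ℝ) (a b : ℤ) (l : ℝ) (p : ℝ × ℝ) : Prop :=
  AS2 ((a : ℝ), (b : ℝ)) (fun q => ENNReal.ofReal |G q|) p ≤ ENNReal.ofReal l ∧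
  ∀ M : ℕ, 1 ≤ M → QQ2 ((a : ℝ), (b : ℝ)) M (fun q => ENNReal.ofReal |G q|) p ≤ ENNReal.ofReal (l ^ 2)

lemma Good_vol (G : ℝ × ℝ → ℝ) (hm : Measurable G) (hp : Bip G) (a b : ℤ) (l : ℝ) (hl : 0 < l) :
    volume {p | p ∈ T2 ∧ ¬ Good G a b l p} ≤ ENNReal.ofReal (1200 / l) * ∫⁻ p in T2, ENNReal.ofReal |G p| := by
  have w1 := weak_AS2 a b (fun q => ENNReal.ofReal |G q|) (by fun_prop) (hp.comp fun x => ENNReal.ofReal |x|) l hl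
  have w2 := weak_QQ2 a b (fun q => ENNReal.ofReal |G q|) (by fun_prop) (hp.comp fun x => ENNReal.ofReal |x|) l hl
  have e : ENNReal.ofReal (1200 / l) = ENNReal.ofReal (500 / l) + ENNReal.ofReal (700 / l) := by
    rw [← ENNReal.ofReal_add (by positivity) (by positivity)]; congr 1; ring
  rw [e, add_mul]
  refine le_trans ?_ (add_le_add w1 w2)
  refine le_trans (measure_mono ?_) (measure_union_le _ _)
  rintro p ⟨h, h'⟩
  by_cases c : AS2 ((a : ℝ), (b : ℝ)) (fun q => ENNReal.ofReal |G q|) p ≤ ENNReal.ofReal l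
  · right
    refine ⟨h, ?_⟩
    by_contra hc
    refine h' ⟨c, fun M hM => ?_⟩
    by_contra hcc
    exact hc ⟨M, hM, not_le.1 hcc⟩
  · left; exact ⟨h, not_le.1 c⟩

lemma Good_Bd (N r α j k) (h0 : ∀ p, 0 ≤ tp N r α j k p) (μ : ℝ) (hμ : 0 < μ) (p : ℝ × ℝ)
    (hJ : ∫⁻ q in T2, ENNReal.ofReal |tp N r α j k q| ≤ ENNReal.ofReal (2 * Real.pi ^ 2 * μ))
    (g1 : Good (Gm N r α j k) 1 0 (μ / 8) p) (g2 : Good (Gm N r α j k) 0 1 (μ / 8) p)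
    (g3 : Good (Gp N r α j k) 1 0 (μ / 8) p) (g4 : Good (Gp N r α j k) 0 1 (μ / 8) p)
    (gM : 3 * MM (fun q => ENNReal.ofReal |tp N r α j k q|) p ≤ ENNReal.ofReal μ) (K : ℕ) :
    BdK K (fun n => SS (n + 1) (tp N r α j k) p) μ := by
  have hEE : ∀ n, |EE n (tp N r α j k) p| ≤ μ / 2 := fun n =>
    EE_le n N r α j k h0 p (μ / 2) (by positivity) (hJ.trans (le_of_eq (by congr 1; ring)))
  refine ⟨fun s M hM _ => ?_, fun M hM _ => ?_⟩
  · rw [Gm_sp] at g1 g2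
    rw [Gp_sp] at g3 g4
    obtain ⟨c1, k1⟩ := osc2 _ _ _ _ _ 1 0 p (μ / 8) (by positivity) g1.1 g1.2 M hM (s + 1)
    obtain ⟨c2, k2⟩ := osc2 _ _ _ _ _ 0 1 p (μ / 8) (by positivity) g2.1 g2.2 M hM (s + 1)
    obtain ⟨c3, k3⟩ := osc2 _ _ _ _ _ 1 0 p (μ / 8) (by positivity) g3.1 g3.2 M hM (s + 1)
    obtain ⟨c4, k4⟩ := osc2 _ _ _ _ _ 0 1 p (μ / 8) (by positivity) g4.1 g4.2 M hM (s + 1)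
    rw [← Gm_sp] at k1 k2
    rw [← Gp_sp] at k3 k4
    refine ⟨tp N r α j k p - 1/2 * c1 + 1/2 * c2 - 1/2 * c3 - 1/2 * c4, ?_⟩
    have k5 := avg_le M hM (fun i => |EE (s + 1 + i) (tp N r α j k) p|) (μ / 2) (fun i _ => hEE _)
    set X1 := fun i => |TT (s + 1 + i) (lin (((1:ℤ):ℝ), ((0:ℤ):ℝ)) (Gm N r α j k) p) 0 - c1| with hX1
    set X2 := fun i => |TT (s + 1 + i) (lin (((0:ℤ):ℝ), ((1:ℤ):ℝ)) (Gm N r α j k) p) 0 - c2| with hX2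
    set X3 := fun i => |TT (s + 1 + i) (lin (((1:ℤ):ℝ), ((0:ℤ):ℝ)) (Gp N r α j k) p) 0 - c3| with hX3
    set X4 := fun i => |TT (s + 1 + i) (lin (((0:ℤ):ℝ), ((1:ℤ):ℝ)) (Gp N r α j k) p) 0 - c4| with hX4
    set X5 := fun i => |EE (s + 1 + i) (tp N r α j k) p| with hX5
    calc _ ≤ (1 / (M : ℝ)) * ∑ i ∈ Finset.range M, (1/2 * X1 i + 1/2 * X2 i + 1/2 * X3 i + 1/2 * X4 i + X5 i) := by
          gcongr with i _
          have ei : s + i + 1 = s + 1 + i := by ring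
          beta_reduce
          rw [ei, SS_identity (s + 1 + i) (by omega)]
          simp only [hX1, hX2, hX3, hX4, hX5]
          unfold ex ey
          generalize TT (s + 1 + i) (lin (((1:ℤ):ℝ), ((0:ℤ):ℝ)) (Gm N r α j k) p) 0 = y1
          generalize TT (s + 1 + i) (lin (((0:ℤ):ℝ), ((1:ℤ):ℝ)) (Gm N r α j k) p) 0 = y2
          generalize TT (s + 1 + i) (lin (((1:ℤ):ℝ), ((0:ℤ):ℝ)) (Gp N r α j k) p) 0 = y3
          generalize TT (s + 1 + i) (lin (((0:ℤ):ℝ), ((1:ℤ):ℝ)) (Gp N r α j k) p) 0 = y4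
          generalize EE (s + 1 + i) (tp N r α j k) p = y5
          generalize tp N r α j k p = y6
          have a1 := le_abs_self (y1 - c1)
          have a2 := le_abs_self (y2 - c2)
          have a3 := le_abs_self (y3 - c3)
          have a4 := le_abs_self (y4 - c4)
          have a5 := le_abs_self y5
          have b1 := neg_le_abs (y1 - c1)
          have b2 := neg_le_abs (y2 - c2)
          have b3 := neg_le_abs (y3 - c3)
          have b4 := neg_le_abs (y4 - c4)
          have b5 := neg_le_abs y5
          rw [abs_le]; constructor <;> linarith
      _ = 1/2 * ((1 / (M : ℝ)) * ∑ i ∈ Finset.range M, X1 i) + 1/2 * ((1 / (M : ℝ)) * ∑ i ∈ Finset.range M, X2 i)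
          + 1/2 * ((1 / (M : ℝ)) * ∑ i ∈ Finset.range M, X3 i) + 1/2 * ((1 / (M : ℝ)) * ∑ i ∈ Finset.range M, X4 i)
          + (1 / (M : ℝ)) * ∑ i ∈ Finset.range M, X5 i := by
          simp only [Finset.sum_add_distrib, ← Finset.mul_sum]; ring
      _ ≤ μ := by linarith
  · have := (mean_bound M hM _ (tp_cont N r α j k).measurable (tp_bip N r α j k) p (cont_int_II2 _ (tp_cont N r α j k) p)).trans gM
    rwa [ENNReal.ofReal_le_ofReal_iff hμ.le] at this

lemma main_tp : ∃ C : ℝ, 0 < C ∧ ∀ N r α j k, (∀ p, 0 ≤ tp N r α j k p) → ∀ μ : ℝ, 0 < μ →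
    volume {p | p ∈ T2 ∧ ¬ ∀ K, BdK K (fun n => SS (n + 1) (tp N r α j k) p) μ} ≤
      ENNReal.ofReal (C / μ) * (1 + ∫⁻ q in T2, ENNReal.ofReal (PhiY (tp N r α j k q))) := by
  obtain ⟨C, hC0, hC⟩ : ∃ C : ℝ, 0 < C ∧ ∀ I : ℝ≥0∞, 4 * (9600 * (ENNReal.ofReal (2 * Real.pi) * 130 + 12 * I)) +
      13500 * (ENNReal.ofReal (2 * Real.pi) * 200000 + 25500 * I) + 2 * (200 + I) ≤ ENNReal.ofReal C * (1 + I) := by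
    refine ⟨10 ^ 12, by norm_num, fun I => ?_⟩
    have h7 : ENNReal.ofReal (2 * Real.pi) ≤ 7 := by
      refine ENNReal.ofReal_le_of_le_toReal ?_
      have := Real.pi_lt_d2
      simp; linarith
    have : ENNReal.ofReal (10 ^ 12) = 10 ^ 12 := by rw [ENNReal.ofReal_pow (by norm_num)]; norm_num
    rw [this]
    calc _ ≤ 4 * (9600 * (7 * 130 + 12 * I)) + 13500 * (7 * 200000 + 25500 * I) + 2 * (200 + I) := by gcongr
      _ = (4 * 9600 * 7 * 130 + 13500 * 7 * 200000 + 400) + (4 * 9600 * 12 + 13500 * 25500 + 2) * I := by ring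
      _ ≤ 10 ^ 12 + 10 ^ 12 * I := by gcongr <;> norm_num
      _ = _ := by ring
  refine ⟨C, hC0, fun N r α j k h0 μ hμ => ?_⟩
  set I := ∫⁻ q in T2, ENNReal.ofReal (PhiY (tp N r α j k q)) with hI
  have hfac : ENNReal.ofReal (C / μ) * (1 + I) = ENNReal.ofReal (1 / μ) * (ENNReal.ofReal C * (1 + I)) := by
    rw [← mul_assoc, ← ENNReal.ofReal_mul (by positivity)]; congr 2; ring
  rw [hfac]
  refine le_trans ?_ (mul_le_mul_right (hC I) _)
  have hL1 := L1_le _ h0 (tp_cont N r α j k).measurable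
  have sc : ∀ (x : ℝ) (A : ℝ≥0∞), 0 ≤ x → ENNReal.ofReal (x / μ) * A = ENNReal.ofReal (1 / μ) * (ENNReal.ofReal x * A) := by
    intro x A hx
    rw [← mul_assoc, ← ENNReal.ofReal_mul (by positivity)]; congr 2; ring
  by_cases hJ : ∫⁻ q in T2, ENNReal.ofReal |tp N r α j k q| ≤ ENNReal.ofReal (2 * Real.pi ^ 2 * μ)
  · have v1 := (Good_vol _ (Gm_cont N r α j k).measurable (Gm_bip N r α j k) 1 0 (μ / 8) (by positivity)).trans (mul_le_mul_right (Gm_L1 N r α j k h0) _)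
    have v2 := (Good_vol _ (Gm_cont N r α j k).measurable (Gm_bip N r α j k) 0 1 (μ / 8) (by positivity)).trans (mul_le_mul_right (Gm_L1 N r α j k h0) _)
    have v3 := (Good_vol _ (Gp_cont N r α j k).measurable (Gp_bip N r α j k) 1 0 (μ / 8) (by positivity)).trans (mul_le_mul_right (Gp_L1 N r α j k h0) _)
    have v4 := (Good_vol _ (Gp_cont N r α j k).measurable (Gp_bip N r α j k) 0 1 (μ / 8) (by positivity)).trans (mul_le_mul_right (Gp_L1 N r α j k h0) _)
    have v5 := weak_MM _ (tp_cont N r α j k).measurable (tp_bip N r α j k) h0 μ hμ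
    have e8 : (1200 : ℝ) / (μ / 8) = 9600 / μ := by field_simp; norm_num
    rw [e8, sc 9600 _ (by norm_num), ← hI] at v1 v2 v3 v4
    rw [sc 13500 _ (by norm_num), ← hI] at v5
    have hsub : {p | p ∈ T2 ∧ ¬ ∀ K, BdK K (fun n => SS (n + 1) (tp N r α j k) p) μ} ⊆
        ((({p | p ∈ T2 ∧ ¬ Good (Gm N r α j k) 1 0 (μ / 8) p} ∪ {p | p ∈ T2 ∧ ¬ Good (Gm N r α j k) 0 1 (μ / 8) p}) ∪
        {p | p ∈ T2 ∧ ¬ Good (Gp N r α j k) 1 0 (μ / 8) p}) ∪ {p | p ∈ T2 ∧ ¬ Good (Gp N r α j k) 0 1 (μ / 8) p}) ∪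
        {p | p ∈ T2 ∧ ENNReal.ofReal μ < 3 * MM (fun q => ENNReal.ofReal |tp N r α j k q|) p} := by
      rintro p ⟨hp, hb⟩
      by_contra hc
      simp only [mem_union, mem_ofPred_eq, not_or, not_and, not_not, not_lt] at hc
      obtain ⟨⟨⟨⟨a1, a2⟩, a3⟩, a4⟩, a5⟩ := hc
      exact hb (Good_Bd N r α j k h0 μ hμ p hJ (a1 hp) (a2 hp) (a3 hp) (a4 hp) (a5 hp))
    refine (measure_mono hsub).trans ((measure_union_le _ _).trans ?_)
    refine (add_le_add ((measure_union_le _ _).trans (add_le_add ((measure_union_le _ _).trans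
      (add_le_add ((measure_union_le _ _).trans (add_le_add v1 v2)) v3)) v4)) v5).trans ?_
    rw [← mul_add, ← mul_add, ← mul_add, ← mul_add]
    refine mul_le_mul_right ?_ _
    have t1 : ENNReal.ofReal 9600 = 9600 := by norm_num
    have t2 : ENNReal.ofReal 13500 = 13500 := by norm_num
    rw [t1, t2]
    refine le_trans (le_of_eq ?_) le_self_add
    ring
  · push Not at hJ
    refine (measure_mono (fun p hp => hp.1 : _ ⊆ T2)).trans ?_
    rw [volume_T2']
    have e : ENNReal.ofReal (4 * Real.pi ^ 2) = ENNReal.ofReal (1 / μ) * (2 * ENNReal.ofReal (2 * Real.pi ^ 2 * μ)) := by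
      have : (2 : ℝ≥0∞) = ENNReal.ofReal 2 := by simp
      rw [this, ← ENNReal.ofReal_mul (by norm_num), ← ENNReal.ofReal_mul (by positivity)]
      congr 1; field_simp; norm_num
    rw [e]
    refine mul_le_mul_right ?_ _
    refine le_trans ?_ le_add_self
    exact mul_le_mul_right (hJ.le.trans hL1) _

/-- being a trigonometric polynomial -/
def IsTp (h : ℝ × ℝ → ℝ) : Prop := ∃ N r α j k, ∀ p, h p = tp N r α j k p

lemma IsTp.add {g h : ℝ × ℝ → ℝ} (hg : IsTp g) (hh : IsTp h) : IsTp (fun p => g p + h p) := by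
  obtain ⟨N, r, α, j, k, e⟩ := hg
  obtain ⟨N', r', α', j', k', e'⟩ := hh
  refine ⟨N + N', fun i => if i < N then r i else r' (i - N), fun i => if i < N then α i else α' (i - N),
    fun i => if i < N then j i else j' (i - N), fun i => if i < N then k i else k' (i - N), fun p => ?_⟩
  beta_reduce
  rw [e, e']
  unfold tp
  rw [Finset.sum_range_add]
  congr 1
  · refine Finset.sum_congr rfl fun i hi => ?_
    simp [Finset.mem_range.1 hi]
  · refine Finset.sum_congr rfl fun i _ => ?_
    simp

lemma IsTp.zero : IsTp (fun _ => 0) := ⟨0, 0, 0, 0, 0, fun p => by simp [tp]⟩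

lemma IsTp.atom (r α : ℝ) (j k : ℤ) : IsTp (fun p => r * Real.cos (ph j k α p)) :=
  ⟨1, fun _ => r, fun _ => α, fun _ => j, fun _ => k, fun p => by simp [tp]⟩

/-- the map to the bicircle -/
def eT (p : ℝ × ℝ) : ℂ × ℂ := (Complex.exp (p.1 * Complex.I), Complex.exp (p.2 * Complex.I))

lemma eT_cont : Continuous eT := by unfold eT; fun_prop

/-- point of the unit torus -/
def phiT (p : ℝ × ℝ) : UnitAddTorus (Fin 2) := ![((p.1 / (2 * Real.pi) : ℝ) : AddCircle (1 : ℝ)), ((p.2 / (2 * Real.pi) : ℝ) : AddCircle (1 : ℝ))]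

lemma fourier_pt (n : ℤ) (x : ℝ) : fourier n ((x / (2 * Real.pi) : ℝ) : AddCircle (1 : ℝ)) = Complex.exp ((n * x : ℝ) * Complex.I) := by
  rw [fourier_coe_apply]
  congr 1
  have : (Real.pi : ℂ) ≠ 0 := by exact_mod_cast Real.pi_ne_zero
  push_cast
  field_simp

lemma isTp_span (h : C(UnitAddTorus (Fin 2), ℂ))
    (hh : h ∈ Submodule.span ℂ (range (UnitAddTorus.mFourier (d := Fin 2)))) (z : ℂ) :
    IsTp (fun p => (z * h (phiT p)).re) := by
  induction hh using Submodule.span_induction generalizing z with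
  | mem x hx =>
    obtain ⟨n, rfl⟩ := hx
    have : (fun p => (z * UnitAddTorus.mFourier n (phiT p)).re) =
        fun p => ‖z‖ * Real.cos (ph (n 0) (n 1) z.arg p) := by
      funext p
      have e : UnitAddTorus.mFourier n (phiT p) = Complex.exp ((n 0 * p.1 + n 1 * p.2 : ℝ) * Complex.I) := by
        simp only [UnitAddTorus.mFourier, ContinuousMap.coe_mk, Fin.prod_univ_two, phiT]
        simp only [Matrix.cons_val_zero, Matrix.cons_val_one]
        rw [fourier_pt, fourier_pt, ← Complex.exp_add]
        congr 1; push_cast; ring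
      rw [e]
      conv_lhs => rw [← Complex.norm_mul_exp_arg_mul_I z]
      rw [mul_assoc, ← Complex.exp_add, ← add_mul, ← Complex.ofReal_add, Complex.re_ofReal_mul, Complex.exp_ofReal_mul_I_re]
      unfold ph
      congr 2; ring
    rw [this]
    exact IsTp.atom _ _ _ _
  | zero => simpa using IsTp.zero
  | add x y _ _ hx hy =>
    have := (hx z).add (hy z)
    simpa [mul_add] using this
  | smul a x _ hx =>
    have := hx (z * a)
    simpa [mul_assoc] using this

lemma approx_cont (g : ℂ × ℂ → ℝ) (hg : Continuous g) (ε : ℝ) (hε : 0 < ε) :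
    ∃ N r α j k, ∀ p, |g (eT p) - tp N r α j k p| ≤ ε := by
  let G : C(UnitAddTorus (Fin 2), ℂ) := ⟨fun x => (g (fourier 1 (x 0), fourier 1 (x 1)) : ℂ), by
    fun_prop⟩
  have hG : G ∈ (Submodule.span ℂ (range (UnitAddTorus.mFourier (d := Fin 2)))).topologicalClosure := by
    rw [UnitAddTorus.span_mFourier_closure_eq_top]; trivial
  rw [← SetLike.mem_coe, Submodule.topologicalClosure_coe, Metric.mem_closure_iff] at hG
  obtain ⟨h, hh, hd⟩ := hG ε hε
  obtain ⟨N, r, α, j, k, e⟩ := isTp_span h hh 1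
  refine ⟨N, r, α, j, k, fun p => ?_⟩
  rw [← e p]; beta_reduce; rw [one_mul]
  have h1 : ‖(G - h) (phiT p)‖ ≤ ‖G - h‖ := ContinuousMap.norm_coe_le_norm _ _
  have h2 : G (phiT p) = (g (eT p) : ℂ) := by
    change ((g (fourier 1 (phiT p 0), fourier 1 (phiT p 1)) : ℝ) : ℂ) = _
    simp only [phiT, Matrix.cons_val_zero, Matrix.cons_val_one]
    rw [fourier_pt, fourier_pt]
    simp [eT]
  have h3 := Complex.abs_re_le_norm ((G - h) (phiT p))
  rw [ContinuousMap.sub_apply, h2, Complex.sub_re, Complex.ofReal_re] at h3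
  rw [dist_eq_norm] at hd
  rw [ContinuousMap.sub_apply, h2] at h1
  linarith

lemma approx_bdd (f : ℝ × ℝ → ℝ) (hm : Measurable f) (K : ℝ) (hK : 0 ≤ K)
    (h0 : ∀ p, 0 ≤ f p) (h1 : ∀ p, f p ≤ K) (ε : ℝ) (hε : 0 < ε) :
    ∃ g : ℂ × ℂ → ℝ, Continuous g ∧ (∀ z, 0 ≤ g z) ∧ (∀ z, g z ≤ K) ∧
      ∫⁻ p in T2, ENNReal.ofReal |f p - g (eT p)| ≤ ENNReal.ofReal ε := by
  let μ : Measure (ℂ × ℂ) := (volume.restrict (II ×ˢ II)).map eT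
  have hfin : IsFiniteMeasure (volume.restrict (II ×ˢ II) : Measure (ℝ × ℝ)) :=
    ⟨by
      have := II2_lint (fun _ => 1)
      rw [lintegral_one, lintegral_one, Measure.restrict_apply_univ T2] at this
      rw [this, volume_T2]; exact ENNReal.mul_lt_top ENNReal.ofReal_lt_top ENNReal.ofReal_lt_top⟩
  have hμ : IsFiniteMeasure μ := inferInstance
  let F : ℂ × ℂ → ℝ := fun z => f (z.1.arg, z.2.arg)
  have hF : Measurable F := hm.comp
    ((Complex.measurable_arg.comp measurable_fst).prodMk (Complex.measurable_arg.comp measurable_snd))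
  have hFi : Integrable F μ := by
    refine Integrable.of_bound hF.aestronglyMeasurable K (Eventually.of_forall fun z => ?_)
    rw [Real.norm_eq_abs, abs_of_nonneg (h0 _)]; exact h1 _
  obtain ⟨g, hg, -⟩ := hFi.exists_boundedContinuous_lintegral_sub_le (ε := ENNReal.ofReal ε) (by simpa using hε)
  refine ⟨fun z => max 0 (min K (g z)), by fun_prop, fun z => le_max_left _ _,
    fun z => max_le hK (min_le_left _ _), ?_⟩
  rw [lintegral_map (by fun_prop) eT_cont.measurable] at hg
  rw [← II2_lint]
  refine le_trans ?_ hg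
  refine lintegral_mono_ae ?_
  have hne : ∀ᵐ p ∂(volume.restrict (II ×ˢ II) : Measure (ℝ × ℝ)), p ∈ II ×ˢ II :=
    ae_restrict_mem (measurableSet_II.prod measurableSet_II)
  refine hne.mono fun p hp => ?_
  have harg : ∀ x ∈ II, (Complex.exp (x * Complex.I)).arg = x := by
    intro x hx
    rw [Complex.arg_exp_mul_I]
    exact (toIocMod_eq_self _).2 ⟨hx.1, by linarith [hx.2]⟩
  have hFe : F (eT p) = f p := by
    change f ((Complex.exp (p.1 * Complex.I)).arg, (Complex.exp (p.2 * Complex.I)).arg) = _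
    rw [harg _ hp.1, harg _ hp.2]
  rw [hFe, ← ofReal_norm, Real.norm_eq_abs]
  refine ENNReal.ofReal_le_ofReal ?_
  have e : f p = max 0 (min K (f p)) := by rw [min_eq_right (h1 p), max_eq_right (h0 p)]
  conv_lhs => rw [e]
  refine (abs_max_sub_max_le_max _ _ _ _).trans ?_
  rw [sub_self, abs_zero, max_eq_right (abs_nonneg _)]
  refine (abs_min_sub_min_le_max _ _ _ _).trans ?_
  rw [sub_self, abs_zero, max_eq_right (abs_nonneg _)]

lemma PhiY_lip (R a b : ℝ) (hR : 1 ≤ R) (ha : 0 ≤ a) (_hb : 0 ≤ b) (hbR : b ≤ R) :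
    PhiY b ≤ PhiY a + (1 + Real.log R) * |a - b| := by
  have hl : 0 ≤ Real.log R := Real.log_nonneg hR
  have hpos : 0 ≤ (1 + Real.log R) * |a - b| := by positivity
  have hP := PhiY_nonneg a ha
  unfold PhiY logPlus at *
  split_ifs at * with h1 h2 h2
  · by_cases hab : b ≤ a
    · have : b * Real.log b ≤ a * Real.log a :=
        mul_le_mul hab (Real.log_le_log (by linarith) hab) (Real.log_nonneg h1.le) ha
      linarith
    · push Not at hab
      have e : |a - b| = b - a := by rw [abs_sub_comm, abs_of_pos (by linarith)]
      rw [e]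
      have h3 : Real.log b ≤ Real.log R := Real.log_le_log (by linarith) hbR
      have h4 : Real.log (b / a) ≤ b / a - 1 := Real.log_le_sub_one_of_pos (by positivity)
      rw [Real.log_div (by linarith) (by linarith)] at h4
      have h5 : a * (Real.log b - Real.log a) ≤ b - a := by
        calc _ ≤ a * (b / a - 1) := mul_le_mul_of_nonneg_left h4 ha
          _ = b - a := by field_simp
      nlinarith [mul_le_mul_of_nonneg_left h3 (sub_nonneg.2 hab.le)]
  · have e : |a - b| = b - a := by rw [abs_sub_comm, abs_of_pos (by linarith)]
    rw [e]
    have h3 : Real.log b ≤ Real.log R := Real.log_le_log (by linarith) hbR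
    have h4 : Real.log b ≤ b - 1 := Real.log_le_sub_one_of_pos (by linarith)
    nlinarith [mul_le_mul_of_nonneg_left h3 (sub_nonneg.2 h1.le), mul_nonneg hl (sub_nonneg.2 (not_lt.1 h2))]
  · linarith
  · linarith

lemma PhiY_mono {a b : ℝ} (ha : 0 ≤ a) (hab : a ≤ b) : PhiY a ≤ PhiY b := by
  have hP := PhiY_nonneg b (ha.trans hab)
  unfold PhiY logPlus at *
  split_ifs at * with h1 h2 h2
  · exact mul_le_mul hab (Real.log_le_log (by linarith) hab) (Real.log_nonneg h1.le) (by linarith)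
  · linarith
  · linarith
  · linarith

lemma approx1 (f : ℝ × ℝ → ℝ) (hm : Measurable f) (K : ℝ) (hK : 1 ≤ K)
    (h0 : ∀ p, 0 ≤ f p) (h1 : ∀ p, f p ≤ K) (ε : ℝ) (hε : 0 < ε) :
    ∃ N r α j k, (∀ p, 0 ≤ tp N r α j k p) ∧ (∀ p, tp N r α j k p ≤ K + 1) ∧
      ∫⁻ p in T2, ENNReal.ofReal |f p - tp N r α j k p| ≤ ENNReal.ofReal ε := by
  obtain ⟨g, gc, g0, g1, gi⟩ := approx_bdd f hm K (by linarith) h0 h1 (ε / 2) (by positivity)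
  have hπ := Real.pi_pos
  let η := min (1 / 2) (ε / (16 * Real.pi ^ 2))
  have hη : 0 < η := lt_min (by norm_num) (by positivity)
  have hη1 : η ≤ 1 / 2 := min_le_left _ _
  have hη2 : η ≤ ε / (16 * Real.pi ^ 2) := min_le_right _ _
  obtain ⟨N, r, α, j, k, ht⟩ := approx_cont (fun z => g z + η) (by fun_prop) η hη
  refine ⟨N, r, α, j, k, fun p => ?_, fun p => ?_, ?_⟩
  · have := abs_le.1 (ht p); linarith [g0 (eT p)]
  · have := abs_le.1 (ht p); linarith [g1 (eT p)]
  · calc _ ≤ ∫⁻ p in T2, (ENNReal.ofReal |f p - g (eT p)| + ENNReal.ofReal (2 * η)) := by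
          refine lintegral_mono fun p => ?_
          rw [← ENNReal.ofReal_add (abs_nonneg _) (by linarith)]
          refine ENNReal.ofReal_le_ofReal ?_
          have e : f p - tp N r α j k p = (f p - g (eT p)) + (g (eT p) + η - tp N r α j k p) + (-η) := by ring
          rw [e]
          refine (abs_add_le _ _).trans ?_
          refine (add_le_add_left (abs_add_le _ _) _).trans ?_
          rw [abs_neg, abs_of_pos hη]
          linarith [ht p]
      _ ≤ ENNReal.ofReal (ε / 2) + ENNReal.ofReal (2 * η) * volume T2 := by
          rw [lintegral_add_right _ measurable_const, lintegral_const, Measure.restrict_apply_univ]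
          gcongr
      _ ≤ ENNReal.ofReal ε := by
          rw [volume_T2', ← ENNReal.ofReal_mul (by linarith), ← ENNReal.ofReal_add (by linarith) (by positivity)]
          refine ENNReal.ofReal_le_ofReal ?_
          rw [le_div_iff₀ (by positivity)] at hη2
          nlinarith

lemma approx (f : ℝ × ℝ → ℝ) (hm : Measurable f) (h0 : ∀ p, 0 ≤ f p)
    (hi : ∫⁻ p in T2, ENNReal.ofReal (f p) ≠ ∞) (ε : ℝ) (hε : 0 < ε) :
    ∃ N r α j k, (∀ p, 0 ≤ tp N r α j k p) ∧
      ∫⁻ p in T2, ENNReal.ofReal |f p - tp N r α j k p| ≤ ENNReal.ofReal ε ∧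
      ∫⁻ p in T2, ENNReal.ofReal (PhiY (tp N r α j k p)) ≤ (∫⁻ p in T2, ENNReal.ofReal (PhiY (f p))) + 1 := by
  have hlim : Tendsto (fun n : ℕ => ∫⁻ p in T2, ENNReal.ofReal |f p - min (f p) n|) atTop (nhds (∫⁻ p in T2, 0)) := by
    refine tendsto_lintegral_of_dominated_convergence (fun p => ENNReal.ofReal (f p)) (fun n => by fun_prop) (fun n => ?_) hi ?_
    · refine Eventually.of_forall fun p => ENNReal.ofReal_le_ofReal ?_
      have h2 : 0 ≤ min (f p) n := le_min (h0 p) (by positivity)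
      rw [abs_of_nonneg (by linarith [min_le_left (f p) n])]; linarith
    · refine Eventually.of_forall fun p => ?_
      refine tendsto_const_nhds.congr' ?_
      filter_upwards [eventually_ge_atTop ⌈f p⌉₊] with n hn
      rw [min_eq_left (Nat.ceil_le.1 hn)]; simp
  rw [lintegral_zero] at hlim
  obtain ⟨n, hn1, hn⟩ := ((hlim.eventually_lt_const (u := ENNReal.ofReal (ε / 2)) (by simpa using hε)).and
    (eventually_ge_atTop 1)).exists
  have hK : (1 : ℝ) ≤ n := by exact_mod_cast hn
  have hl : 0 ≤ Real.log (n + 1) := Real.log_nonneg (by linarith)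
  let ε' := min (ε / 2) (1 / (1 + Real.log (n + 1)))
  have hε' : 0 < ε' := lt_min (by positivity) (by positivity)
  obtain ⟨N, r, α, j, k, t0, t1, ti⟩ := approx1 (fun p => min (f p) n) (by fun_prop) n hK
    (fun p => le_min (h0 p) (by positivity)) (fun p => min_le_right _ _) ε' hε'
  refine ⟨N, r, α, j, k, t0, ?_, ?_⟩
  · calc _ ≤ ∫⁻ p in T2, (ENNReal.ofReal |f p - min (f p) n| + ENNReal.ofReal |min (f p) n - tp N r α j k p|) := by
          refine lintegral_mono fun p => ?_
          rw [← ENNReal.ofReal_add (abs_nonneg _) (abs_nonneg _)]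
          exact ENNReal.ofReal_le_ofReal (abs_sub_le _ _ _)
      _ ≤ ENNReal.ofReal (ε / 2) + ENNReal.ofReal ε' := by
          rw [lintegral_add_left (by fun_prop)]
          exact add_le_add hn1.le ti
      _ ≤ ENNReal.ofReal ε := by
          rw [← ENNReal.ofReal_add (by linarith) hε'.le]
          refine ENNReal.ofReal_le_ofReal ?_
          linarith [min_le_left (ε / 2) (1 / (1 + Real.log (n + 1)))]
  · have hc : 0 ≤ 1 + Real.log (n + 1) := by linarith
    calc _ ≤ ∫⁻ p in T2, (ENNReal.ofReal (PhiY (f p)) + ENNReal.ofReal (1 + Real.log (n + 1)) * ENNReal.ofReal |min (f p) n - tp N r α j k p|) := by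
          refine lintegral_mono fun p => ?_
          rw [← ENNReal.ofReal_mul hc, ← ENNReal.ofReal_add (PhiY_nonneg _ (h0 p)) (by positivity)]
          refine ENNReal.ofReal_le_ofReal ?_
          have hmin : 0 ≤ min (f p) n := le_min (h0 p) (by positivity)
          have := PhiY_lip (n + 1) (min (f p) n) (tp N r α j k p) (by linarith) hmin (t0 p) (t1 p)
          linarith [PhiY_mono hmin (min_le_left (f p) n)]
      _ ≤ (∫⁻ p in T2, ENNReal.ofReal (PhiY (f p))) + ENNReal.ofReal (1 + Real.log (n + 1)) * ENNReal.ofReal ε' := by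
          have hmm : Measurable (fun p => ENNReal.ofReal (PhiY (f p))) := (measurable_PhiY.comp hm).ennreal_ofReal
          rw [lintegral_add_left hmm, lintegral_const_mul' _ _ ENNReal.ofReal_ne_top]
          exact add_le_add_right (mul_le_mul_right ti _) _
      _ ≤ _ := by
          gcongr
          rw [← ENNReal.ofReal_mul hc, ← ENNReal.ofReal_one]
          refine ENNReal.ofReal_le_ofReal ?_
          calc _ ≤ (1 + Real.log (n + 1)) * (1 / (1 + Real.log (n + 1))) := mul_le_mul_of_nonneg_left (min_le_right _ _) hc
            _ = 1 := by field_simp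

lemma shift_int (f : ℝ × ℝ → ℝ) (hm : Measurable f) (hp : Bip f)
    (hi : ∫⁻ p in T2, ENNReal.ofReal |f p| ≠ ∞) (p : ℝ × ℝ) :
    IntegrableOn (fun q => f (p + q)) (II ×ˢ II) := by
  have hm2 : Measurable (fun q => f (p + q)) := hm.comp (measurable_const.add measurable_id)
  refine ⟨hm2.aestronglyMeasurable, ?_⟩
  rw [hasFiniteIntegral_iff_norm]
  simp only [Real.norm_eq_abs]
  rw [II2_shift (fun q => ENNReal.ofReal |f q|) (by fun_prop) (hp.comp fun x => ENNReal.ofReal |x|) p]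
  exact lt_top_iff_ne_top.2 hi

lemma SS_sub (n : ℕ) (f g : ℝ × ℝ → ℝ) (p : ℝ × ℝ)
    (hf : IntegrableOn (fun q => f (p + q)) (II ×ˢ II)) (hg : IntegrableOn (fun q => g (p + q)) (II ×ˢ II)) :
    SS n (fun q => f q - g q) p = SS n f p - SS n g p := by
  unfold SS
  rw [← mul_sub]
  congr 1
  unfold KK
  rw [← integral_sub (KK_integrable (BM_Dst n) f p hf) (KK_integrable (BM_Dst n) g p hg)]
  simp only [mul_sub]

lemma SS_close (n : ℕ) (f g : ℝ × ℝ → ℝ) (hfm : Measurable f) (hgm : Measurable g) (hfp : Bip f) (hgp : Bip g)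
    (hf : ∫⁻ p in T2, ENNReal.ofReal |f p| ≠ ∞) (hg : ∫⁻ p in T2, ENNReal.ofReal |g p| ≠ ∞) (ε : ℝ) (hε : 0 ≤ ε)
    (h : ∫⁻ p in T2, ENNReal.ofReal |f p - g p| ≤ ENNReal.ofReal ε) (p : ℝ × ℝ) :
    |SS n f p - SS n g p| ≤ n ^ 2 * ε := by
  rw [← SS_sub n f g p (shift_int f hfm hfp hf p) (shift_int g hgm hgp hg p)]
  have h1 := (KK_le (Dst n) n (by positivity) (Dst_le_n n) (fun q => f q - g q) (hfm.sub hgm)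
    (fun x y => ⟨by beta_reduce; rw [(hfp x y).1, (hgp x y).1], by beta_reduce; rw [(hfp x y).2, (hgp x y).2]⟩) p).trans
    (mul_le_mul_right h _)
  rw [← ENNReal.ofReal_mul (by positivity), ENNReal.ofReal_le_ofReal_iff (by positivity)] at h1
  unfold SS
  rw [abs_mul]
  have h2 : |1 / Real.pi ^ 2| ≤ 1 := by
    rw [abs_of_nonneg (by positivity), div_le_one (by positivity)]
    nlinarith [Real.pi_gt_three]
  exact (mul_le_of_le_one_left (abs_nonneg _) h2).trans h1

lemma main_pos : ∃ C : ℝ, 0 < C ∧ ∀ f : ℝ × ℝ → ℝ, Measurable f → Bip f → (∀ p, 0 ≤ f p) →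
    ∫⁻ p in T2, ENNReal.ofReal |f p| ≠ ∞ → ∀ μ : ℝ, 0 < μ →
    volume {p | p ∈ T2 ∧ ¬ ∀ K, BdK K (fun n => SS (n + 1) f p) (2 * μ)} ≤
      ENNReal.ofReal (C / μ) * (2 + ∫⁻ q in T2, ENNReal.ofReal (PhiY (f q))) := by
  obtain ⟨C, hC, H⟩ := main_tp
  refine ⟨C, hC, fun f hm hp h0 hi μ hμ => ?_⟩
  have hU : {p | p ∈ T2 ∧ ¬ ∀ K, BdK K (fun n => SS (n + 1) f p) (2 * μ)} =
      ⋃ K : ℕ, {p | p ∈ T2 ∧ ¬ BdK K (fun n => SS (n + 1) f p) (2 * μ)} := by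
    ext p; simp
  have hmono : Monotone (fun K : ℕ => {p | p ∈ T2 ∧ ¬ BdK K (fun n => SS (n + 1) f p) (2 * μ)}) :=
    fun K K' hK p hp => ⟨hp.1, fun h => hp.2 (h.anti hK)⟩
  rw [hU, hmono.measure_iUnion]
  refine iSup_le fun K => ?_
  obtain ⟨N, r, α, j, k, t0, t1, t2⟩ := approx f hm h0 (by simpa only [abs_of_nonneg (h0 _)] using hi)
    (μ / (K + 1) ^ 2) (by positivity)
  have htm := (tp_cont N r α j k).measurable
  have hti : ∫⁻ p in T2, ENNReal.ofReal |tp N r α j k p| ≠ ∞ := by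
    refine ne_top_of_le_ne_top (ENNReal.add_ne_top.2 ⟨hi, ENNReal.ofReal_ne_top (r := μ / (K + 1) ^ 2)⟩) ?_
    calc _ ≤ ∫⁻ p in T2, (ENNReal.ofReal |f p| + ENNReal.ofReal |f p - tp N r α j k p|) := by
          refine lintegral_mono fun p => ?_
          rw [← ENNReal.ofReal_add (abs_nonneg _) (abs_nonneg _)]
          refine ENNReal.ofReal_le_ofReal ?_
          have := abs_sub (f p) (f p - tp N r α j k p)
          rwa [sub_sub_cancel] at this
      _ ≤ _ := by
          rw [lintegral_add_left (by fun_prop)]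
          exact add_le_add_right t1 _
  refine (measure_mono (t := {p | p ∈ T2 ∧ ¬ ∀ K, BdK K (fun n => SS (n + 1) (tp N r α j k) p) μ}) ?_).trans
    ((H N r α j k t0 μ hμ).trans (mul_le_mul_right ?_ _))
  · rintro p ⟨hpT, hpB⟩
    refine ⟨hpT, fun hall => hpB ?_⟩
    rw [two_mul]
    refine (hall K).pert fun n hn => ?_
    rw [abs_sub_comm]
    refine (SS_close (n + 1) f _ hm htm hp (tp_bip N r α j k) hi hti _ (by positivity) t1 p).trans ?_
    have h1 : ((n + 1 : ℕ) : ℝ) ≤ K + 1 := by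
      have : ((n + 1 : ℕ) : ℝ) ≤ K := by exact_mod_cast hn
      linarith
    calc ((n + 1 : ℕ) : ℝ) ^ 2 * (μ / (K + 1) ^ 2) ≤ ((K : ℝ) + 1) ^ 2 * (μ / (K + 1) ^ 2) := by gcongr
      _ = μ := by field_simp
  · refine (add_le_add_right t2 1).trans (le_of_eq ?_)
    rw [add_comm _ (1 : ℝ≥0∞), ← add_assoc]; norm_num

lemma main_all : ∃ C : ℝ, 0 < C ∧ ∀ f : ℝ × ℝ → ℝ, Measurable f → Bip f →
    ∫⁻ p in T2, ENNReal.ofReal |f p| ≠ ∞ → ∀ μ : ℝ, 0 < μ →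
    volume {p | p ∈ T2 ∧ ¬ ∀ K, BdK K (fun n => SS (n + 1) f p) (4 * μ)} ≤
      ENNReal.ofReal (C / μ) * (1 + ∫⁻ q in T2, ENNReal.ofReal (PhiY |f q|)) := by
  obtain ⟨C, hC, H⟩ := main_pos
  refine ⟨4 * C, by positivity, fun f hm hp hi μ hμ => ?_⟩
  have hle1 : ∀ p, |max (f p) 0| ≤ |f p| := fun p => by
    rw [abs_of_nonneg (le_max_right _ _)]; exact max_le (le_abs_self _) (abs_nonneg _)
  have hle2 : ∀ p, |max (-f p) 0| ≤ |f p| := fun p => by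
    rw [abs_of_nonneg (le_max_right _ _)]; exact max_le (neg_le_abs _) (abs_nonneg _)
  have hm1 : Measurable (fun p => max (f p) 0) := by fun_prop
  have hm2 : Measurable (fun p => max (-f p) 0) := by fun_prop
  have hp1 : Bip (fun p => max (f p) 0) := hp.comp fun x => max x 0
  have hp2 : Bip (fun p => max (-f p) 0) := hp.comp fun x => max (-x) 0
  have hi1 : ∫⁻ p in T2, ENNReal.ofReal |max (f p) 0| ≠ ∞ :=
    ne_top_of_le_ne_top hi (lintegral_mono fun p => ENNReal.ofReal_le_ofReal (hle1 p))
  have hi2 : ∫⁻ p in T2, ENNReal.ofReal |max (-f p) 0| ≠ ∞ :=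
    ne_top_of_le_ne_top hi (lintegral_mono fun p => ENNReal.ofReal_le_ofReal (hle2 p))
  have H1 := H _ hm1 hp1 (fun p => le_max_right _ _) hi1 μ hμ
  have H2 := H _ hm2 hp2 (fun p => le_max_right _ _) hi2 μ hμ
  have hΦ1 : ∫⁻ q in T2, ENNReal.ofReal (PhiY (max (f q) 0)) ≤ ∫⁻ q in T2, ENNReal.ofReal (PhiY |f q|) :=
    lintegral_mono fun p => ENNReal.ofReal_le_ofReal (PhiY_mono (le_max_right _ _) ((le_abs_self _).trans (hle1 p)))
  have hΦ2 : ∫⁻ q in T2, ENNReal.ofReal (PhiY (max (-f q) 0)) ≤ ∫⁻ q in T2, ENNReal.ofReal (PhiY |f q|) :=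
    lintegral_mono fun p => ENNReal.ofReal_le_ofReal (PhiY_mono (le_max_right _ _) ((le_abs_self _).trans (hle2 p)))
  calc _ ≤ volume ({p | p ∈ T2 ∧ ¬ ∀ K, BdK K (fun n => SS (n + 1) (fun p => max (f p) 0) p) (2 * μ)} ∪
        {p | p ∈ T2 ∧ ¬ ∀ K, BdK K (fun n => SS (n + 1) (fun p => max (-f p) 0) p) (2 * μ)}) := by
        refine measure_mono ?_
        rintro p ⟨hpT, hpB⟩
        by_contra hcon
        rw [mem_union, not_or] at hcon
        obtain ⟨c1, c2⟩ := hcon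
        have c1' : ∀ K, BdK K (fun n => SS (n + 1) (fun p => max (f p) 0) p) (2 * μ) := by
          by_contra h; exact c1 ⟨hpT, h⟩
        have c2' : ∀ K, BdK K (fun n => SS (n + 1) (fun p => max (-f p) 0) p) (2 * μ) := by
          by_contra h; exact c2 ⟨hpT, h⟩
        refine hpB fun K => ?_
        have h3 := (c1' K).sub (c2' K)
        have e : (fun n => SS (n + 1) (fun p => max (f p) 0) p - SS (n + 1) (fun p => max (-f p) 0) p) =
            fun n => SS (n + 1) f p := by
          funext n
          rw [← SS_sub (n + 1) _ _ p (shift_int _ hm1 hp1 hi1 p) (shift_int _ hm2 hp2 hi2 p)]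
          congr 1
          funext q
          rcases le_total (f q) 0 with h | h
          · rw [max_eq_right h, max_eq_left (by linarith)]; ring
          · rw [max_eq_left h, max_eq_right (by linarith)]; ring
        rw [e] at h3
        exact h3.mono (by linarith)
    _ ≤ ENNReal.ofReal (C / μ) * (2 + ∫⁻ q in T2, ENNReal.ofReal (PhiY |f q|)) +
        ENNReal.ofReal (C / μ) * (2 + ∫⁻ q in T2, ENNReal.ofReal (PhiY |f q|)) := by
        refine (measure_union_le _ _).trans (add_le_add (H1.trans ?_) (H2.trans ?_))
        · exact mul_le_mul_right (add_le_add_right hΦ1 _) _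
        · exact mul_le_mul_right (add_le_add_right hΦ2 _) _
    _ ≤ _ := by
        have e : ENNReal.ofReal (4 * C / μ) = ENNReal.ofReal (C / μ) * 4 := by
          rw [mul_div_assoc, ENNReal.ofReal_mul (by norm_num), mul_comm]; norm_num
        rw [e, ← mul_add, mul_assoc]
        refine mul_le_mul_right ?_ _
        rw [mul_add]
        set J := ∫⁻ q in T2, ENNReal.ofReal (PhiY |f q|)
        calc 2 + J + (2 + J) = 4 * 1 + 2 * J := by ring
          _ ≤ 4 * 1 + 4 * J := by
            refine add_le_add_right (mul_le_mul_left ?_ _) _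
            norm_num

lemma pv_eq (n : ℕ) (f : ℝ × ℝ → ℝ) (p : ℝ × ℝ) (hf : IntegrableOn (fun q => f (p + q)) (II ×ˢ II)) (L : ℝ)
    (h : pvT2 (fun q => (1 / Real.pi ^ 2) *
              (Real.sin ((n : ℝ) * q.1) * Real.sin ((n : ℝ) * q.2) /
                (4 * Real.tan (q.1 / 2) * Real.tan (q.2 / 2))) * f (p.1 + q.1, p.2 + q.2)) L) :
    L = SS n f p := by
  have e : (fun q : ℝ × ℝ => (1 / Real.pi ^ 2) *
              (Real.sin ((n : ℝ) * q.1) * Real.sin ((n : ℝ) * q.2) /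
                (4 * Real.tan (q.1 / 2) * Real.tan (q.2 / 2))) * f (p.1 + q.1, p.2 + q.2)) =
      fun q => (1 / Real.pi ^ 2) * (Dst n q.1 * Dst n q.2 * f (p + q)) := by
    funext q
    change _ = (1 / Real.pi ^ 2) * (Dst n q.1 * Dst n q.2 * f (p.1 + q.1, p.2 + q.2))
    unfold Dst ct
    rw [div_eq_mul_inv _ (4 * Real.tan (q.1 / 2) * Real.tan (q.2 / 2)), mul_inv, mul_inv]
    ring
  rw [e] at h
  have hi := (KK_integrable (BM_Dst n) f p hf).const_mul (1 / Real.pi ^ 2)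
  have hS : SS n f p = ∫ q in II ×ˢ II, (1 / Real.pi ^ 2) * (Dst n q.1 * Dst n q.2 * f (p + q)) := by
    unfold SS KK
    rw [integral_const_mul]
  rw [hS]
  unfold pvT2 at h
  refine tendsto_nhds_unique h ?_
  set G : ℝ × ℝ → ℝ := fun q => (1 / Real.pi ^ 2) * (Dst n q.1 * Dst n q.2 * f (p + q)) with hG
  let A : ℝ → Set (ℝ × ℝ) := fun ε => {q : ℝ × ℝ | (ε < |q.1| ∧ |q.1| < Real.pi) ∧ ε < |q.2| ∧ |q.2| < Real.pi}
  have hA : ∀ ε, MeasurableSet (A ε) := fun ε => by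
    have a1 : Measurable fun q : ℝ × ℝ => |q.1| := by fun_prop
    have a2 : Measurable fun q : ℝ × ℝ => |q.2| := by fun_prop
    exact ((measurableSet_lt measurable_const a1).inter (measurableSet_lt a1 measurable_const)).inter
      ((measurableSet_lt measurable_const a2).inter (measurableSet_lt a2 measurable_const))
  have hAs : ∀ ε, A ε ⊆ II ×ˢ II := fun ε q hq => ⟨abs_lt.1 hq.1.2, abs_lt.1 hq.2.2⟩
  have hAI : ∀ ε, ∫ q in A ε, G q = ∫ q in II ×ˢ II, (A ε).indicator G q := fun ε => by
    rw [setIntegral_indicator (hA ε), inter_eq_right.2 (hAs ε)]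
  change Tendsto (fun ε => ∫ q in A ε, G q) _ _
  simp only [hAI]
  refine tendsto_integral_filter_of_dominated_convergence (fun q => ‖G q‖) ?_ ?_ hi.norm ?_
  · exact Eventually.of_forall fun ε => hi.aestronglyMeasurable.indicator (hA ε)
  · exact Eventually.of_forall fun ε => Eventually.of_forall fun q => norm_indicator_le_norm_self _ _
  · refine (ae_restrict_mem (measurableSet_II.prod measurableSet_II)).mono fun q hq => ?_
    refine tendsto_const_nhds.congr' ?_
    have hD : Dst n 0 = 0 := by simp [Dst]
    by_cases h1 : q.1 = 0
    · have : G q = 0 := by rw [hG]; beta_reduce; rw [h1, hD]; ring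
      exact Eventually.of_forall fun ε => (by change G q = (A ε).indicator G q; rw [indicator_apply, this, ite_self])
    by_cases h2 : q.2 = 0
    · have : G q = 0 := by rw [hG]; beta_reduce; rw [h2, hD]; ring
      exact Eventually.of_forall fun ε => (by change G q = (A ε).indicator G q; rw [indicator_apply, this, ite_self])
    have hpos : 0 < min |q.1| |q.2| := lt_min (abs_pos.2 h1) (abs_pos.2 h2)
    filter_upwards [mem_nhdsWithin_of_mem_nhds (Iio_mem_nhds hpos)] with ε hε
    have hε' : ε < min |q.1| |q.2| := hε
    rw [indicator_of_mem]
    exact ⟨⟨hε'.trans_le (min_le_left _ _), abs_lt.2 hq.1⟩, hε'.trans_le (min_le_right _ _), abs_lt.2 hq.2⟩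

end Helpers

/-- for `f ∈ L log L(𝕋²)` and the modified quadratic partial sums
`S*_{nn}(x,y,f) = (1/π²) p.v. ∬_{𝕋²} [sin(nt) sin(ns) / (4 tan(t/2) tan(s/2))]
  f(x+t, y+s) dt ds` (`n ≥ 1`, a.e. `(x,y)`), one has the weak type estimate
`|{(x,y) ∈ 𝕋² : bmo[S*_{nn}(x,y,f)] > λ}| ≤ (c/λ)(1 + ∬ |f| log⁺|f|)`
for an absolute constant `c > 0`. -/
theorem bmo_weak_type_SnnStar :
    ∃ c : ℝ, 0 < c ∧ ∀ f : ℝ × ℝ → ℝ, Measurable f → Biperiodic f →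
      IntegrableOn f T2 → IntegrableOn (fun p => |f p| * logPlus |f p|) T2 →
      ∀ Sstar : ℕ → ℝ × ℝ → ℝ,
        (∀ n : ℕ, 1 ≤ n → ∀ᵐ p : ℝ × ℝ,
          pvT2 (fun q => (1 / Real.pi ^ 2) *
              (Real.sin ((n : ℝ) * q.1) * Real.sin ((n : ℝ) * q.2) /
                (4 * Real.tan (q.1 / 2) * Real.tan (q.2 / 2))) * f (p.1 + q.1, p.2 + q.2))
            (Sstar n p)) →
        ∀ lam : ℝ, 0 < lam →
          volume {p : ℝ × ℝ | p ∈ T2 ∧ lam < bmoSeq (fun k => Sstar (k + 1) p)} ≤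
            ENNReal.ofReal ((c / lam) * (1 + ∫ p in T2, |f p| * logPlus |f p|)) := by
  obtain ⟨C, hC, H⟩ := main_all
  refine ⟨28 * C, by positivity, fun f hm hp hf hfl Sstar hS lam hlam => ?_⟩
  have hp' : Bip f := hp
  have hi : ∫⁻ p in T2, ENNReal.ofReal |f p| ≠ ⊤ := by
    have := hf.2
    rw [hasFiniteIntegral_iff_norm] at this
    exact this.ne
  have hae : ∀ᵐ p : ℝ × ℝ, ∀ k : ℕ, Sstar (k + 1) p = SS (k + 1) f p := by
    rw [ae_all_iff]
    intro k
    filter_upwards [hS (k + 1) (by omega)] with p hp2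
    exact pv_eq (k + 1) f p (shift_int f hm hp' hi p) _ hp2
  have h0 : ∀ p, 0 ≤ |f p| * logPlus |f p| := fun p => PhiY_nonneg _ (abs_nonneg (f p))
  have hI : ∫⁻ q in T2, ENNReal.ofReal (PhiY |f q|) = ENNReal.ofReal (∫ p in T2, |f p| * logPlus |f p|) :=
    (ofReal_integral_eq_lintegral_ofReal hfl (Eventually.of_forall h0)).symm
  have hJ : 0 ≤ ∫ p in T2, |f p| * logPlus |f p| := integral_nonneg h0
  have key := H f hm hp' hi (lam / 28) (by positivity)
  calc _ ≤ volume {p | p ∈ T2 ∧ ¬ ∀ K, BdK K (fun n => SS (n + 1) f p) (4 * (lam / 28))} := by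
        refine measure_mono_ae ?_
        filter_upwards [hae] with p hp2
        rintro ⟨hpT, hlt⟩
        refine ⟨hpT, fun hall => ?_⟩
        have h3 : (fun k => Sstar (k + 1) p) = fun n => SS (n + 1) f p := funext hp2
        rw [h3] at hlt
        have := bmoSeq_le _ _ (by positivity) hall
        linarith
    _ ≤ _ := key
    _ = _ := by
        rw [hI, ← ENNReal.ofReal_one, ← ENNReal.ofReal_add zero_le_one hJ, ← ENNReal.ofReal_mul (by positivity)]
        congr 2
        field_simp
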